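/- Let N ≥ 3, μ ∈ (0, μ₀) with μ₀ = (N-2)²/4, and let V ∈ C^γ_loc(ℝ^N∖{0}) (γ ∈ (0,1)) be a positive potential satisfying |x|^{-2} - c₅ ≤ V(x) ≤ |x|^{-2} for all x ∈ ℝ^N∖{0}, for some c₅ > 0, and additionally limsup_{|x|→+∞} V(x)|x|^τ < +∞ for some τ > 2. Let u_k be the minimal positive classical solution of -Δu - μVu = 0 in ℝ^N∖{0} satisfying the dμ-distributional identity with constant k > 0. Then there exists c₇ > 0 such that u_k(x) ≤ c₇|x|^{2-N} for all x ∈ ℝ^N with |x| ≥ 1. -/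

import Mathlib

open Filter MeasureTheory Metric

noncomputable section

/-- Euclidean space ℝ^N. -/
abbrev Euc (N : ℕ) : Type := EuclideanSpace ℝ (Fin N)

/-- The Laplacian of `u` at `x`, as the sum of the pure second derivatives in the
coordinate directions. -/
def lap {N : ℕ} (u : Euc N → ℝ) (x : Euc N) : ℝ :=
  ∑ i : Fin N, fderiv ℝ (fun y => fderiv ℝ u y (EuclideanSpace.single i 1)) x
    (EuclideanSpace.single i 1)

/-- μ₀ = (N-2)²/4. -/
def mu0 (N : ℕ) : ℝ := ((N : ℝ) - 2) ^ 2 / 4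

/-- τ₋(μ) = -(N-2)/2 - √(μ₀-μ). -/
def tauMinus (N : ℕ) (μ : ℝ) : ℝ := -((N : ℝ) - 2) / 2 - Real.sqrt (mu0 N - μ)

/-- τ₊(μ) = -(N-2)/2 + √(μ₀-μ). -/
def tauPlus (N : ℕ) (μ : ℝ) : ℝ := -((N : ℝ) - 2) / 2 + Real.sqrt (mu0 N - μ)

/-- Surface area of the unit sphere in ℝ^N, i.e. N times the volume of the unit ball. -/
def sphereArea (N : ℕ) : ℝ := N * (volume (ball (0 : Euc N) 1)).toReal

/-- The normalizing constant c_μ: 2√(μ₀-μ)|𝕊^{N-1}| for μ < μ₀ and |𝕊^{N-1}| for μ = μ₀. -/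
def cMu (N : ℕ) (μ : ℝ) : ℝ :=
  if μ < mu0 N then 2 * Real.sqrt (mu0 N - μ) * sphereArea N else sphereArea N

/-- The normalizing constant c_N = ((N-2)|𝕊^{N-1}|)⁻¹ of the fundamental solution of -Δ. -/
def cN (N : ℕ) : ℝ := (((N : ℝ) - 2) * sphereArea N)⁻¹

/-- The singular profile Φ_μ: |x|^{τ₋(μ)} for μ < μ₀ and |x|^{-(N-2)/2}(-ln|x|) for μ = μ₀. -/
def PhiFun (N : ℕ) (μ : ℝ) (x : Euc N) : ℝ :=
  if μ < mu0 N then ‖x‖ ^ tauMinus N μ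
  else ‖x‖ ^ (-((N : ℝ) - 2) / 2) * (-Real.log ‖x‖)

/-- The adjoint operator L*_μ ξ(x) = -Δξ(x) - 2τ₊(μ)|x|⁻² x·∇ξ(x). -/
def LstarMu (N : ℕ) (μ : ℝ) (ξ : Euc N → ℝ) (x : Euc N) : ℝ :=
  -lap ξ x - 2 * tauPlus N μ / ‖x‖ ^ 2 * fderiv ℝ ξ x x

/-- The adjoint operator L*_{μV} ξ = L*_μ ξ - μ(V - |x|⁻²)ξ. -/
def LstarMuV (N : ℕ) (μ : ℝ) (V ξ : Euc N → ℝ) (x : Euc N) : ℝ :=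
  LstarMu N μ ξ x - μ * (V x - ‖x‖ ^ (-2 : ℝ)) * ξ x

/-- A compactly supported C^{1,1} test function: compactly supported, differentiable,
with Lipschitz gradient. -/
def IsC11c {N : ℕ} (ξ : Euc N → ℝ) : Prop :=
  HasCompactSupport ξ ∧ Differentiable ℝ ξ ∧ ∃ L : NNReal, LipschitzWith L (fderiv ℝ ξ)

/-- The dμ-distributional identity with constant `k`. -/
def DistribIdentity (N : ℕ) (μ : ℝ) (V u : Euc N → ℝ) (k : ℝ) : Prop :=
  ∀ ξ : Euc N → ℝ, IsC11c ξ →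
    ∫ x : Euc N, u x * LstarMuV N μ V ξ x * ‖x‖ ^ tauPlus N μ = cMu N μ * k * ξ 0

/-- `u` is a classical solution of -Δu - μVu = 0 in ℝ^N∖{0}. -/
def IsSolution (N : ℕ) (μ : ℝ) (V u : Euc N → ℝ) : Prop :=
  ContDiffOn ℝ 2 u {x : Euc N | x ≠ 0} ∧
  ∀ x : Euc N, x ≠ 0 → -lap u x - μ * V x * u x = 0

/-- `f` is locally γ-Hölder continuous on `s`. -/
def LocHolderOn {N : ℕ} (γ : ℝ) (s : Set (Euc N)) (f : Euc N → ℝ) : Prop :=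
  ∀ x ∈ s, ∃ ε > 0, ∃ C > 0, ∀ y ∈ ball x ε ∩ s, ∀ z ∈ ball x ε ∩ s,
    |f y - f z| ≤ C * dist y z ^ γ

/-- The filter `‖x‖ → +∞` on ℝ^N. -/
def normAtTop (N : ℕ) : Filter (Euc N) := comap norm atTop

/-- Assumption (V): V is locally Hölder and positive on ℝ^N∖{0},
0 ≤ V(x) - |x|⁻² ≤ c₀, and limsup_{|x|→∞} V(x)|x|² = α. -/
def AssumpV (N : ℕ) (V : Euc N → ℝ) (α : ℝ) : Prop :=
  (∃ γ : ℝ, 0 < γ ∧ γ < 1 ∧ LocHolderOn γ {x : Euc N | x ≠ 0} V) ∧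
  (∀ x : Euc N, x ≠ 0 → 0 < V x) ∧
  (∃ c₀ : ℝ, 0 < c₀ ∧ ∀ x : Euc N, x ≠ 0 →
    0 ≤ V x - ‖x‖ ^ (-2 : ℝ) ∧ V x - ‖x‖ ^ (-2 : ℝ) ≤ c₀) ∧
  limsup (fun x : Euc N => V x * ‖x‖ ^ 2) (normAtTop N) = α

/-- Assumption (Ṽ): V is locally Hölder and positive on ℝ^N∖{0},
0 ≤ V(x) - |x|⁻² ≤ c₀, and liminf_{|x|→∞} V(x)|x|² = β. -/
def AssumpVtilde (N : ℕ) (V : Euc N → ℝ) (β : ℝ) : Prop :=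
  (∃ γ : ℝ, 0 < γ ∧ γ < 1 ∧ LocHolderOn γ {x : Euc N | x ≠ 0} V) ∧
  (∀ x : Euc N, x ≠ 0 → 0 < V x) ∧
  (∃ c₀ : ℝ, 0 < c₀ ∧ ∀ x : Euc N, x ≠ 0 →
    0 ≤ V x - ‖x‖ ^ (-2 : ℝ) ∧ V x - ‖x‖ ^ (-2 : ℝ) ≤ c₀) ∧
  liminf (fun x : Euc N => V x * ‖x‖ ^ 2) (normAtTop N) = β

/-- The potential V_ρ(x) = |x|⁻²(1 + ρ|x|²)/(1 + |x|²). -/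
def Vrho (N : ℕ) (ρ : ℝ) (x : Euc N) : ℝ :=
  ‖x‖ ^ (-2 : ℝ) * (1 + ρ * ‖x‖ ^ 2) / (1 + ‖x‖ ^ 2)

/-- Ω has C² boundary: it is the sublevel set of a C² function whose differential
does not vanish on the boundary. -/
def HasC2Boundary {N : ℕ} (Ω : Set (Euc N)) : Prop :=
  ∃ φ : Euc N → ℝ, ContDiff ℝ 2 φ ∧ Ω = {x | φ x < 0} ∧
    ∀ x ∈ frontier Ω, fderiv ℝ φ x ≠ 0

section

open scoped Topology ENNReal

/-- `f` is differentiable near `x` and its derivative is differentiable at `x`. -/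
def D2At {N : ℕ} (f : Euc N → ℝ) (x : Euc N) : Prop :=
  (∀ᶠ y in 𝓝 x, DifferentiableAt ℝ f y) ∧ DifferentiableAt ℝ (fderiv ℝ f) x

/-- The `i`-th standard basis vector. -/
abbrev bv {N : ℕ} (i : Fin N) : Euc N := EuclideanSpace.single i 1

/-- The scalar product of the gradients of `f` and `g` at `x`. -/
def gdot {N : ℕ} (f g : Euc N → ℝ) (x : Euc N) : ℝ :=
  ∑ i : Fin N, fderiv ℝ f x (bv i) * fderiv ℝ g x (bv i)

section LaplacianCalculus

variable {N : ℕ} {f g : Euc N → ℝ} {x : Euc N}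

lemma d2At_of_hasFDerivAt {f' : Euc N → Euc N →L[ℝ] ℝ} {f'' : Euc N →L[ℝ] Euc N →L[ℝ] ℝ}
    (h : ∀ᶠ y in 𝓝 x, HasFDerivAt f (f' y) y) (h' : HasFDerivAt f' f'' x) : D2At f x := by
  refine ⟨h.mono fun y hy => hy.differentiableAt, ?_⟩
  have : fderiv ℝ f =ᶠ[𝓝 x] f' := h.mono fun y hy => hy.fderiv
  exact (h'.congr_of_eventuallyEq this).differentiableAt

lemma D2At.lap_eq (h : D2At f x) :
    lap f x = ∑ i : Fin N, fderiv ℝ (fderiv ℝ f) x (bv i) (bv i) := by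
  unfold lap
  refine Finset.sum_congr rfl fun i _ => ?_
  rw [fderiv_clm_apply h.2 (differentiableAt_const _)]
  simp

lemma lap_of_hasFDerivAt {f' : Euc N → Euc N →L[ℝ] ℝ} {f'' : Euc N →L[ℝ] Euc N →L[ℝ] ℝ}
    (h : ∀ᶠ y in 𝓝 x, HasFDerivAt f (f' y) y) (h' : HasFDerivAt f' f'' x) :
    lap f x = ∑ i : Fin N, f'' (bv i) (bv i) := by
  rw [(d2At_of_hasFDerivAt h h').lap_eq]
  have : fderiv ℝ f =ᶠ[𝓝 x] f' := h.mono fun y hy => hy.fderiv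
  rw [this.fderiv_eq, h'.fderiv]

lemma D2At.eventually_hasFDerivAt (h : D2At f x) :
    ∀ᶠ y in 𝓝 x, HasFDerivAt f (fderiv ℝ f y) y :=
  h.1.mono fun _ hy => hy.hasFDerivAt

lemma D2At.differentiableAt (h : D2At f x) : DifferentiableAt ℝ f x := h.1.self_of_nhds

lemma ContDiffAt.d2At (h : ContDiffAt ℝ 2 f x) : D2At f x := by
  refine ⟨(h.eventually (by simp)).mono fun y hy => hy.differentiableAt (by simp), ?_⟩
  exact (h.fderiv_right (m := 1) (by norm_num)).differentiableAt (by simp)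

lemma lap_congr (h : f =ᶠ[𝓝 x] g) : lap f x = lap g x := by
  unfold lap
  refine Finset.sum_congr rfl fun i _ => ?_
  have : (fun y => fderiv ℝ f y (bv i)) =ᶠ[𝓝 x] fun y => fderiv ℝ g y (bv i) := by
    filter_upwards [h.fderiv (𝕜 := ℝ)] with y hy
    rw [hy]
  rw [this.fderiv_eq]

lemma lap_const (c : ℝ) : lap (fun _ : Euc N => c) x = 0 := by
  simp [lap]

lemma D2At.add (hf : D2At f x) (hg : D2At g x) : D2At (fun y => f y + g y) x :=
  d2At_of_hasFDerivAt
    (by filter_upwards [hf.eventually_hasFDerivAt, hg.eventually_hasFDerivAt] with y h1 h2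
        exact h1.add h2)
    (hf.2.hasFDerivAt.add hg.2.hasFDerivAt)

lemma lap_add (hf : D2At f x) (hg : D2At g x) :
    lap (fun y => f y + g y) x = lap f x + lap g x := by
  rw [lap_of_hasFDerivAt
    (by filter_upwards [hf.eventually_hasFDerivAt, hg.eventually_hasFDerivAt] with y h1 h2
        exact h1.add h2)
    (hf.2.hasFDerivAt.add hg.2.hasFDerivAt), hf.lap_eq, hg.lap_eq, ← Finset.sum_add_distrib]
  rfl

lemma D2At.const_mul (c : ℝ) (hf : D2At f x) : D2At (fun y => c * f y) x :=
  d2At_of_hasFDerivAt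
    (by filter_upwards [hf.eventually_hasFDerivAt] with y h1
        exact h1.const_mul c)
    (hf.2.hasFDerivAt.const_smul c)

lemma lap_const_mul (c : ℝ) (hf : D2At f x) : lap (fun y => c * f y) x = c * lap f x := by
  rw [lap_of_hasFDerivAt
    (by filter_upwards [hf.eventually_hasFDerivAt] with y h1
        exact h1.const_mul c)
    (hf.2.hasFDerivAt.const_smul c), hf.lap_eq, Finset.mul_sum]
  rfl

lemma D2At.sub (hf : D2At f x) (hg : D2At g x) : D2At (fun y => f y - g y) x := by
  simpa [sub_eq_add_neg] using hf.add (hg.const_mul (-1))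

lemma lap_sub (hf : D2At f x) (hg : D2At g x) :
    lap (fun y => f y - g y) x = lap f x - lap g x := by
  have h := lap_add hf (hg.const_mul (-1))
  rw [lap_const_mul (-1) hg] at h
  simpa [sub_eq_add_neg] using h

lemma lap_mul (hf : D2At f x) (hg : D2At g x) :
    lap (fun y => f y * g y) x = f x * lap g x + g x * lap f x + 2 * gdot f g x := by
  have h : ∀ᶠ y in 𝓝 x, HasFDerivAt (fun y => f y * g y)
      (f y • fderiv ℝ g y + g y • fderiv ℝ f y) y := by
    filter_upwards [hf.eventually_hasFDerivAt, hg.eventually_hasFDerivAt] with y h1 h2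
    exact h1.mul h2
  have h' := (hf.differentiableAt.hasFDerivAt.smul hg.2.hasFDerivAt).add
    (hg.differentiableAt.hasFDerivAt.smul hf.2.hasFDerivAt)
  rw [lap_of_hasFDerivAt h h', hf.lap_eq, hg.lap_eq, gdot, Finset.mul_sum, Finset.mul_sum,
    Finset.mul_sum, ← Finset.sum_add_distrib, ← Finset.sum_add_distrib]
  refine Finset.sum_congr rfl fun i _ => ?_
  simp
  ring

lemma lap_comp {F F' : ℝ → ℝ} {c : ℝ} (hf : D2At f x)
    (hF : ∀ᶠ t in 𝓝 (f x), HasDerivAt F (F' t) t) (hF' : HasDerivAt F' c (f x)) :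
    lap (fun y => F (f y)) x = c * gdot f f x + F' (f x) * lap f x := by
  have h : ∀ᶠ y in 𝓝 x, HasFDerivAt (fun y => F (f y)) (F' (f y) • fderiv ℝ f y) y := by
    filter_upwards [hf.eventually_hasFDerivAt,
      hf.differentiableAt.continuousAt.eventually hF] with y h1 h2
    exact h2.comp_hasFDerivAt y h1
  have h' := (hF'.comp_hasFDerivAt x hf.differentiableAt.hasFDerivAt).smul hf.2.hasFDerivAt
  rw [lap_of_hasFDerivAt h h', hf.lap_eq, gdot, Finset.mul_sum, Finset.mul_sum,
    ← Finset.sum_add_distrib]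
  refine Finset.sum_congr rfl fun i _ => ?_
  simp
  ring

lemma lap_comp_sub (f : Euc N → ℝ) (a x : Euc N) :
    lap (fun y => f (y - a)) x = lap f (x - a) := by
  unfold lap
  refine Finset.sum_congr rfl fun i _ => ?_
  simp only [fderiv_comp_sub]
  exact congrArg (fun L : Euc N →L[ℝ] ℝ => L (bv i))
    (fderiv_comp_sub (𝕜 := ℝ) (f := fun y => fderiv ℝ f y (bv i)) a)

lemma lap_comp_smul (f : Euc N → ℝ) (r : ℝ) (x : Euc N) :
    lap (fun y => f (r • y)) x = r ^ 2 * lap f (r • x) := by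
  unfold lap
  rw [Finset.mul_sum]
  refine Finset.sum_congr rfl fun i _ => ?_
  have h1 : ∀ y, fderiv ℝ (fun y => f (r • y)) y = r • fderiv ℝ f (r • y) := fun y =>
    fderiv_comp_smul r
  simp only [h1]
  have h2 : (fun y => (r • fderiv ℝ f (r • y)) (bv i)) =
      r • fun y => (fun z => fderiv ℝ f z (bv i)) (r • y) := by
    ext y; simp
  rw [h2, fderiv_const_smul_field]
  have := fderiv_comp_smul (𝕜 := ℝ) (f := fun z => fderiv ℝ f z (bv i)) (x := x) r
  simp only [Pi.smul_apply]
  rw [this]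
  simp
  ring

lemma gdot_self_nonneg (f : Euc N → ℝ) (x : Euc N) : 0 ≤ gdot f f x :=
  Finset.sum_nonneg fun _ _ => mul_self_nonneg _

lemma abs_gdot_le (f g : Euc N → ℝ) (x : Euc N) :
    |gdot f g x| ≤ N * (‖fderiv ℝ f x‖ * ‖fderiv ℝ g x‖) := by
  unfold gdot
  refine (Finset.abs_sum_le_sum_abs _ _).trans ?_
  have : ∀ i ∈ (Finset.univ : Finset (Fin N)), |fderiv ℝ f x (bv i) * fderiv ℝ g x (bv i)| ≤
      ‖fderiv ℝ f x‖ * ‖fderiv ℝ g x‖ := by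
    intro i _
    rw [abs_mul]
    have h1 := (fderiv ℝ f x).le_opNorm (bv i)
    have h2 := (fderiv ℝ g x).le_opNorm (bv i)
    simp only [bv, PiLp.norm_single, norm_one, mul_one, Real.norm_eq_abs] at h1 h2
    exact mul_le_mul h1 h2 (abs_nonneg _) (norm_nonneg _)
  refine (Finset.sum_le_sum this).trans ?_
  simp

end LaplacianCalculus

section RadialPowers

variable {N : ℕ}

/-- The radial power `(c + ‖x‖²) ^ a`. -/
def pw {N : ℕ} (c a : ℝ) (x : Euc N) : ℝ := (c + ‖x‖ ^ 2) ^ a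

variable {c a : ℝ} {x : Euc N}

lemma pw_nonneg (hc : 0 ≤ c) : 0 ≤ pw c a x := by unfold pw; positivity

lemma pw_pos (h : 0 < c + ‖x‖ ^ 2) : 0 < pw c a x := Real.rpow_pos_of_pos h _

lemma pw_zero_left (a : ℝ) (x : Euc N) : pw 0 a x = ‖x‖ ^ (2 * a) := by
  rw [pw, zero_add, ← Real.rpow_natCast, ← Real.rpow_mul (norm_nonneg _)]
  norm_num

lemma contDiffAt_pw (h : 0 < c + ‖x‖ ^ 2) {n : WithTop ℕ∞} : ContDiffAt ℝ n (pw c a : Euc N → ℝ) x := by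
  unfold pw
  exact (contDiffAt_const.add (contDiff_norm_sq ℝ).contDiffAt).rpow_const_of_ne h.ne'

lemma contDiff_pw (h : 0 < c) {n : WithTop ℕ∞} : ContDiff ℝ n (pw c a : Euc N → ℝ) :=
  contDiff_iff_contDiffAt.2 fun x => contDiffAt_pw (by positivity)

lemma hasFDerivAt_pw (h : 0 < c + ‖x‖ ^ 2) :
    HasFDerivAt (pw c a : Euc N → ℝ) ((2 * a * (c + ‖x‖ ^ 2) ^ (a - 1)) • innerSL ℝ x) x := by
  have h1 : HasFDerivAt (fun y : Euc N => c + ‖y‖ ^ 2) (2 • innerSL ℝ x) x := by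
    simpa using ((hasStrictFDerivAt_norm_sq x).hasFDerivAt).const_add c
  have h2 := (Real.hasDerivAt_rpow_const (p := a) (Or.inl h.ne')).comp_hasFDerivAt x h1
  have e : (2 * a * (c + ‖x‖ ^ 2) ^ (a - 1)) • innerSL ℝ x =
      (a * (c + ‖x‖ ^ 2) ^ (a - 1)) • (2 : ℕ) • innerSL ℝ x := by
    ext v
    simp
    ring
  rw [e]
  exact h2

lemma eventually_pos_pw (h : 0 < c + ‖x‖ ^ 2) : ∀ᶠ y : Euc N in 𝓝 x, 0 < c + ‖y‖ ^ 2 := by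
  have : Continuous fun y : Euc N => c + ‖y‖ ^ 2 := by fun_prop
  exact this.continuousAt.eventually (lt_mem_nhds h)

lemma fderiv_pw (h : 0 < c + ‖x‖ ^ 2) (v : Euc N) :
    fderiv ℝ (pw c a) x v = 2 * a * (c + ‖x‖ ^ 2) ^ (a - 1) * inner ℝ x v := by
  rw [(hasFDerivAt_pw h).fderiv]; simp

lemma norm_fderiv_pw_le (h : 0 < c + ‖x‖ ^ 2) :
    ‖fderiv ℝ (pw c a) x‖ ≤ 2 * |a| * (c + ‖x‖ ^ 2) ^ (a - 1) * ‖x‖ := by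
  rw [(hasFDerivAt_pw h).fderiv, norm_smul, innerSL_apply_norm, Real.norm_eq_abs, abs_mul, abs_mul,
    abs_of_pos (Real.rpow_pos_of_pos h _)]
  norm_num

lemma lap_pw (h : 0 < c + ‖x‖ ^ 2) :
    lap (pw c a) x = 4 * a * (a - 1) * ‖x‖ ^ 2 * (c + ‖x‖ ^ 2) ^ (a - 2)
      + 2 * N * a * (c + ‖x‖ ^ 2) ^ (a - 1) := by
  have h1 : ∀ᶠ y in 𝓝 x, HasFDerivAt (pw c a : Euc N → ℝ)
      ((2 * a * pw c (a - 1) y) • innerSL ℝ y) y := by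
    filter_upwards [eventually_pos_pw h] with y hy
    exact hasFDerivAt_pw hy
  have h2 := ((hasFDerivAt_pw (a := a - 1) h).const_mul (2 * a)).smul
    (innerSL ℝ : Euc N →L[ℝ] Euc N →L[ℝ] ℝ).hasFDerivAt
  rw [lap_of_hasFDerivAt h1 h2]
  have h3 : ‖x‖ ^ 2 = ∑ i, x i * x i := by
    rw [EuclideanSpace.norm_sq_eq]
    exact Finset.sum_congr rfl fun i _ => by rw [Real.norm_eq_abs, sq_abs, sq]
  have h4 : ∀ i : Fin N, innerSL ℝ x (bv i) = x i := fun i => by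
    simp [bv, EuclideanSpace.inner_single_right]
  have h5 : ∀ i : Fin N, innerSL ℝ (bv i : Euc N) (bv i) = (1 : ℝ) := fun i => by
    simp [bv]
  simp only [add_apply, smul_apply, smul_eq_mul,
    ContinuousLinearMap.smulRight_apply, h4, h5]
  rw [Finset.sum_add_distrib]
  have e : a - 1 - 1 = a - 2 := by ring
  have : ∀ i : Fin N, 2 * a * (2 * (a - 1) * (c + ‖x‖ ^ 2) ^ (a - 1 - 1) * x i) * x i =
      4 * a * (a - 1) * (c + ‖x‖ ^ 2) ^ (a - 2) * (x i * x i) := fun i => by rw [e]; ring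
  simp only [this]
  rw [← Finset.mul_sum, ← Finset.mul_sum, ← h3]
  simp [pw]
  ring

lemma gdot_pw (h : 0 < c + ‖x‖ ^ 2) (g : Euc N → ℝ) :
    gdot (pw c a) g x = 2 * a * (c + ‖x‖ ^ 2) ^ (a - 1) * fderiv ℝ g x x := by
  have h4 : ∀ i : Fin N, inner ℝ x (bv i) = x i := fun i => by
    simp [bv, EuclideanSpace.inner_single_right]
  have hx : x = ∑ i, x i • (bv i : Euc N) := by
    conv_lhs => rw [← (EuclideanSpace.basisFun (Fin N) ℝ).sum_repr x]
    simp
  unfold gdot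
  simp only [fderiv_pw h, h4]
  conv_rhs => rw [hx]
  rw [map_sum, Finset.mul_sum]
  refine Finset.sum_congr rfl fun i _ => ?_
  rw [map_smul, smul_eq_mul]
  conv_rhs => rw [← hx]
  ring

end RadialPowers

end

section

open scoped Topology ENNReal

section ByParts

variable {N : ℕ}

lemma exists_contDiff_cutoff (n : ℕ) {K U : Set (Euc N)} (hK : IsCompact K) (hU : IsOpen U)
    (h : K ⊆ U) :
    ∃ η : Euc N → ℝ, ContDiff ℝ n η ∧ HasCompactSupport η ∧ tsupport η ⊆ U ∧
      (∀ᶠ x in 𝓝ˢ K, η x = 1) ∧ ∀ x, η x ∈ Set.Icc (0 : ℝ) 1 := by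
  obtain ⟨L, hL, hKL, hLU⟩ := exists_compact_between hK hU h
  obtain ⟨f, h1, h2, h3⟩ := exists_contMDiffMap_one_nhds_of_subset_interior
    (modelWithCornersSelf ℝ (Euc N)) (n := n) hK.isClosed hKL
  have hts : tsupport f ⊆ L := closure_minimal
    (fun x hx => by by_contra hxL; exact hx (h2 x hxL)) hL.isClosed
  exact ⟨f, f.contMDiff.contDiff, HasCompactSupport.of_support_subset_isCompact hL
    (subset_closure.trans hts), hts.trans hLU, h1, h3⟩

lemma exists_cutoff {K U : Set (Euc N)} (hK : IsCompact K) (hU : IsOpen U) (h : K ⊆ U) :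
    ∃ η : Euc N → ℝ, ContDiff ℝ 2 η ∧ HasCompactSupport η ∧ tsupport η ⊆ U ∧
      (∀ᶠ x in 𝓝ˢ K, η x = 1) ∧ ∀ x, η x ∈ Set.Icc (0 : ℝ) 1 :=
  mod_cast exists_contDiff_cutoff 2 hK hU h

lemma isC11c_of_contDiff {f : Euc N → ℝ} (hf : ContDiff ℝ 2 f) (h : HasCompactSupport f) :
    IsC11c f :=
  ⟨h, hf.differentiable (by simp), ContDiff.lipschitzWith_of_hasCompactSupport (n := 1)
    (h.fderiv ℝ) (hf.fderiv_right (by norm_num)) (by simp)⟩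

namespace IsC11c

variable {f g : Euc N → ℝ}

lemma continuous_fderiv (hf : IsC11c f) : Continuous (fderiv ℝ f) := by
  obtain ⟨-, -, L, hL⟩ := hf
  exact hL.continuous

lemma contDiff (hf : IsC11c f) : ContDiff ℝ 1 f :=
  contDiff_one_iff_fderiv.2 ⟨hf.2.1, hf.continuous_fderiv⟩

lemma continuous (hf : IsC11c f) : Continuous f := hf.contDiff.continuous

lemma exists_bound (hf : IsC11c f) : ∃ C, ∀ x, ‖f x‖ ≤ C :=
  hf.1.exists_bound_of_continuous hf.continuous

lemma exists_bound_fderiv (hf : IsC11c f) : ∃ C, ∀ x, ‖fderiv ℝ f x‖ ≤ C :=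
  (hf.1.fderiv ℝ).exists_bound_of_continuous hf.continuous_fderiv

lemma lipschitz (hf : IsC11c f) : ∃ C, LipschitzWith C f :=
  ContDiff.lipschitzWith_of_hasCompactSupport hf.1 hf.contDiff (by simp)

lemma lipschitz_apply (hf : IsC11c f) (v : Euc N) :
    ∃ C, LipschitzWith C (fun x => fderiv ℝ f x v) := by
  obtain ⟨-, -, L, hL⟩ := hf
  exact ⟨_, (ContinuousLinearMap.apply ℝ ℝ v).lipschitz.comp hL⟩

lemma ae_d2At (hf : IsC11c f) : ∀ᵐ x, D2At f x := by
  obtain ⟨-, h, L, hL⟩ := hf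
  filter_upwards [hL.ae_differentiableAt] with x hx
  exact ⟨.of_forall h, hx⟩

lemma mul (hf : IsC11c f) (hg : IsC11c g) : IsC11c (fun x => f x * g x) := by
  obtain ⟨A, hA⟩ := hf.exists_bound
  obtain ⟨A', hA'⟩ := hf.exists_bound_fderiv
  obtain ⟨B, hB⟩ := hg.exists_bound
  obtain ⟨B', hB'⟩ := hg.exists_bound_fderiv
  obtain ⟨a, ha⟩ := hf.lipschitz
  obtain ⟨b, hb⟩ := hg.lipschitz
  obtain ⟨h1, h2, L, h3⟩ := hf
  obtain ⟨k1, k2, M, k3⟩ := hg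
  refine ⟨h1.mul_right, h2.mul k2, Real.toNNReal (A * M + a * B' + (B * L + b * A')), ?_⟩
  have e : fderiv ℝ (fun x => f x * g x) = fun x => f x • fderiv ℝ g x + g x • fderiv ℝ f x := by
    ext1 x
    exact ((h2 x).hasFDerivAt.mul (k2 x).hasFDerivAt).fderiv
  have key : ∀ (p : Euc N → ℝ) (q : Euc N → Euc N →L[ℝ] ℝ) (P Q p' q' : ℝ),
      (∀ x, ‖p x‖ ≤ P) → (∀ x, ‖q x‖ ≤ Q) → (∀ x y, ‖p x - p y‖ ≤ p' * ‖x - y‖) →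
      (∀ x y, ‖q x - q y‖ ≤ q' * ‖x - y‖) → ∀ x y,
      ‖p x • q x - p y • q y‖ ≤ (P * q' + p' * Q) * ‖x - y‖ := by
    intro p q P Q p' q' hP hQ hp hq x y
    have : p x • q x - p y • q y = p x • (q x - q y) + (p x - p y) • q y := by
      ext v
      simp
      ring
    rw [this]
    refine (norm_add_le _ _).trans ?_
    rw [norm_smul, norm_smul, add_mul]
    have hP0 : 0 ≤ P := (norm_nonneg _).trans (hP x)
    refine add_le_add ?_ ?_
    · rw [mul_assoc]
      exact mul_le_mul (hP x) (hq x y) (norm_nonneg _) hP0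
    · rw [mul_right_comm]
      exact mul_le_mul (hp x y) (hQ y) (norm_nonneg _) ((norm_nonneg _).trans (hp x y))
  rw [e]
  refine LipschitzWith.of_dist_le' fun x y => ?_
  have i1 := key f (fderiv ℝ g) A B' a M hA hB' (fun x y => ha.norm_sub_le x y)
    (fun x y => k3.norm_sub_le x y) x y
  have i2 := key g (fderiv ℝ f) B A' b L hB hA' (fun x y => hb.norm_sub_le x y)
    (fun x y => h3.norm_sub_le x y) x y
  rw [dist_eq_norm, dist_eq_norm, add_sub_add_comm, add_mul]
  exact (norm_add_le _ _).trans (add_le_add i1 i2)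

lemma exists_bound_lap (hf : IsC11c f) : ∃ C, ∀ x, ‖lap f x‖ ≤ C := by
  have : ∀ i : Fin N, ∃ C : NNReal, ∀ x,
      ‖fderiv ℝ (fun y => fderiv ℝ f y (bv i)) x (bv i)‖ ≤ C := fun i => by
    obtain ⟨C, hC⟩ := hf.lipschitz_apply (bv i)
    refine ⟨C, fun x => ?_⟩
    refine (ContinuousLinearMap.le_opNorm _ _).trans ?_
    simpa [bv] using norm_fderiv_le_of_lipschitz ℝ hC (x₀ := x)
  choose C hC using this
  exact ⟨∑ i, (C i : ℝ), fun x => (norm_sum_le _ _).trans (Finset.sum_le_sum fun i _ => hC i x)⟩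

end IsC11c

lemma measurable_lap (f : Euc N → ℝ) : Measurable (lap f) := by
  unfold lap
  exact Finset.measurable_sum _ fun i _ => measurable_fderiv_apply_const ℝ _ _

lemma lap_eq_zero_of_notMem_tsupport {f : Euc N → ℝ} {x : Euc N} (hx : x ∉ tsupport f) :
    lap f x = 0 := by
  rw [lap_congr (notMem_tsupport_iff_eventuallyEq.1 hx)]
  exact lap_const 0

lemma integrable_mul_of_bounded {f g : Euc N → ℝ} {K : Set (Euc N)} {C : ℝ}
    (hf : IntegrableOn f K) (hK : MeasurableSet K) (hg : AEStronglyMeasurable g volume)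
    (hC : ∀ x, ‖g x‖ ≤ C) (h0 : ∀ x ∉ K, g x = 0) : Integrable (fun x => f x * g x) := by
  have h1 : Integrable (fun x => K.indicator f x * g x) :=
    ((integrable_indicator_iff hK).2 hf).mul_bdd hg (.of_forall hC)
  refine h1.congr (.of_forall fun x => ?_)
  by_cases hx : x ∈ K
  · simp [hx]
  · simp [hx, h0 x hx]

lemma integral_lap_mul_eq_neg {f g : Euc N → ℝ} (hf : IsC11c f) (hg : IsC11c g) :
    ∫ x, lap f x * g x = -∑ i : Fin N, ∫ x, fderiv ℝ f x (bv i) * fderiv ℝ g x (bv i) := by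
  obtain ⟨D, hD⟩ := hg.lipschitz
  have key : ∀ i : Fin N, Integrable (fun x => fderiv ℝ (fun y => fderiv ℝ f y (bv i)) x (bv i) * g x) ∧
      ∫ x, fderiv ℝ (fun y => fderiv ℝ f y (bv i)) x (bv i) * g x =
      -∫ x, fderiv ℝ f x (bv i) * fderiv ℝ g x (bv i) := by
    intro i
    obtain ⟨C, hC⟩ := hf.lipschitz_apply (bv i)
    constructor
    · refine (hg.continuous.integrable_of_hasCompactSupport hg.1).bdd_mul (c := C)
        (measurable_fderiv_apply_const ℝ _ _).aestronglyMeasurable (.of_forall fun x => ?_)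
      refine (ContinuousLinearMap.le_opNorm _ _).trans ?_
      simpa [bv] using norm_fderiv_le_of_lipschitz ℝ hC (x₀ := x)
    have h := LipschitzWith.integral_lineDeriv_mul_eq (μ := volume) hC hD hg.1 (bv i)
    have h1 : ∫ x, fderiv ℝ (fun y => fderiv ℝ f y (bv i)) x (bv i) * g x =
        ∫ x, lineDeriv ℝ (fun y => fderiv ℝ f y (bv i)) x (bv i) * g x := by
      refine integral_congr_ae ?_
      filter_upwards [hC.ae_differentiableAt] with x hx
      rw [hx.lineDeriv_eq_fderiv]
    rw [h1, h, ← integral_neg]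
    refine integral_congr_ae (.of_forall fun x => ?_)
    simp only [(hg.2.1 x).lineDeriv_eq_fderiv, map_neg]
    ring
  simp only [lap, Finset.sum_mul]
  rw [integral_finsetSum _ fun i _ => (key i).1, ← Finset.sum_neg_distrib]
  exact Finset.sum_congr rfl fun i _ => (key i).2

/-- Green's identity for compactly supported `C^{1,1}` functions. -/
lemma integral_mul_lap_comm {f g : Euc N → ℝ} (hf : IsC11c f) (hg : IsC11c g) :
    ∫ x, f x * lap g x = ∫ x, lap f x * g x := by
  rw [integral_lap_mul_eq_neg hf hg]
  simp only [mul_comm (f _)]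
  rw [integral_lap_mul_eq_neg hg hf]
  simp only [mul_comm]

/-- A `C²` function on an open set, multiplied by a cutoff supported there, is globally `C²`. -/
lemma contDiff_mul_cutoff {f η : Euc N → ℝ} {U : Set (Euc N)} (hU : IsOpen U)
    (hf : ContDiffOn ℝ 2 f U) (hη : ContDiff ℝ 2 η) (h : tsupport η ⊆ U) :
    ContDiff ℝ 2 (fun x => f x * η x) := by
  refine contDiff_iff_contDiffAt.2 fun x => ?_
  by_cases hx : x ∈ tsupport η
  · exact (hf.contDiffAt (hU.mem_nhds (h hx))).mul hη.contDiffAt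
  · refine (contDiffAt_const (c := (0 : ℝ))).congr_of_eventuallyEq ?_
    filter_upwards [notMem_tsupport_iff_eventuallyEq.1 hx] with y hy
    simp [hy]

lemma continuousOn_lap {f : Euc N → ℝ} {U : Set (Euc N)} (hU : IsOpen U)
    (hf : ContDiffOn ℝ 2 f U) : ContinuousOn (lap f) U := by
  have h1 : ContDiffOn ℝ 1 (fderiv ℝ f) U := hf.fderiv_of_isOpen hU (by norm_num)
  have h2 : ContinuousOn (fderiv ℝ (fderiv ℝ f)) U := h1.continuousOn_fderiv_of_isOpen hU (by simp)
  have h3 : ContinuousOn (fun x => ∑ i : Fin N, fderiv ℝ (fderiv ℝ f) x (bv i) (bv i)) U :=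
    continuousOn_finsetSum _ fun i _ =>
      ((h2.clm_apply continuousOn_const).clm_apply continuousOn_const)
  exact h3.congr fun x hx => (hf.contDiffAt (hU.mem_nhds hx)).d2At.lap_eq

/-- Green's identity for a `C²` function on an open set and a compactly supported test function. -/
lemma integral_mul_lap_of_contDiffOn {f φ : Euc N → ℝ} {U : Set (Euc N)} (hU : IsOpen U)
    (hf : ContDiffOn ℝ 2 f U) (hφ : IsC11c φ) (h : tsupport φ ⊆ U) :
    ∫ x, f x * lap φ x = ∫ x, lap f x * φ x := by
  obtain ⟨η, h1, h2, h3, h4, -⟩ := exists_cutoff hφ.1 hU h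
  have hF := isC11c_of_contDiff (contDiff_mul_cutoff hU hf h1 h3) h2.mul_left
  have := integral_mul_lap_comm hF hφ
  have hη : ∀ x ∈ tsupport φ, ∀ᶠ y in 𝓝 x, f y * η y = f y := fun x hx => by
    filter_upwards [h4.filter_mono (nhds_le_nhdsSet hx)] with y hy
    rw [hy, mul_one]
  calc ∫ x, f x * lap φ x = ∫ x, (f x * η x) * lap φ x := by
        refine integral_congr_ae (.of_forall fun x => ?_)
        by_cases hx : x ∈ tsupport φ
        · simp only [(hη x hx).self_of_nhds]
        · simp [lap_eq_zero_of_notMem_tsupport hx]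
    _ = ∫ x, lap (fun y => f y * η y) x * φ x := this
    _ = ∫ x, lap f x * φ x := by
        refine integral_congr_ae (.of_forall fun x => ?_)
        by_cases hx : x ∈ tsupport φ
        · simp only [lap_congr (hη x hx)]
        · simp [image_eq_zero_of_notMem_tsupport hx]

end ByParts

end

section

open scoped Topology ENNReal

section Kernel

variable {N : ℕ}

/-- The regularized fundamental solution `(c + ‖x‖²)^(1 - N/2)`. -/
def gam {N : ℕ} (c : ℝ) : Euc N → ℝ := pw c (1 - (N : ℝ) / 2)

/-- Minus the Laplacian of `gam c`. -/
def psi {N : ℕ} (c : ℝ) (x : Euc N) : ℝ := (N : ℝ) * ((N : ℝ) - 2) * c * pw c (-1 - (N : ℝ) / 2) x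

/-- The total mass of `psi c`. -/
def kap (N : ℕ) : ℝ := ∫ x : Euc N, psi 1 x

lemma gam_zero_eq (x : Euc N) : gam 0 x = ‖x‖ ^ ((2 : ℝ) - N) := by
  rw [gam, pw_zero_left]; ring_nf

lemma gam_nonneg {c : ℝ} (hc : 0 ≤ c) (x : Euc N) : 0 ≤ gam c x := pw_nonneg hc

lemma gam_pos {c : ℝ} {x : Euc N} (h : 0 < c + ‖x‖ ^ 2) : 0 < gam c x := pw_pos h

lemma pos_add_normSq {c : ℝ} (hc : 0 ≤ c) {x : Euc N} (hx : x ≠ 0) : 0 < c + ‖x‖ ^ 2 := by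
  have := norm_pos_iff.2 hx
  positivity

lemma psi_nonneg (hN : 3 ≤ N) {c : ℝ} (hc : 0 ≤ c) (x : Euc N) : 0 ≤ psi c x := by
  have h2 : (3 : ℝ) ≤ N := by exact_mod_cast hN
  have := pw_nonneg (a := -1 - (N : ℝ) / 2) (x := x) hc
  unfold psi
  have : 0 ≤ (N : ℝ) - 2 := by linarith
  positivity

lemma lap_gam {c : ℝ} {x : Euc N} (h : 0 < c + ‖x‖ ^ 2) : lap (gam c) x = -psi c x := by
  unfold gam psi
  rw [lap_pw h, pw]
  have e1 : (1 : ℝ) - (N : ℝ) / 2 - 2 = -1 - (N : ℝ) / 2 := by ring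
  have e2 : (c + ‖x‖ ^ 2) ^ (1 - (N : ℝ) / 2 - 1) =
      (c + ‖x‖ ^ 2) ^ (-1 - (N : ℝ) / 2) * (c + ‖x‖ ^ 2) := by
    rw [← Real.rpow_add_one h.ne']; ring_nf
  rw [e1, e2]
  ring

lemma gam_anti (hN : 3 ≤ N) {c d : ℝ} {x : Euc N} (h : 0 < c + ‖x‖ ^ 2) (hcd : c ≤ d) :
    gam d x ≤ gam c x := by
  have h2 : (3 : ℝ) ≤ N := by exact_mod_cast hN
  exact Real.rpow_le_rpow_of_nonpos h (by linarith) (by linarith)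

lemma gam_lt (hN : 3 ≤ N) {c d : ℝ} {x : Euc N} (h : 0 < c + ‖x‖ ^ 2) (hcd : c < d) :
    gam d x < gam c x := by
  have h2 : (3 : ℝ) ≤ N := by exact_mod_cast hN
  exact Real.rpow_lt_rpow_of_neg h (by linarith) (by linarith)

lemma tendsto_gam {x : Euc N} (hx : x ≠ 0) : Tendsto (fun c => gam c x) (𝓝 0) (𝓝 (gam 0 x)) := by
  have h : ContinuousAt (fun c : ℝ => gam c x) 0 := by
    unfold gam pw
    refine ContinuousAt.rpow_const (by fun_prop) (Or.inl ?_)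
    simpa using hx
  exact h

lemma tendsto_gam_atTop (hN : 3 ≤ N) (x : Euc N) : Tendsto (fun c => gam c x) atTop (𝓝 0) := by
  have h2 : (3 : ℝ) ≤ N := by exact_mod_cast hN
  have := tendsto_rpow_neg_atTop (y := (N : ℝ) / 2 - 1) (by linarith)
  have h3 : Tendsto (fun c : ℝ => c + ‖x‖ ^ 2) atTop atTop := tendsto_atTop_add_const_right _ _ tendsto_id
  refine (this.comp h3).congr fun c => ?_
  simp [gam, pw]

lemma measurable_pw (c a : ℝ) : Measurable (pw c a : Euc N → ℝ) := by
  unfold pw; fun_prop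

lemma measurable_gam (c : ℝ) : Measurable (gam c : Euc N → ℝ) := measurable_pw _ _

lemma measurable_psi (c : ℝ) : Measurable (psi c : Euc N → ℝ) := (measurable_pw _ _).const_mul _

lemma integrable_pw_one {a : ℝ} (ha : (N : ℝ) / 2 < a) : Integrable (pw 1 (-a) : Euc N → ℝ) := by
  have := integrable_rpow_neg_one_add_norm_sq (E := Euc N) (μ := volume) (r := 2 * a)
    (by simp; linarith)
  refine this.congr (.of_forall fun x => ?_)
  simp only [pw]
  congr 1
  ring

lemma integrable_psi_one : Integrable (psi 1 : Euc N → ℝ) := by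
  have := integrable_pw_one (N := N) (a := 1 + (N : ℝ) / 2) (by linarith)
  refine (this.const_mul ((N : ℝ) * (N - 2))).congr (.of_forall fun x => ?_)
  simp only [psi, mul_one]
  ring_nf

lemma psi_pos (hN : 3 ≤ N) {c : ℝ} (hc : 0 < c) (x : Euc N) : 0 < psi c x := by
  have h2 : (3 : ℝ) ≤ N := by exact_mod_cast hN
  have := pw_pos (a := -1 - (N : ℝ) / 2) (x := x) (c := c) (by positivity)
  unfold psi
  have : 0 < (N : ℝ) - 2 := by linarith
  positivity

lemma kap_pos (hN : 3 ≤ N) : 0 < kap N := by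
  unfold kap
  rw [integral_pos_iff_support_of_nonneg (fun x => psi_nonneg hN zero_le_one x) integrable_psi_one]
  have : Function.support (psi 1 : Euc N → ℝ) = Set.univ := by
    ext x; simp [(psi_pos hN one_pos x).ne']
  rw [this]
  exact isOpen_univ.measure_pos _ ⟨0, trivial⟩

lemma psi_sq_smul {r : ℝ} (hr : 0 < r) (w : Euc N) :
    r ^ N * psi (r ^ 2) (r • w) = psi 1 w := by
  unfold psi pw
  have e : r ^ 2 + ‖r • w‖ ^ 2 = r ^ 2 * (1 + ‖w‖ ^ 2) := by
    rw [norm_smul, Real.norm_eq_abs, mul_pow, sq_abs]; ring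
  rw [e, Real.mul_rpow (by positivity) (by positivity), ← Real.rpow_natCast r 2,
    ← Real.rpow_mul hr.le, ← Real.rpow_natCast r N]
  have e2 : r ^ (N : ℝ) * (r ^ ((2 : ℕ) : ℝ) * r ^ (((2 : ℕ) : ℝ) * (-1 - (N : ℝ) / 2))) = 1 := by
    rw [← Real.rpow_add hr, ← Real.rpow_add hr]
    rw [show (N : ℝ) + (((2 : ℕ) : ℝ) + ((2 : ℕ) : ℝ) * (-1 - (N : ℝ) / 2)) = 0 by push_cast; ring]
    simp
  linear_combination ((N : ℝ) * (N - 2) * (1 + ‖w‖ ^ 2) ^ (-1 - (N : ℝ) / 2)) * e2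

lemma integral_mul_psi_eq (q : Euc N → ℝ) (x : Euc N) {r : ℝ} (hr : 0 < r) :
    ∫ y, q y * psi (r ^ 2) (y - x) = ∫ w, q (x + r • w) * psi 1 w := by
  have h1 : ∫ y, q y * psi (r ^ 2) (y - x) = ∫ z, q (x + z) * psi (r ^ 2) z := by
    rw [← integral_add_left_eq_self _ x]
    simp
  have h2 := Measure.integral_comp_smul (volume : Measure (Euc N))
    (fun z => q (x + z) * psi (r ^ 2) z) r
  rw [h1]
  have h3 : ∀ w, q (x + r • w) * psi 1 w = r ^ N * (q (x + r • w) * psi (r ^ 2) (r • w)) := by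
    intro w
    rw [← psi_sq_smul hr w]; ring
  simp only [h3]
  rw [integral_const_mul, h2]
  simp only [finrank_euclideanSpace, Fintype.card_fin, smul_eq_mul]
  rw [abs_of_pos (by positivity), ← mul_assoc, mul_inv_cancel₀ (by positivity), one_mul]

/-- `psi c` is an approximate identity of mass `kap N` as `c → 0`. -/
lemma tendsto_integral_mul_psi (hN : 3 ≤ N) {q : Euc N → ℝ} (hq : Measurable q) {C : ℝ}
    (hC : ∀ y, ‖q y‖ ≤ C) {x : Euc N} (hx : ContinuousAt q x) :
    Tendsto (fun c => ∫ y, q y * psi c (y - x)) (𝓝[>] 0) (𝓝 (kap N * q x)) := by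
  have h1 : Tendsto (fun r => ∫ w, q (x + r • w) * psi 1 w) (𝓝[>] (0 : ℝ))
      (𝓝 (∫ w : Euc N, q x * psi 1 w)) := by
    refine tendsto_integral_filter_of_dominated_convergence (fun w => C * psi 1 w) ?_ ?_
      (integrable_psi_one.const_mul C) ?_
    · refine .of_forall fun r => ?_
      exact ((hq.comp (by fun_prop)).mul (measurable_psi 1)).aestronglyMeasurable
    · refine .of_forall fun r => .of_forall fun w => ?_
      rw [norm_mul, Real.norm_of_nonneg (psi_nonneg hN zero_le_one w)]
      exact mul_le_mul_of_nonneg_right (hC _) (psi_nonneg hN zero_le_one w)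
    · refine .of_forall fun w => Tendsto.mul_const _ ?_
      have : Tendsto (fun r : ℝ => x + r • w) (𝓝[>] 0) (𝓝 x) := by
        have : Continuous (fun r : ℝ => x + r • w) := by fun_prop
        simpa using (this.tendsto 0).mono_left nhdsWithin_le_nhds
      exact hx.tendsto.comp this
  rw [integral_const_mul] at h1
  have h2 : Tendsto (fun c : ℝ => √c) (𝓝[>] 0) (𝓝[>] 0) := by
    refine tendsto_nhdsWithin_of_tendsto_nhds_of_eventually_within _ ?_ ?_
    · simpa using (Real.continuous_sqrt.tendsto 0).mono_left nhdsWithin_le_nhds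
    · filter_upwards [self_mem_nhdsWithin] with c hc
      exact Real.sqrt_pos.2 hc
  rw [mul_comm]
  refine (h1.comp h2).congr' ?_
  filter_upwards [self_mem_nhdsWithin] with c hc
  have hc' : 0 < c := hc
  rw [Function.comp_apply, ← integral_mul_psi_eq q x (Real.sqrt_pos.2 hc'), Real.sq_sqrt hc'.le]

end Kernel

end

section

open scoped Topology ENNReal

section SmoothRamp

lemma hasDerivAt_comp_max_zero {G G' : ℝ → ℝ} (h : ∀ s, HasDerivAt G (G' s) s) (h0 : G 0 = 0)
    (h0' : G' 0 = 0) (t : ℝ) : HasDerivAt (fun t => G (max t 0)) (G' (max t 0)) t := by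
  rcases lt_trichotomy t 0 with ht | rfl | ht
  · rw [max_eq_right ht.le, h0']
    refine (hasDerivAt_const t (0 : ℝ)).congr_of_eventuallyEq ?_
    filter_upwards [Iio_mem_nhds ht] with s hs
    rw [max_eq_right (le_of_lt hs), h0]
  · rw [max_self]
    have h1 : HasDerivWithinAt (fun t => G (max t 0)) (G' 0) (Set.Iic 0) 0 := by
      rw [h0']
      refine (hasDerivWithinAt_const (0 : ℝ) _ (0 : ℝ)).congr (fun s hs => ?_) ?_
      · rw [max_eq_right hs, h0]
      · rw [max_self, h0]
    have h2 : HasDerivWithinAt (fun t => G (max t 0)) (G' 0) (Set.Ici 0) 0 := by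
      refine (h 0).hasDerivWithinAt.congr (fun s hs => ?_) ?_
      · rw [max_eq_left hs]
      · rw [max_self]
    have := h1.union h2
    rwa [Set.Iic_union_Ici, hasDerivWithinAt_univ] at this
  · rw [max_eq_left ht.le]
    refine (h t).congr_of_eventuallyEq ?_
    filter_upwards [Ioi_mem_nhds ht] with s hs
    rw [max_eq_left (le_of_lt hs)]

/-- A convex `C²` approximation of `t ↦ max t 0` vanishing for `t ≤ 1`. -/
def ramp (t : ℝ) : ℝ := max (t - 1) 0 - Real.arctan (max (t - 1) 0)

/-- The derivative of `ramp`. -/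
def ramp' (t : ℝ) : ℝ := 1 - 1 / (1 + max (t - 1) 0 ^ 2)

/-- The second derivative of `ramp`. -/
def ramp'' (t : ℝ) : ℝ := 2 * max (t - 1) 0 / (1 + max (t - 1) 0 ^ 2) ^ 2

lemma hasDerivAt_ramp (t : ℝ) : HasDerivAt ramp (ramp' t) t := by
  have h : ∀ s : ℝ, HasDerivAt (fun s => s - Real.arctan s) (1 - 1 / (1 + s ^ 2)) s := fun s =>
    (hasDerivAt_id s).sub (Real.hasDerivAt_arctan s)
  have := hasDerivAt_comp_max_zero h (by simp) (by simp) (t - 1)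
  exact (this.comp t ((hasDerivAt_id t).sub_const 1)).congr_deriv (mul_one _)

lemma hasDerivAt_ramp' (t : ℝ) : HasDerivAt ramp' (ramp'' t) t := by
  have h : ∀ s : ℝ, HasDerivAt (fun s : ℝ => 1 - 1 / (1 + s ^ 2)) (2 * s / (1 + s ^ 2) ^ 2) s := by
    intro s
    have h1 : HasDerivAt (fun s : ℝ => 1 + s ^ 2) (2 * s) s := by
      simpa using (hasDerivAt_pow 2 s).const_add 1
    have h2 := (h1.inv (by positivity)).const_sub 1
    rw [show (fun s : ℝ => 1 - 1 / (1 + s ^ 2)) = fun s => 1 - (1 + s ^ 2)⁻¹ by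
      ext s; rw [one_div]]
    exact h2.congr_deriv (by rw [neg_div, neg_neg])
  have := hasDerivAt_comp_max_zero h (by simp) (by simp) (t - 1)
  exact (this.comp t ((hasDerivAt_id t).sub_const 1)).congr_deriv (mul_one _)

lemma contDiff_ramp : ContDiff ℝ 2 ramp := by
  have e1 : deriv ramp = ramp' := funext fun t => (hasDerivAt_ramp t).deriv
  have e2 : deriv ramp' = ramp'' := funext fun t => (hasDerivAt_ramp' t).deriv
  have h2 : Continuous ramp'' := by
    unfold ramp''
    refine Continuous.div (by fun_prop) (by fun_prop) fun t => ?_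
    positivity
  have h1 : ContDiff ℝ 1 ramp' := contDiff_one_iff_deriv.2
    ⟨fun t => (hasDerivAt_ramp' t).differentiableAt, e2 ▸ h2⟩
  rw [show (2 : WithTop ℕ∞) = 1 + 1 by norm_num, contDiff_succ_iff_deriv]
  exact ⟨fun t => (hasDerivAt_ramp t).differentiableAt, by simp, e1 ▸ h1⟩

lemma continuous_ramp' : Continuous ramp' :=
  continuous_iff_continuousAt.2 fun t => (hasDerivAt_ramp' t).continuousAt

lemma ramp_of_le {t : ℝ} (h : t ≤ 1) : ramp t = 0 := by
  simp [ramp, max_eq_right (sub_nonpos.2 h)]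

lemma ramp'_of_le {t : ℝ} (h : t ≤ 1) : ramp' t = 0 := by
  simp [ramp', max_eq_right (sub_nonpos.2 h)]

lemma ramp'_nonneg (t : ℝ) : 0 ≤ ramp' t := by
  unfold ramp'
  rw [sub_nonneg, div_le_one (by positivity)]
  nlinarith [sq_nonneg (max (t - 1) 0)]

lemma ramp'_le_one (t : ℝ) : ramp' t ≤ 1 := by
  unfold ramp'
  have : 0 ≤ 1 / (1 + max (t - 1) 0 ^ 2) := by positivity
  linarith

lemma ramp''_nonneg (t : ℝ) : 0 ≤ ramp'' t := by
  unfold ramp''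
  have : 0 ≤ max (t - 1) 0 := le_max_right _ _
  positivity

lemma ramp_nonneg (t : ℝ) : 0 ≤ ramp t := by
  have hmono : Monotone ramp := monotone_of_deriv_nonneg
    (fun t => (hasDerivAt_ramp t).differentiableAt) fun t => by
      rw [(hasDerivAt_ramp t).deriv]; exact ramp'_nonneg t
  rcases le_total t 1 with h | h
  · rw [ramp_of_le h]
  · rw [← ramp_of_le le_rfl]; exact hmono h

lemma sub_three_le_ramp (t : ℝ) : t - 3 ≤ ramp t := by
  unfold ramp
  have h1 := Real.arctan_lt_pi_div_two (max (t - 1) 0)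
  have h2 := Real.pi_le_four
  have h3 : t - 1 ≤ max (t - 1) 0 := le_max_left _ _
  linarith

lemma ramp_le (t : ℝ) : ramp t ≤ max t 0 := by
  unfold ramp
  have h1 : 0 ≤ Real.arctan (max (t - 1) 0) := Real.arctan_nonneg.2 (le_max_right _ _)
  have h2 : max (t - 1) 0 ≤ max t 0 := max_le_max (by linarith) le_rfl
  linarith

lemma tendsto_ramp'_atTop : Tendsto ramp' atTop (𝓝 1) := by
  have h1 : Tendsto (fun t : ℝ => max (t - 1) 0) atTop atTop :=
    tendsto_atTop_mono (fun t => le_max_left _ _) (tendsto_atTop_add_const_right _ (-1) tendsto_id)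
  have h2 : Tendsto (fun t : ℝ => 1 + max (t - 1) 0 ^ 2) atTop atTop :=
    tendsto_atTop_add_const_left _ _ ((tendsto_pow_atTop two_ne_zero).comp h1)
  have h3 := (tendsto_const_nhds (x := (1 : ℝ))).sub (h2.inv_tendsto_atTop)
  rw [sub_zero] at h3
  refine h3.congr fun t => ?_
  simp [ramp']

lemma tendsto_mul_ramp_div {s a : ℕ → ℝ} {S : ℝ} (hS : 0 ≤ S) (hs : Tendsto s atTop (𝓝 S))
    (ha : ∀ n, 0 < a n) (ha0 : Tendsto a atTop (𝓝 0)) :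
    Tendsto (fun n => a n * ramp (s n / a n)) atTop (𝓝 S) := by
  have h1 : Tendsto (fun n => s n - 3 * a n) atTop (𝓝 S) := by
    simpa using hs.sub (ha0.const_mul 3)
  have h2 : Tendsto (fun n => max (s n) 0) atTop (𝓝 S) := by
    simpa [max_eq_left hS] using hs.max (tendsto_const_nhds (x := (0 : ℝ)))
  refine tendsto_of_tendsto_of_tendsto_of_le_of_le h1 h2 (fun n => ?_) fun n => ?_
  · have := mul_le_mul_of_nonneg_left (sub_three_le_ramp (s n / a n)) (ha n).le
    rw [mul_sub, mul_div_cancel₀ _ (ha n).ne'] at this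
    linarith
  · have := mul_le_mul_of_nonneg_left (ramp_le (s n / a n)) (ha n).le
    rwa [mul_max_of_nonneg _ _ (ha n).le, mul_div_cancel₀ _ (ha n).ne', mul_zero] at this

lemma tendsto_ramp'_div {s a : ℕ → ℝ} {S : ℝ} (hS : 0 < S) (hs : Tendsto s atTop (𝓝 S))
    (ha : ∀ n, 0 < a n) (ha0 : Tendsto a atTop (𝓝 0)) :
    Tendsto (fun n => ramp' (s n / a n)) atTop (𝓝 1) := by
  refine tendsto_ramp'_atTop.comp ?_
  have h1 : Tendsto (fun n => (a n)⁻¹) atTop atTop :=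
    (tendsto_nhdsWithin_iff.2 ⟨ha0, .of_forall ha⟩).inv_tendsto_nhdsGT_zero
  simpa only [div_eq_mul_inv] using hs.pos_mul_atTop hS h1

end SmoothRamp

end

section

open scoped Topology ENNReal

section Riesz

variable {N : ℕ}

lemma nontrivial_euc (hN : 3 ≤ N) : Nontrivial (Euc N) := by
  have : Nonempty (Fin N) := ⟨⟨0, by omega⟩⟩
  infer_instance

lemma ae_ne_point (hN : 3 ≤ N) (a : Euc N) : ∀ᵐ y : Euc N, y ≠ a := by
  have := nontrivial_euc hN
  exact Measure.ae_ne volume a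

lemma isOpen_ne_zero : IsOpen {x : Euc N | x ≠ 0} := isOpen_ne

lemma integrable_mul_of_hasCompactSupport {f g : Euc N → ℝ} {U : Set (Euc N)}
    (hf : ContinuousOn f U) (hg : Continuous g) (h : HasCompactSupport g) (hU : tsupport g ⊆ U) :
    Integrable (fun x => f x * g x) := by
  obtain ⟨C, hC⟩ := h.exists_bound_of_continuous hg
  exact integrable_mul_of_bounded ((hf.mono hU).integrableOn_compact h) h.isCompact.measurableSet
    hg.aestronglyMeasurable hC fun x hx => image_eq_zero_of_notMem_tsupport hx

/-- The weight which makes the barrier in `riesz_approx` nonpositive near the origin. -/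
def barrierWeight (x : Euc N) (θ : ℝ) : ℝ :=
  (‖x‖ / 2) ^ ((2 : ℝ) - N) * (2 * θ ^ 2) ^ ((N : ℝ) / 2 - 1)

/-- A difference of regularized kernels, nonpositive near the origin. -/
def barrier (x : Euc N) (b θ c : ℝ) (y : Euc N) : ℝ :=
  gam c (y - x) - gam b (y - x) - barrierWeight x θ * gam (θ ^ 2) y

lemma barrierWeight_nonneg (x : Euc N) (θ : ℝ) : 0 ≤ barrierWeight x θ := by
  unfold barrierWeight; positivity

lemma contDiff_gam {c : ℝ} (hc : 0 < c) : ContDiff ℝ 2 (gam c : Euc N → ℝ) := contDiff_pw hc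

lemma contDiff_barrier {x : Euc N} {b θ c : ℝ} (hb : 0 < b) (hθ : 0 < θ) (hc : 0 < c) :
    ContDiff ℝ 2 (barrier x b θ c) := by
  have h : ∀ {c : ℝ}, 0 < c → ContDiff ℝ 2 (fun y : Euc N => gam c (y - x)) := fun hc =>
    (contDiff_gam hc).comp (contDiff_id.sub contDiff_const)
  exact ((h hc).sub (h hb)).sub (contDiff_const.mul (contDiff_gam (by positivity)))

lemma lap_barrier (hN : 3 ≤ N) {x : Euc N} {b θ c : ℝ} (hb : 0 < b) (hθ : 0 < θ) (hc : 0 < c)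
    (y : Euc N) : psi b (y - x) - psi c (y - x) ≤ lap (barrier x b θ c) y := by
  have h : ∀ {c : ℝ}, 0 < c → ContDiff ℝ 2 (fun y : Euc N => gam c (y - x)) := fun hc =>
    (contDiff_gam hc).comp (contDiff_id.sub contDiff_const)
  have hl : ∀ {c : ℝ}, 0 < c → lap (fun y : Euc N => gam c (y - x)) y = -psi c (y - x) := by
    intro c hc
    rw [lap_comp_sub, lap_gam (by positivity)]
  have hd : ∀ {c : ℝ}, 0 < c → D2At (fun y : Euc N => gam c (y - x)) y := fun hc =>
    (h hc).contDiffAt.d2At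
  have hθ2 : 0 < θ ^ 2 := by positivity
  unfold barrier
  rw [lap_sub ((hd hc).sub (hd hb)) ((contDiff_gam hθ2).contDiffAt.d2At.const_mul _),
    lap_sub (hd hc) (hd hb), hl hc, hl hb,
    lap_const_mul _ (contDiff_gam hθ2).contDiffAt.d2At, lap_gam (by positivity)]
  have := mul_nonneg (barrierWeight_nonneg x θ) (psi_nonneg hN hθ2.le y)
  linarith

lemma barrier_nonpos (hN : 3 ≤ N) {x : Euc N} (hx : x ≠ 0) {b θ c : ℝ} (hb : 0 < b) (hθ : 0 < θ)
    (hc : 0 < c) (hθx : θ ≤ ‖x‖ / 2) {y : Euc N} (hy : ‖y‖ ≤ θ) : barrier x b θ c y ≤ 0 := by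
  have hN' : (3 : ℝ) ≤ N := by exact_mod_cast hN
  have hx0 := norm_pos_iff.2 hx
  have h1 : ‖x‖ / 2 ≤ ‖y - x‖ := by
    have := norm_sub_norm_le x y
    rw [norm_sub_rev] at this
    linarith
  have h2 : gam c (y - x) ≤ (‖x‖ / 2) ^ ((2 : ℝ) - N) := by
    have hyx : y - x ≠ 0 := norm_pos_iff.1 (by linarith)
    refine (gam_anti hN (pos_add_normSq le_rfl hyx) hc.le).trans ?_
    rw [gam_zero_eq]
    exact Real.rpow_le_rpow_of_nonpos (by positivity) h1 (by linarith)
  have h3 : (2 * θ ^ 2) ^ (1 - (N : ℝ) / 2) ≤ gam (θ ^ 2) y := by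
    refine Real.rpow_le_rpow_of_nonpos (by positivity) ?_ (by linarith)
    nlinarith [norm_nonneg y]
  have h4 : (2 * θ ^ 2) ^ ((N : ℝ) / 2 - 1) * (2 * θ ^ 2) ^ (1 - (N : ℝ) / 2) = 1 := by
    rw [← Real.rpow_add (by positivity)]
    simp
  have h5 : (‖x‖ / 2) ^ ((2 : ℝ) - N) ≤ barrierWeight x θ * gam (θ ^ 2) y := by
    calc (‖x‖ / 2) ^ ((2 : ℝ) - N) = barrierWeight x θ * (2 * θ ^ 2) ^ (1 - (N : ℝ) / 2) := by
          rw [barrierWeight, mul_assoc, h4, mul_one]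
      _ ≤ _ := mul_le_mul_of_nonneg_left h3 (barrierWeight_nonneg x θ)
  have h6 := gam_nonneg hb.le (y - x)
  unfold barrier
  linarith

lemma exists_gam_zero_le (hN : 3 ≤ N) {a : ℝ} (ha : 0 < a) :
    ∃ r > 0, ∀ z : Euc N, r ≤ ‖z‖ → gam 0 z ≤ a := by
  have hN' : (3 : ℝ) ≤ N := by exact_mod_cast hN
  have h := tendsto_rpow_neg_atTop (y := (N : ℝ) - 2) (by linarith)
  obtain ⟨r, hr⟩ := eventually_atTop.1 (h.eventually (ge_mem_nhds ha))
  refine ⟨max r 1, by positivity, fun z hz => ?_⟩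
  rw [gam_zero_eq, ← neg_sub]
  exact hr _ ((le_max_left _ _).trans hz)

lemma riesz_approx (hN : 3 ≤ N) {f : Euc N → ℝ} (hf : ContDiffOn ℝ 2 f {x | x ≠ 0})
    (hfm : Measurable f) (f0 : ∀ y, y ≠ 0 → 0 ≤ f y) (hg : ∀ y, y ≠ 0 → lap f y ≤ 0)
    {x : Euc N} (hx : x ≠ 0) {a b θ δ : ℝ} (ha : 0 < a) (hb : 0 < b) (hθ : 0 < θ)
    (hθx : θ ≤ ‖x‖ / 2) (hδ : 0 < δ) :
    ∃ c, 0 < c ∧ c ≤ δ ∧ ∫⁻ y, ENNReal.ofReal (-lap f y * (a * ramp (barrier x b θ c y / a)) +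
      f y * (ramp' (barrier x b θ c y / a) * psi b (y - x))) ≤
      ENNReal.ofReal (kap N * f x + δ) := by
  have hx0 := norm_pos_iff.2 hx
  obtain ⟨r, hr, hra⟩ := exists_gam_zero_le hN ha
  set K : Set (Euc N) := closedBall x r \ ball 0 θ with hK
  have hKc : IsCompact K := (isCompact_closedBall x r).diff isOpen_ball
  have hK0 : ∀ y ∈ K, y ≠ 0 := fun y hy h => hy.2 (by simp [h, hθ])
  have hfK : ContinuousOn f K := hf.continuousOn.mono hK0
  obtain ⟨C, hC⟩ := hKc.exists_bound_of_continuousOn hfK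
  have hKx : K ∈ 𝓝 x := by
    refine inter_mem (closedBall_mem_nhds x hr) ?_
    have : (closedBall (0 : Euc N) θ)ᶜ ∈ 𝓝 x :=
      isClosed_closedBall.isOpen_compl.mem_nhds (by simp; linarith)
    exact mem_of_superset this (Set.compl_subset_compl.2 ball_subset_closedBall)
  have hxK : x ∈ K := mem_of_mem_nhds hKx
  have hq : ContinuousAt (K.indicator f) x := by
    refine (hf.continuousOn.continuousAt (isOpen_ne_zero.mem_nhds hx)).congr ?_
    filter_upwards [hKx] with y hy
    rw [Set.indicator_of_mem hy]
  have hlim := tendsto_integral_mul_psi hN (hfm.indicator hKc.measurableSet) (C := max C 0)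
    (fun y => by
      by_cases hy : y ∈ K
      · simpa [hy] using (Or.inl (hC y hy))
      · simp [hy]) hq
  rw [Set.indicator_of_mem hxK] at hlim
  obtain ⟨c, ⟨hc1, hc2⟩, hc3⟩ := ((hlim.eventually (ge_mem_nhds (lt_add_of_pos_right _ hδ))).and
    (Ioc_mem_nhdsGT hδ)).exists.imp fun c hc => (⟨hc.2, hc.1⟩ : c ∈ Set.Ioc 0 δ ∧ _)
  refine ⟨c, hc1, hc2, ?_⟩
  set s := barrier x b θ c with hs
  have hsd : ContDiff ℝ 2 s := contDiff_barrier hb hθ hc1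
  have hsK : ∀ y ∉ K, s y / a ≤ 1 := by
    intro y hy
    rw [div_le_one ha]
    by_cases h : ‖y‖ ≤ θ
    · exact (barrier_nonpos hN hx hb hθ hc1 hθx h).trans ha.le
    · have hyr : r ≤ ‖y - x‖ := by
        by_contra hlt
        refine hy ⟨?_, ?_⟩
        · rw [mem_closedBall, dist_eq_norm]; linarith
        · rw [mem_ball_zero_iff]; linarith
      have h1 := hra _ hyr
      have h2 := gam_anti hN (x := y - x) (c := 0) (d := c)
        (pos_add_normSq le_rfl (norm_pos_iff.1 (by linarith))) hc1.le
      have h3 := gam_nonneg hb.le (y - x)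
      have h4 := mul_nonneg (barrierWeight_nonneg x θ) (gam_nonneg (sq_nonneg θ) y)
      rw [hs]; unfold barrier
      linarith
  have hsa : ContDiff ℝ 2 fun y => s y / a := hsd.div_const a
  set φ : Euc N → ℝ := fun y => a * ramp (s y / a) with hφ
  have hφd : ContDiff ℝ 2 φ := contDiff_const.mul (contDiff_ramp.comp hsa)
  set ρ : Euc N → ℝ := fun y => ramp' (s y / a) with hρ
  have hρc : Continuous ρ := continuous_ramp'.comp hsa.continuous
  have supp : ∀ h : Euc N → ℝ, (∀ y ∉ K, h y = 0) → HasCompactSupport h ∧ tsupport h ⊆ K := by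
    intro h hh
    have : tsupport h ⊆ K := closure_minimal
      (fun y hy => by by_contra hyK; exact hy (hh y hyK)) hKc.isClosed
    exact ⟨HasCompactSupport.of_support_subset_isCompact hKc (subset_closure.trans this), this⟩
  have hφ0 : ∀ y ∉ K, φ y = 0 := fun y hy => by simp [hφ, ramp_of_le (hsK y hy)]
  have hρ0 : ∀ y ∉ K, ρ y = 0 := fun y hy => ramp'_of_le (hsK y hy)
  obtain ⟨hφs, hφK⟩ := supp φ hφ0
  have hK0' : K ⊆ {x : Euc N | x ≠ 0} := hK0
  have hpsi : ∀ {c : ℝ}, 0 < c → Continuous fun y : Euc N => psi c (y - x) := fun hc =>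
    ((contDiff_pw (n := 0) hc).continuous.const_mul _).comp (continuous_id.sub continuous_const)
  have int : ∀ {h : Euc N → ℝ} {F : Euc N → ℝ}, Continuous h → (∀ y ∉ K, h y = 0) →
      ContinuousOn F {x : Euc N | x ≠ 0} → Integrable fun y => F y * h y := fun hh h0 hF =>
    integrable_mul_of_hasCompactSupport hF hh (supp _ h0).1 ((supp _ h0).2.trans hK0')
  have ibp := integral_mul_lap_of_contDiffOn isOpen_ne_zero hf (isC11c_of_contDiff hφd hφs)
    (hφK.trans hK0')
  have iP : Integrable fun y => lap f y * φ y :=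
    int hφd.continuous hφ0 (continuousOn_lap isOpen_ne_zero hf)
  have iQ : Integrable fun y => f y * (ρ y * psi b (y - x)) :=
    int (hρc.mul (hpsi hb)) (fun y hy => by simp [hρ0 y hy]) hf.continuousOn
  have iW : Integrable fun y => f y * (ρ y * psi c (y - x)) :=
    int (hρc.mul (hpsi hc1)) (fun y hy => by simp [hρ0 y hy]) hf.continuousOn
  have iL : Integrable fun y => f y * lap φ y :=
    int (continuousOn_univ.1 (continuousOn_lap isOpen_univ hφd.contDiffOn))
      (fun y hy => lap_eq_zero_of_notMem_tsupport fun h => hy (hφK h)) hf.continuousOn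
  have hlap : ∀ y, ρ y * (psi b (y - x) - psi c (y - x)) ≤ lap φ y := by
    intro y
    have hd : ∀ t : ℝ, HasDerivAt (fun t => t / a) (1 / a) t := fun t =>
      (hasDerivAt_id t).div_const a
    have hF : ∀ t : ℝ, HasDerivAt (fun t => a * ramp (t / a)) (ramp' (t / a)) t := fun t => by
      have h : HasDerivAt (fun t => ramp (t / a)) (ramp' (t / a) * (1 / a)) t :=
        HasDerivAt.comp (h₂ := ramp) (h := fun t => t / a) t (hasDerivAt_ramp (t / a)) (hd t)
      exact (h.const_mul a).congr_deriv (by field_simp)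
    have hF' : HasDerivAt (fun t => ramp' (t / a)) (ramp'' (s y / a) / a) (s y) := by
      have h : HasDerivAt (fun t => ramp' (t / a)) (ramp'' (s y / a) * (1 / a)) (s y) :=
        HasDerivAt.comp (h₂ := ramp') (h := fun t => t / a) (s y) (hasDerivAt_ramp' (s y / a)) (hd (s y))
      exact h.congr_deriv (by rw [mul_one_div])
    rw [hφ, lap_comp (F := fun t => a * ramp (t / a)) hsd.contDiffAt.d2At (.of_forall hF) hF']
    have h1 : 0 ≤ ramp'' (s y / a) / a * gdot s s y :=
      mul_nonneg (div_nonneg (ramp''_nonneg _) ha.le) (gdot_self_nonneg _ _)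
    have h2 := mul_le_mul_of_nonneg_left (lap_barrier hN (x := x) hb hθ hc1 y)
      (ramp'_nonneg (s y / a))
    linarith
  have hle : ∫ y, f y * (ρ y * psi b (y - x)) - f y * (ρ y * psi c (y - x)) ≤
      ∫ y, f y * lap φ y := by
    refine integral_mono_ae (iQ.sub iW) iL ?_
    filter_upwards [ae_ne_point hN 0] with y hy
    have := mul_le_mul_of_nonneg_left (hlap y) (f0 y hy)
    linarith
  rw [integral_sub iQ iW, ibp] at hle
  have hW : ∫ y, f y * (ρ y * psi c (y - x)) ≤ ∫ y, K.indicator f y * psi c (y - x) := by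
    refine integral_mono_ae iW ?_ (.of_forall fun y => ?_)
    · have : IntegrableOn (fun y => f y * psi c (y - x)) K :=
        (hfK.mul (hpsi hc1).continuousOn).integrableOn_compact hKc
      refine ((integrable_indicator_iff hKc.measurableSet).2 this).congr (.of_forall fun y => ?_)
      by_cases hy : y ∈ K <;> simp [hy]
    · by_cases hy : y ∈ K
      · simp only [hy, Set.indicator_of_mem]
        refine mul_le_mul_of_nonneg_left ?_ (f0 y (hK0 y hy))
        exact mul_le_of_le_one_left (psi_nonneg hN hc1.le _) (ramp'_le_one _)
      · simp [hy, hρ0 y hy]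
  have hnn : ∀ᵐ y, 0 ≤ -lap f y * φ y + f y * (ρ y * psi b (y - x)) := by
    filter_upwards [ae_ne_point hN 0] with y hy
    exact add_nonneg (mul_nonneg (neg_nonneg.2 (hg y hy)) (mul_nonneg ha.le (ramp_nonneg _)))
      (mul_nonneg (f0 y hy) (mul_nonneg (ramp'_nonneg _) (psi_nonneg hN hb.le _)))
  have iP' : Integrable fun y => -lap f y * φ y := iP.neg.congr (.of_forall fun y => by simp)
  have hI := ofReal_integral_eq_lintegral_ofReal (iP'.add iQ) hnn
  refine hI.symm.le.trans ?_
  refine ENNReal.ofReal_le_ofReal ?_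
  refine (integral_add iP' iQ).le.trans ?_
  simp only [neg_mul, integral_neg]
  linarith

end Riesz

end

section

open scoped Topology ENNReal

section RieszLimit

variable {N : ℕ}

lemma lintegral_ofReal_le_of_tendsto {h : Euc N → ℝ} {g : ℕ → Euc N → ℝ} {A : ℕ → ℝ} {B : ℝ}
    (hg : ∀ n, Measurable (g n)) (hlim : ∀ᵐ y, Tendsto (fun n => g n y) atTop (𝓝 (h y)))
    (hA : ∀ n, ∫⁻ y, ENNReal.ofReal (g n y) ≤ ENNReal.ofReal (A n))
    (hAB : Tendsto A atTop (𝓝 B)) : ∫⁻ y, ENNReal.ofReal (h y) ≤ ENNReal.ofReal B := by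
  calc ∫⁻ y, ENNReal.ofReal (h y) = ∫⁻ y, liminf (fun n => ENNReal.ofReal (g n y)) atTop := by
        refine lintegral_congr_ae ?_
        filter_upwards [hlim] with y hy
        exact ((ENNReal.continuous_ofReal.tendsto _).comp hy).liminf_eq.symm
    _ ≤ liminf (fun n => ∫⁻ y, ENNReal.ofReal (g n y)) atTop :=
        lintegral_liminf_le fun n => (hg n).ennreal_ofReal
    _ ≤ liminf (fun n => ENNReal.ofReal (A n)) atTop := liminf_le_liminf (.of_forall hA)
    _ = ENNReal.ofReal B := ((ENNReal.continuous_ofReal.tendsto _).comp hAB).liminf_eq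

lemma measurable_barrier (x : Euc N) (b θ c : ℝ) : Measurable (barrier x b θ c) := by
  unfold barrier
  exact (((measurable_gam c).comp (by fun_prop)).sub ((measurable_gam b).comp (by fun_prop))).sub
    ((measurable_gam _).const_mul _)

lemma tendsto_barrierWeight (hN : 3 ≤ N) (x : Euc N) {θ : ℕ → ℝ} (hθ : Tendsto θ atTop (𝓝 0)) :
    Tendsto (fun n => barrierWeight x (θ n)) atTop (𝓝 0) := by
  have hN' : (3 : ℝ) ≤ N := by exact_mod_cast hN
  have h1 : Tendsto (fun n => 2 * θ n ^ 2) atTop (𝓝 0) := by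
    simpa using (hθ.pow 2).const_mul 2
  have h2 := h1.rpow_const (p := (N : ℝ) / 2 - 1) (Or.inr (by linarith))
  rw [Real.zero_rpow (by linarith)] at h2
  simpa [barrierWeight] using h2.const_mul ((‖x‖ / 2) ^ ((2 : ℝ) - N))

/-- Riesz-type inequality for a nonnegative superharmonic function on the punctured space. -/
lemma riesz_inequality (hN : 3 ≤ N) {f : Euc N → ℝ} (hf : ContDiffOn ℝ 2 f {x | x ≠ 0})
    (hfm : Measurable f) (f0 : ∀ y, y ≠ 0 → 0 ≤ f y) (hg : ∀ y, y ≠ 0 → lap f y ≤ 0)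
    {x : Euc N} (hx : x ≠ 0) {b : ℝ} (hb : 0 < b) :
    ∫⁻ y, ENNReal.ofReal (-lap f y * (gam 0 (y - x) - gam b (y - x)) + f y * psi b (y - x)) ≤
      ENNReal.ofReal (kap N * f x) := by
  have hx0 := norm_pos_iff.2 hx
  set a : ℕ → ℝ := fun n => 1 / ((n : ℝ) + 1) with ha
  have ha0 : ∀ n, 0 < a n := fun n => by positivity
  have hal : Tendsto a atTop (𝓝 0) := tendsto_one_div_add_atTop_nhds_zero_nat
  have ha1 : ∀ n, a n ≤ 1 := fun n => by
    rw [ha]; simp only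
    rw [div_le_one (by positivity)]
    linarith [Nat.cast_nonneg (α := ℝ) n]
  set θ : ℕ → ℝ := fun n => ‖x‖ / 2 * a n with hθ
  have hθ0 : ∀ n, 0 < θ n := fun n => mul_pos (by positivity) (ha0 n)
  have hθl : Tendsto θ atTop (𝓝 0) := by simpa using hal.const_mul (‖x‖ / 2)
  choose c hc0 hca hc using fun n => riesz_approx hN hf hfm f0 hg hx (ha0 n) hb (hθ0 n)
    (mul_le_of_le_one_right (by positivity) (ha1 n)) (ha0 n)
  have hcl : Tendsto c atTop (𝓝 0) := squeeze_zero (fun n => (hc0 n).le) hca hal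
  refine lintegral_ofReal_le_of_tendsto (A := fun n => kap N * f x + a n) (fun n => ?_) ?_ hc
    (by simpa using hal.const_add (kap N * f x))
  · have h1 := (measurable_barrier x b (θ n) (c n)).div_const (a n)
    have h2 : Measurable fun y : Euc N => psi b (y - x) := (measurable_psi b).comp (by fun_prop)
    exact ((measurable_lap f).neg.mul ((contDiff_ramp.continuous.measurable.comp h1).const_mul _)).add
      (hfm.mul ((continuous_ramp'.measurable.comp h1).mul h2))
  · filter_upwards [ae_ne_point hN 0, ae_ne_point hN x] with y hy hyx
    have hyx' : y - x ≠ 0 := sub_ne_zero.2 hyx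
    have hpos : 0 < gam 0 (y - x) - gam b (y - x) :=
      sub_pos.2 (gam_lt hN (pos_add_normSq le_rfl hyx') hb)
    have hs : Tendsto (fun n => barrier x b (θ n) (c n) y) atTop
        (𝓝 (gam 0 (y - x) - gam b (y - x))) := by
      have h1 : Tendsto (fun n => gam (c n) (y - x)) atTop (𝓝 (gam 0 (y - x))) :=
        (tendsto_gam hyx').comp hcl
      have h2 : Tendsto (fun n => gam (θ n ^ 2) y) atTop (𝓝 (gam 0 y)) :=
        (tendsto_gam hy).comp (by simpa using hθl.pow 2)
      have h3 := (tendsto_barrierWeight hN x hθl).mul h2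
      simpa [barrier] using (h1.sub_const (gam b (y - x))).sub h3
    have h1 := (tendsto_mul_ramp_div hpos.le hs ha0 hal).const_mul (-lap f y)
    have h2 := ((tendsto_ramp'_div hpos hs ha0 hal).mul_const (psi b (y - x))).const_mul (f y)
    simpa using h1.add h2

lemma riesz_mean (hN : 3 ≤ N) {f : Euc N → ℝ} (hf : ContDiffOn ℝ 2 f {x | x ≠ 0})
    (hfm : Measurable f) (f0 : ∀ y, y ≠ 0 → 0 ≤ f y) (hg : ∀ y, y ≠ 0 → lap f y ≤ 0)
    {x : Euc N} (hx : x ≠ 0) {b : ℝ} (hb : 0 < b) :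
    ∫⁻ y, ENNReal.ofReal (f y * psi b (y - x)) ≤ ENNReal.ofReal (kap N * f x) := by
  refine (lintegral_mono_ae ?_).trans (riesz_inequality hN hf hfm f0 hg hx hb)
  filter_upwards [ae_ne_point hN 0, ae_ne_point hN x] with y hy hyx
  refine ENNReal.ofReal_le_ofReal (le_add_of_nonneg_left ?_)
  exact mul_nonneg (neg_nonneg.2 (hg y hy))
    (sub_nonneg.2 (gam_anti hN (pos_add_normSq le_rfl (sub_ne_zero.2 hyx)) hb.le))

/-- The Newtonian potential of `-Δf` is dominated by `f`. -/
lemma riesz_potential (hN : 3 ≤ N) {f : Euc N → ℝ} (hf : ContDiffOn ℝ 2 f {x | x ≠ 0})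
    (hfm : Measurable f) (f0 : ∀ y, y ≠ 0 → 0 ≤ f y) (hg : ∀ y, y ≠ 0 → lap f y ≤ 0)
    {x : Euc N} (hx : x ≠ 0) :
    ∫⁻ y, ENNReal.ofReal (-lap f y * gam 0 (y - x)) ≤ ENNReal.ofReal (kap N * f x) := by
  refine lintegral_ofReal_le_of_tendsto (A := fun _ => kap N * f x)
    (g := fun n y => -lap f y * (gam 0 (y - x) - gam ((n : ℝ) + 1) (y - x))) (fun n => ?_) ?_
    (fun n => ?_) tendsto_const_nhds
  · exact (measurable_lap f).neg.mul (((measurable_gam _).comp (by fun_prop)).sub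
      ((measurable_gam _).comp (by fun_prop)))
  · refine .of_forall fun y => ?_
    have h : Tendsto (fun n : ℕ => (n : ℝ) + 1) atTop atTop :=
      tendsto_atTop_add_const_right _ _ tendsto_natCast_atTop_atTop
    have := ((tendsto_gam_atTop hN (y - x)).comp h).const_sub (gam 0 (y - x))
    simpa using this.const_mul (-lap f y)
  · refine (lintegral_mono_ae ?_).trans
      (riesz_inequality hN hf hfm f0 hg hx (b := (n : ℝ) + 1) (by positivity))
    filter_upwards [ae_ne_point hN 0] with y hy
    exact ENNReal.ofReal_le_ofReal (le_add_of_nonneg_right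
      (mul_nonneg (f0 y hy) (psi_nonneg hN (by positivity) _)))

end RieszLimit

end

section

open scoped Topology ENNReal

variable {N : ℕ}

lemma integrableOn_norm_rpow (hN : 3 ≤ N) {s : ℝ} (hs : -(N : ℝ) < s) (R : ℝ) :
    IntegrableOn (fun y : Euc N => ‖y‖ ^ s) (ball 0 R) := by
  have := nontrivial_euc hN
  have h2 : (3 : ℝ) ≤ N := by exact_mod_cast hN
  have key : Integrable (fun y : Euc N => (Set.Iio R).indicator (fun r : ℝ => r ^ s) ‖y‖) volume := by
    rw [integrable_fun_norm_addHaar volume (f := (Set.Iio R).indicator (fun r : ℝ => r ^ s))]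
    have h3 : IntegrableOn (fun r : ℝ => r ^ ((N : ℝ) - 1 + s)) (Set.Ioo 0 R) := by
      rcases le_or_gt R 0 with hR | hR
      · simp [Set.Ioo_eq_empty (not_lt.2 hR)]
      · exact (intervalIntegral.integrableOn_Ioo_rpow_iff hR).2 (by linarith)
    have h4 : IntegrableOn ((Set.Iio R).indicator (fun r : ℝ => r ^ ((N : ℝ) - 1 + s))) (Set.Ioi 0) := by
      rw [IntegrableOn, integrable_indicator_iff measurableSet_Iio, IntegrableOn,
        Measure.restrict_restrict measurableSet_Iio, Set.inter_comm, Set.Ioi_inter_Iio]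
      exact h3
    refine h4.congr_fun (fun r hr => ?_) measurableSet_Ioi
    have hr' : (0 : ℝ) < r := hr
    by_cases hR : r < R
    · simp only [Set.indicator, Set.mem_Iio, hR, if_true, finrank_euclideanSpace, Fintype.card_fin,
        smul_eq_mul]
      rw [← Real.rpow_natCast, ← Real.rpow_add hr', Nat.cast_sub (by lia)]
      simp
    · simp [Set.indicator, hR]
  have h5 : (fun y : Euc N => (Set.Iio R).indicator (fun r : ℝ => r ^ s) ‖y‖)
      = (ball 0 R).indicator (fun y => ‖y‖ ^ s) := by
    ext y; simp [Set.indicator]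
  rw [h5] at key
  exact (integrable_indicator_iff measurableSet_ball).1 key

lemma integrableOn_gam_zero (hN : 3 ≤ N) (x : Euc N) (R : ℝ) :
    IntegrableOn (fun y => gam 0 (y - x)) (ball x R) := by
  have h1 : IntegrableOn (gam 0 : Euc N → ℝ) (ball 0 R) := by
    have := integrableOn_norm_rpow hN (s := 2 - N) (by linarith) R
    exact this.congr_fun (fun y _ => (gam_zero_eq y).symm) measurableSet_ball
  have h2 := ((integrable_indicator_iff measurableSet_ball).2 h1).comp_sub_right x
  refine (integrable_indicator_iff measurableSet_ball).1 (h2.congr (.of_forall fun y => ?_))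
  simp only [Set.indicator, mem_ball, dist_eq_norm, sub_zero]

lemma integrable_gam_zero_mul (hN : 3 ≤ N) (x : Euc N) {h : Euc N → ℝ} {C : ℝ}
    (hm : Measurable h) (hC : ∀ y, ‖h y‖ ≤ C) (hs : HasCompactSupport h) :
    Integrable (fun y => gam 0 (y - x) * h y) := by
  obtain ⟨R, hR⟩ := hs.isCompact.isBounded.subset_ball x
  refine integrable_mul_of_bounded (integrableOn_gam_zero hN x R) measurableSet_ball
    hm.aestronglyMeasurable hC fun y hy => ?_
  exact image_eq_zero_of_notMem_tsupport fun h' => hy (hR h')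

lemma gam_comm_sub (c : ℝ) (x y : Euc N) : gam c (x - y) = gam c (y - x) := by
  simp only [gam, pw, norm_sub_rev]

lemma contDiff_gam_sub {c : ℝ} (hc : 0 < c) (x : Euc N) : ContDiff ℝ 2 fun y => gam c (y - x) :=
  (contDiff_gam hc).comp (contDiff_id.sub contDiff_const)

lemma lap_gam_sub {c : ℝ} (hc : 0 < c) (x y : Euc N) :
    lap (fun y => gam c (y - x)) y = -psi c (y - x) := by
  rw [lap_comp_sub, lap_gam (by positivity)]

lemma tendsto_integral_mul_gam (hN : 3 ≤ N) (x : Euc N) {h : Euc N → ℝ} (hm : Measurable h)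
    (hi : Integrable (fun y => gam 0 (y - x) * h y)) :
    Tendsto (fun c => ∫ y, gam c (y - x) * h y) (𝓝[>] 0) (𝓝 (∫ y, gam 0 (y - x) * h y)) := by
  have hae : ∀ᵐ y : Euc N, y ≠ x := ae_ne_point hN x
  refine tendsto_integral_filter_of_dominated_convergence (fun y => ‖gam 0 (y - x) * h y‖) ?_ ?_
    hi.norm ?_
  · refine .of_forall fun c => ?_
    exact (((measurable_gam c).comp (by fun_prop)).mul hm).aestronglyMeasurable
  · filter_upwards [self_mem_nhdsWithin] with c hc
    have hc : 0 < c := hc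
    filter_upwards [hae] with y hy
    have hp := pos_add_normSq le_rfl (sub_ne_zero.2 hy)
    rw [norm_mul, norm_mul, Real.norm_of_nonneg (gam_nonneg hc.le _),
      Real.norm_of_nonneg (gam_nonneg le_rfl _)]
    exact mul_le_mul_of_nonneg_right (gam_anti hN hp hc.le) (norm_nonneg _)
  · filter_upwards [hae] with y hy
    exact ((tendsto_gam (sub_ne_zero.2 hy)).mono_left nhdsWithin_le_nhds).mul_const _

lemma integral_gam_mul_lap (hN : 3 ≤ N) {φ : Euc N → ℝ} (hφ : ContDiff ℝ 2 φ)
    (hs : HasCompactSupport φ) (x : Euc N) :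
    ∫ y, gam 0 (y - x) * lap φ y = -(kap N * φ x) := by
  have hφ' := isC11c_of_contDiff hφ hs
  obtain ⟨C, hC⟩ := hφ'.exists_bound
  obtain ⟨C', hC'⟩ := hφ'.exists_bound_lap
  have hls : HasCompactSupport (lap φ) := hs.mono' fun y hy => by
    by_contra h
    exact hy (lap_eq_zero_of_notMem_tsupport h)
  have h1 := tendsto_integral_mul_gam hN x (measurable_lap φ)
    (integrable_gam_zero_mul hN x (measurable_lap φ) hC' hls)
  have h2 := (tendsto_integral_mul_psi hN hφ.continuous.measurable hC
    (hφ.continuous.continuousAt (x := x))).neg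
  refine tendsto_nhds_unique h1 (h2.congr' ?_)
  filter_upwards [self_mem_nhdsWithin] with c hc
  have hc : 0 < c := hc
  rw [integral_mul_lap_of_contDiffOn isOpen_univ (contDiff_gam_sub hc x).contDiffOn hφ'
    (Set.subset_univ _), ← integral_neg]
  congr 1; ext y
  rw [lap_gam_sub hc]; ring

end

section

open scoped Topology ENNReal

variable {N : ℕ}

lemma exists_cutoff_seq (N : ℕ) : ∃ (C : ℝ) (ζ : ℕ → Euc N → ℝ), 0 ≤ C ∧ ∀ n, ContDiff ℝ 2 (ζ n) ∧
    (∀ᶠ y in 𝓝 0, ζ n y = 0) ∧ (∀ y, ζ n y ∈ Set.Icc (0 : ℝ) 1) ∧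
    (∀ y, ‖fderiv ℝ (ζ n) y‖ ≤ C * ‖y‖⁻¹) ∧ (∀ y, ‖lap (ζ n) y‖ ≤ C * (‖y‖ ^ 2)⁻¹) ∧
    (∀ y, 2 ≤ (n + 1) * ‖y‖ → fderiv ℝ (ζ n) y = 0 ∧ lap (ζ n) y = 0 ∧ ζ n y = 1) := by
  obtain ⟨χ, hχ, hcs, hsupp, hone, hIcc⟩ := exists_cutoff (isCompact_closedBall (0 : Euc N) 1)
    (isOpen_ball (x := (0 : Euc N)) (ε := 2)) (closedBall_subset_ball one_lt_two)
  have hχ' := isC11c_of_contDiff hχ hcs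
  obtain ⟨C1, hC1⟩ := hχ'.exists_bound_fderiv
  obtain ⟨C2, hC2⟩ := hχ'.exists_bound_lap
  have hC1' : 0 ≤ C1 := (norm_nonneg _).trans (hC1 0)
  have hC2' : 0 ≤ C2 := (norm_nonneg _).trans (hC2 0)
  refine ⟨2 * C1 + 4 * C2, fun n y => 1 - χ (((n : ℝ) + 1) • y), by positivity, fun n => ?_⟩
  have hn : (0 : ℝ) < (n : ℝ) + 1 := by positivity
  have hsm : ContDiff ℝ 2 fun y : Euc N => χ (((n : ℝ) + 1) • y) :=
    hχ.comp (contDiff_const_smul _)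
  have hfd : ∀ y : Euc N, fderiv ℝ (fun y => 1 - χ (((n : ℝ) + 1) • y)) y
      = -(((n : ℝ) + 1) • fderiv ℝ χ (((n : ℝ) + 1) • y)) := fun y => by
    rw [fderiv_const_sub, fderiv_comp_smul]
  have hlap : ∀ y : Euc N, lap (fun y => 1 - χ (((n : ℝ) + 1) • y)) y
      = -(((n : ℝ) + 1) ^ 2 * lap χ (((n : ℝ) + 1) • y)) := fun y => by
    rw [lap_sub contDiffAt_const.d2At hsm.contDiffAt.d2At, lap_const, lap_comp_smul]; ring
  have hout : ∀ y : Euc N, 2 ≤ (n + 1) * ‖y‖ → ((n : ℝ) + 1) • y ∉ tsupport χ := fun y hy h => by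
    have := hsupp h
    rw [mem_ball_zero_iff, norm_smul, Real.norm_of_nonneg hn.le] at this
    linarith
  have hfar : ∀ y : Euc N, 2 ≤ (n + 1) * ‖y‖ →
      fderiv ℝ (fun y => 1 - χ (((n : ℝ) + 1) • y)) y = 0 ∧
      lap (fun y => 1 - χ (((n : ℝ) + 1) • y)) y = 0 ∧ 1 - χ (((n : ℝ) + 1) • y) = 1 := by
    intro y hy
    have h := hout y hy
    refine ⟨?_, ?_, ?_⟩
    · rw [hfd, fderiv_of_notMem_tsupport ℝ h]; simp
    · rw [hlap, lap_eq_zero_of_notMem_tsupport h]; simp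
    · rw [image_eq_zero_of_notMem_tsupport h]; simp
  have hpos : ∀ y : Euc N, (n + 1) * ‖y‖ < 2 → y ≠ 0 → ((n : ℝ) + 1) ≤ 2 * ‖y‖⁻¹ := fun y hy h0 => by
    have := norm_pos_iff.2 h0
    rw [← div_eq_mul_inv, le_div_iff₀ this]; exact hy.le
  have h1 : ∀ᶠ z : Euc N in 𝓝 0, χ z = 1 :=
    hone.filter_mono (nhds_le_nhdsSet (by simp))
  have h2 : ∀ᶠ y : Euc N in 𝓝 0, χ (((n : ℝ) + 1) • y) = 1 := by
    have : Tendsto (fun y : Euc N => ((n : ℝ) + 1) • y) (𝓝 0) (𝓝 0) := by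
      have : ContinuousAt (fun y : Euc N => ((n : ℝ) + 1) • y) 0 := by fun_prop
      simpa [ContinuousAt] using this
    exact this.eventually h1
  have hz : fderiv ℝ χ 0 = 0 := by
    have : χ =ᶠ[𝓝 0] fun _ => (1 : ℝ) := h1
    rw [this.fderiv_eq]; simp
  have hz' : lap χ 0 = 0 := by
    have : χ =ᶠ[𝓝 0] fun _ => (1 : ℝ) := h1
    rw [lap_congr this, lap_const]
  refine ⟨contDiff_const.sub hsm, ?_, fun y => ?_, fun y => ?_, fun y => ?_, hfar⟩
  · filter_upwards [h2] with y hy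
    rw [hy, sub_self]
  · have := hIcc (((n : ℝ) + 1) • y)
    exact ⟨by linarith [this.2], by linarith [this.1]⟩
  · by_cases hy : 2 ≤ (n + 1) * ‖y‖
    · rw [(hfar y hy).1, norm_zero]; positivity
    · by_cases h0 : y = 0
      · rw [hfd, h0, smul_zero, hz]; simp
      · rw [hfd, norm_neg, norm_smul, Real.norm_of_nonneg hn.le]
        calc _ ≤ (2 * ‖y‖⁻¹) * C1 := mul_le_mul (hpos y (not_le.1 hy) h0) (hC1 _) (norm_nonneg _)
              (by positivity)
          _ ≤ _ := by
            have : 0 ≤ C2 * ‖y‖⁻¹ := by positivity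
            nlinarith
  · by_cases hy : 2 ≤ (n + 1) * ‖y‖
    · rw [(hfar y hy).2.1, norm_zero]; positivity
    · by_cases h0 : y = 0
      · rw [hlap, h0, smul_zero, hz']; simp
      · rw [hlap, norm_neg, norm_mul, Real.norm_of_nonneg (by positivity)]
        calc _ ≤ (2 * ‖y‖⁻¹) ^ 2 * C2 := mul_le_mul
              (pow_le_pow_left₀ hn.le (hpos y (not_le.1 hy) h0) 2) (hC2 _) (norm_nonneg _)
              (by positivity)
          _ ≤ _ := by
            have : 0 ≤ C1 * (‖y‖ ^ 2)⁻¹ := by positivity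
            rw [mul_pow, inv_pow]
            nlinarith

/-- Green's identity on the punctured space when the point singularity is removable. -/
lemma integral_mul_lap_of_removable {ω φ : Euc N → ℝ} {σ C : ℝ} (hN : 3 ≤ N)
    (hω : ContDiffOn ℝ 2 ω {x | x ≠ 0})
    (hφ : ∀ ζ : Euc N → ℝ, ContDiff ℝ 2 ζ → (∀ᶠ y in 𝓝 0, ζ y = 0) → IsC11c fun y => ζ y * φ y)
    (h0 : ∀ y, y ≠ 0 → ‖y‖ < 2 → ‖φ y‖ ≤ C * ‖y‖ ^ σ)
    (h1 : ∀ y, y ≠ 0 → ‖y‖ < 2 → ‖fderiv ℝ φ y‖ ≤ C * ‖y‖ ^ (σ - 1))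
    (hi : IntegrableOn (fun y => ω y * ‖y‖ ^ (σ - 2)) (ball 0 2))
    (hi1 : Integrable fun y => ω y * lap φ y) (hi2 : Integrable fun y => lap ω y * φ y) :
    ∫ y, ω y * lap φ y = ∫ y, lap ω y * φ y := by
  obtain ⟨D, ζ, hD, hζ⟩ := exists_cutoff_seq N
  have hne := ae_ne_point hN (0 : Euc N)
  have htend : ∀ y : Euc N, y ≠ 0 → ∀ᶠ n : ℕ in atTop, 2 ≤ ((n : ℝ) + 1) * ‖y‖ := fun y hy => by
    have h : Tendsto (fun n : ℕ => ((n : ℝ) + 1) * ‖y‖) atTop atTop :=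
      (tendsto_atTop_add_const_right _ _ tendsto_natCast_atTop_atTop).atTop_mul_const
        (norm_pos_iff.2 hy)
    exact h.eventually_ge_atTop 2
  have hd2 : ∀ᵐ y, ∀ n, D2At (fun y => ζ n y * φ y) y :=
    ae_all_iff.2 fun n => (hφ _ (hζ n).1 (hζ n).2.1).ae_d2At
  have hφ2 : ∀ᵐ y, D2At φ y := by
    filter_upwards [hne, hd2] with y hy h
    have h2 := htend ((2 : ℝ)⁻¹ • ((2 : ℝ)⁻¹ • y)) (by simpa using hy)
    obtain ⟨n, hn⟩ := h2.exists
    rw [norm_smul, norm_smul] at hn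
    norm_num at hn
    have h3 := h n
    have h4 : (fun z => ζ n z * φ z) =ᶠ[𝓝 y] φ := by
      have : ∀ᶠ z : Euc N in 𝓝 y, 2 < ((n : ℝ) + 1) * ‖z‖ := by
        have hc : ContinuousAt (fun z : Euc N => ((n : ℝ) + 1) * ‖z‖) y := by fun_prop
        refine hc.eventually_const_lt ?_
        linarith
      filter_upwards [this] with z hz
      rw [((hζ n).2.2.2.2.2 z hz.le).2.2, one_mul]
    refine ⟨?_, ?_⟩
    · have := h3.1
      filter_upwards [this, h4.eventually_nhds] with z hz hz2
      exact (Filter.EventuallyEq.differentiableAt_iff hz2).1 hz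
    · exact (h4.fderiv.differentiableAt_iff).1 h3.2
  have hlim1 : Tendsto (fun n => ∫ y, ω y * lap (fun y => ζ n y * φ y) y) atTop
      (𝓝 (∫ y, ω y * lap φ y)) := by
    have hdom : Integrable fun y => ‖ω y * lap φ y‖ + (ball (0 : Euc N) 2).indicator
        (fun y => (D * C + 2 * N * D * C) * ‖ω y * ‖y‖ ^ (σ - 2)‖) y :=
      hi1.norm.add ((integrable_indicator_iff measurableSet_ball).2 (hi.norm.const_mul _))
    refine tendsto_integral_of_dominated_convergence _ (fun n => ?_) hdom (fun n => ?_) ?_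
    · exact ((measurable_of_continuousOn_compl_singleton 0
        (hω.continuousOn)).mul (measurable_lap _)).aestronglyMeasurable
    · filter_upwards [hne, hφ2] with y hy hy2
      obtain ⟨c1, -, c2, c3, c4, c5⟩ := hζ n
      rw [lap_mul c1.contDiffAt.d2At hy2]
      by_cases hyb : ‖y‖ < 2
      · have hyp := norm_pos_iff.2 hy
        have e1 : ‖φ y * lap (ζ n) y‖ ≤ D * C * ‖y‖ ^ (σ - 2) := by
          rw [norm_mul]
          refine (mul_le_mul (h0 y hy hyb) (c4 y) (norm_nonneg _)
            ((norm_nonneg _).trans (h0 y hy hyb))).trans_eq ?_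
          rw [Real.rpow_sub hyp, Real.rpow_two]; ring
        have e2 : ‖2 * gdot (ζ n) φ y‖ ≤ 2 * N * D * C * ‖y‖ ^ (σ - 2) := by
          rw [norm_mul, Real.norm_ofNat, Real.norm_eq_abs]
          have : ‖fderiv ℝ (ζ n) y‖ * ‖fderiv ℝ φ y‖ ≤ (D * ‖y‖⁻¹) * (C * ‖y‖ ^ (σ - 1)) :=
            mul_le_mul (c3 y) (h1 y hy hyb) (norm_nonneg _) (by positivity)
          have e3 : (D * ‖y‖⁻¹) * (C * ‖y‖ ^ (σ - 1)) = D * C * ‖y‖ ^ (σ - 2) := by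
            rw [show σ - 2 = σ - 1 - 1 by ring, Real.rpow_sub hyp (σ - 1), Real.rpow_one]; ring
          have := abs_gdot_le (ζ n) φ y
          have hN0 : (0 : ℝ) ≤ N := by positivity
          nlinarith
        have e4 : ‖ζ n y * lap φ y‖ ≤ ‖lap φ y‖ := by
          rw [norm_mul, Real.norm_of_nonneg (c2 y).1]
          exact mul_le_of_le_one_left (norm_nonneg _) (c2 y).2
        rw [Set.indicator_of_mem (by simpa using hyb), norm_mul, norm_mul, norm_mul,
          Real.norm_of_nonneg (by positivity : 0 ≤ ‖y‖ ^ (σ - 2))]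
        have := (norm_add₃_le (a := ζ n y * lap φ y) (b := φ y * lap (ζ n) y)
          (c := 2 * gdot (ζ n) φ y))
        have hωn := norm_nonneg (ω y)
        nlinarith
      · have h2 : 2 ≤ ((n : ℝ) + 1) * ‖y‖ := by
          have : (0 : ℝ) ≤ n := by positivity
          nlinarith [not_lt.1 hyb, norm_nonneg y]
        obtain ⟨d1, d2, d3⟩ := c5 y h2
        have hg : gdot (ζ n) φ y = 0 := by
          have := abs_gdot_le (ζ n) φ y
          rw [d1] at this
          simpa using this
        rw [d2, d3, hg, Set.indicator_of_notMem (by simpa using hyb)]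
        simp
    · filter_upwards [hne, hφ2] with y hy hy2
      refine tendsto_const_nhds.congr' ?_
      filter_upwards [htend y hy] with n hn
      obtain ⟨d1, d2, d3⟩ := (hζ n).2.2.2.2.2 y hn
      have hg : gdot (ζ n) φ y = 0 := by
        have := abs_gdot_le (ζ n) φ y
        rw [d1] at this
        simpa using this
      rw [lap_mul (hζ n).1.contDiffAt.d2At hy2, d2, d3, hg]
      simp
  have hlim2 : Tendsto (fun n => ∫ y, lap ω y * (ζ n y * φ y)) atTop
      (𝓝 (∫ y, lap ω y * φ y)) := by
    refine tendsto_integral_of_dominated_convergence _ (fun n => ?_) hi2.norm (fun n => ?_) ?_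
    · refine ((hi2.aestronglyMeasurable.mul (hζ n).1.continuous.aestronglyMeasurable)).congr
        (.of_forall fun y => ?_)
      simp only [Pi.mul_apply]; ring
    · refine .of_forall fun y => ?_
      have c2 := (hζ n).2.2.1 y
      rw [show lap ω y * (ζ n y * φ y) = ζ n y * (lap ω y * φ y) by ring, norm_mul,
        Real.norm_of_nonneg c2.1]
      exact mul_le_of_le_one_left (norm_nonneg _) c2.2
    · filter_upwards [hne] with y hy
      refine tendsto_const_nhds.congr' ?_
      filter_upwards [htend y hy] with n hn
      rw [((hζ n).2.2.2.2.2 y hn).2.2, one_mul]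
  refine tendsto_nhds_unique hlim1 (hlim2.congr fun n => ?_)
  refine (integral_mul_lap_of_contDiffOn isOpen_ne_zero hω (hφ _ (hζ n).1 (hζ n).2.1) ?_).symm
  intro y hy h00
  have h00 : y = 0 := h00
  have : ∀ᶠ y in 𝓝 (0 : Euc N), ζ n y * φ y = 0 := by
    filter_upwards [(hζ n).2.1] with y hy
    rw [hy, zero_mul]
  exact (notMem_tsupport_iff_eventuallyEq.2 this) (h00 ▸ hy)

end

section

open scoped Topology ENNReal

variable {N : ℕ}

/-- Nonnegative classical superharmonic functions on the punctured space. -/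
structure IsSuper (f : Euc N → ℝ) : Prop where
  contDiffOn : ContDiffOn ℝ 2 f {x | x ≠ 0}
  nonneg : ∀ y, y ≠ 0 → 0 ≤ f y
  lap_nonpos : ∀ y, y ≠ 0 → lap f y ≤ 0

lemma integrable_of_lintegral_ofReal_le {h : Euc N → ℝ} {A : ℝ} (hm : Measurable h)
    (h0 : ∀ᵐ y, 0 ≤ h y) (hA : ∫⁻ y, ENNReal.ofReal (h y) ≤ ENNReal.ofReal A) : Integrable h := by
  refine ⟨hm.aestronglyMeasurable, ?_⟩
  rw [hasFiniteIntegral_iff_ofReal h0]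
  exact hA.trans_lt ENNReal.ofReal_lt_top

lemma integral_le_of_lintegral_ofReal_le {h : Euc N → ℝ} {A : ℝ} (hm : Measurable h) (hA0 : 0 ≤ A)
    (h0 : ∀ᵐ y, 0 ≤ h y) (hA : ∫⁻ y, ENNReal.ofReal (h y) ≤ ENNReal.ofReal A) : ∫ y, h y ≤ A := by
  rw [integral_eq_lintegral_of_nonneg_ae h0 hm.aestronglyMeasurable]
  exact ENNReal.toReal_le_of_le_ofReal hA0 hA

namespace IsSuper

variable {f : Euc N → ℝ}

lemma continuousOn (hf : IsSuper f) : ContinuousOn f {x | x ≠ 0} := hf.contDiffOn.continuousOn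

lemma measurable (hf : IsSuper f) : Measurable f :=
  measurable_of_continuousOn_compl_singleton 0 hf.continuousOn

lemma integrable_mean (hN : 3 ≤ N) (hf : IsSuper f) {x : Euc N} (hx : x ≠ 0) {b : ℝ} (hb : 0 < b) :
    Integrable fun y => f y * psi b (y - x) := by
  refine integrable_of_lintegral_ofReal_le
    (hf.measurable.mul ((measurable_psi b).comp (by fun_prop))) ?_
    (riesz_mean hN hf.contDiffOn hf.measurable hf.nonneg hf.lap_nonpos hx hb)
  filter_upwards [ae_ne_point hN 0] with y hy
  exact mul_nonneg (hf.nonneg y hy) (psi_nonneg hN hb.le _)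

lemma integral_mean_le (hN : 3 ≤ N) (hf : IsSuper f) {x : Euc N} (hx : x ≠ 0) {b : ℝ}
    (hb : 0 < b) : ∫ y, f y * psi b (y - x) ≤ kap N * f x := by
  refine integral_le_of_lintegral_ofReal_le
    (hf.measurable.mul ((measurable_psi b).comp (by fun_prop)))
    (mul_nonneg (kap_pos hN).le (hf.nonneg x hx)) ?_
    (riesz_mean hN hf.contDiffOn hf.measurable hf.nonneg hf.lap_nonpos hx hb)
  filter_upwards [ae_ne_point hN 0] with y hy
  exact mul_nonneg (hf.nonneg y hy) (psi_nonneg hN hb.le _)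

lemma integrable_potential (hN : 3 ≤ N) (hf : IsSuper f) {x : Euc N} (hx : x ≠ 0) :
    Integrable fun y => -lap f y * gam 0 (y - x) := by
  refine integrable_of_lintegral_ofReal_le
    ((measurable_lap f).neg.mul ((measurable_gam 0).comp (by fun_prop))) ?_
    (riesz_potential hN hf.contDiffOn hf.measurable hf.nonneg hf.lap_nonpos hx)
  filter_upwards [ae_ne_point hN 0] with y hy
  exact mul_nonneg (by linarith [hf.lap_nonpos y hy]) (gam_nonneg le_rfl _)

end IsSuper

lemma exists_ne_zero (hN : 3 ≤ N) : ∃ x : Euc N, x ≠ 0 := by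
  have := nontrivial_euc hN
  exact exists_ne 0

/-- A function which is integrable against a radially decreasing positive weight is locally
integrable. -/
lemma integrableOn_ball_of_mul {h w : Euc N → ℝ} (hm : Measurable h) (R : ℝ) {c : ℝ} (hc : 0 < c)
    (hw : ∀ᵐ y, y ∈ ball (0 : Euc N) R → c ≤ w y) (hi : Integrable fun y => h y * w y) :
    IntegrableOn h (ball 0 R) := by
  refine Integrable.mono' (hi.norm.const_mul c⁻¹).integrableOn hm.aestronglyMeasurable ?_
  rw [ae_restrict_iff' measurableSet_ball]
  filter_upwards [hw] with y hy hyR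
  have h1 := hy hyR
  rw [norm_mul, Real.norm_of_nonneg (hc.le.trans h1), inv_mul_eq_div, le_div_iff₀ hc]
  exact mul_le_mul_of_nonneg_left h1 (norm_nonneg _)

lemma le_psi (hN : 3 ≤ N) {b r : ℝ} (hb : 0 < b) {z : Euc N} (hz : ‖z‖ ≤ r) :
    (N : ℝ) * (N - 2) * b * (b + r ^ 2) ^ (-1 - (N : ℝ) / 2) ≤ psi b z := by
  have h2 : (3 : ℝ) ≤ N := by exact_mod_cast hN
  unfold psi pw
  refine mul_le_mul_of_nonneg_left ?_ (mul_nonneg (mul_nonneg (by linarith) (by linarith)) hb.le)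
  refine Real.rpow_le_rpow_of_nonpos (by positivity) ?_ (by linarith)
  have := pow_le_pow_left₀ (norm_nonneg z) hz 2
  linarith

lemma le_gam_zero (hN : 3 ≤ N) {r : ℝ} {z : Euc N} (hz : z ≠ 0) (hzr : ‖z‖ ≤ r) :
    r ^ ((2 : ℝ) - N) ≤ gam 0 z := by
  have h2 : (3 : ℝ) ≤ N := by exact_mod_cast hN
  rw [gam_zero_eq]
  exact Real.rpow_le_rpow_of_nonpos (norm_pos_iff.2 hz) hzr (by linarith)

namespace IsSuper

variable {f : Euc N → ℝ}

lemma integrableOn_ball (hN : 3 ≤ N) (hf : IsSuper f) (R : ℝ) : IntegrableOn f (ball 0 R) := by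
  have h2 : (3 : ℝ) ≤ N := by exact_mod_cast hN
  obtain ⟨x, hx⟩ := exists_ne_zero hN
  refine integrableOn_ball_of_mul hf.measurable R
    (c := (N : ℝ) * (N - 2) * 1 * (1 + (R + ‖x‖) ^ 2) ^ (-1 - (N : ℝ) / 2)) ?_
    (.of_forall fun y hy => ?_) (hf.integrable_mean hN hx one_pos)
  · have : (0 : ℝ) < N - 2 := by linarith
    positivity
  · refine le_psi hN one_pos ((norm_sub_le _ _).trans ?_)
    rw [mem_ball_zero_iff] at hy
    linarith

lemma integrableOn_ball_lap (hN : 3 ≤ N) (hf : IsSuper f) (R : ℝ) :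
    IntegrableOn (lap f) (ball 0 R) := by
  obtain ⟨x, hx⟩ := exists_ne_zero hN
  have h : IntegrableOn (fun y => -lap f y) (ball 0 R) := by
    refine integrableOn_ball_of_mul (measurable_lap f).neg R
      (c := (|R| + ‖x‖) ^ ((2 : ℝ) - N)) ?_ ?_ (hf.integrable_potential hN hx)
    · have := norm_pos_iff.2 hx
      positivity
    · filter_upwards [ae_ne_point hN x] with y hy hyR
      refine le_gam_zero hN (sub_ne_zero.2 hy) ((norm_sub_le _ _).trans ?_)
      rw [mem_ball_zero_iff] at hyR
      linarith [le_abs_self R]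
  exact h.neg.congr_fun (fun y _ => by simp) measurableSet_ball

end IsSuper

lemma hasCompactSupport_lap {φ : Euc N → ℝ} (hs : HasCompactSupport φ) :
    HasCompactSupport (lap φ) := hs.mono' fun y hy => by
  by_contra h
  exact hy (lap_eq_zero_of_notMem_tsupport h)

lemma integrable_mul_of_integrableOn_ball {f g : Euc N → ℝ} {C : ℝ}
    (hf : ∀ R, IntegrableOn f (ball 0 R)) (hg : Measurable g) (hC : ∀ x, ‖g x‖ ≤ C)
    (hs : HasCompactSupport g) : Integrable fun y => f y * g y := by
  obtain ⟨R, hR⟩ := hs.isCompact.isBounded.subset_ball 0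
  refine integrable_mul_of_bounded (hf R) measurableSet_ball
    hg.aestronglyMeasurable hC fun y hy => ?_
  exact image_eq_zero_of_notMem_tsupport fun h' => hy (hR h')

/-- If `f |y|⁻²` is locally integrable, Green's identity holds across the origin. -/
lemma IsSuper.integral_mul_lap (hN : 3 ≤ N) {f : Euc N → ℝ} (hf : IsSuper f)
    (hi : IntegrableOn (fun y => f y * ‖y‖ ^ (-2 : ℝ)) (ball 0 2)) {φ : Euc N → ℝ}
    (hφ : ContDiff ℝ 2 φ) (hs : HasCompactSupport φ) :
    ∫ y, f y * lap φ y = ∫ y, lap f y * φ y := by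
  have hφ' := isC11c_of_contDiff hφ hs
  obtain ⟨C1, hC1⟩ := hφ'.exists_bound
  obtain ⟨C2, hC2⟩ := hφ'.exists_bound_fderiv
  obtain ⟨C3, hC3⟩ := hφ'.exists_bound_lap
  have hC1' : 0 ≤ C1 := (norm_nonneg _).trans (hC1 0)
  have hC2' : 0 ≤ C2 := (norm_nonneg _).trans (hC2 0)
  refine integral_mul_lap_of_removable hN (σ := 0) (C := C1 + 2 * C2) hf.contDiffOn ?_ ?_ ?_ ?_ ?_ ?_
  · intro ζ hζ _
    exact isC11c_of_contDiff (hζ.mul hφ) hs.mul_left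
  · intro y hy _
    rw [Real.rpow_zero]
    linarith [hC1 y]
  · intro y hy hy2
    have hp := norm_pos_iff.2 hy
    rw [zero_sub, Real.rpow_neg_one]
    have h1 : 1 ≤ 2 * ‖y‖⁻¹ := by
      rw [← div_eq_mul_inv, le_div_iff₀ hp]; linarith
    have h2 : 0 ≤ C1 * ‖y‖⁻¹ := by positivity
    nlinarith [hC2 y]
  · simpa using hi
  · exact integrable_mul_of_integrableOn_ball (hf.integrableOn_ball hN) (measurable_lap φ) hC3
      (hasCompactSupport_lap hs)
  · exact integrable_mul_of_integrableOn_ball (hf.integrableOn_ball_lap hN) hφ.continuous.measurable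
      hC1 hs

end

section

open scoped Topology ENNReal

variable {N : ℕ}

/-- The error produced by cutting off the regularized kernel at scale `R` is dominated by a
mean-value kernel at scale `R`. -/
lemma exists_cutoff_error (hN : 3 ≤ N) : ∃ (C : ℝ) (χ : Euc N → ℝ), 0 ≤ C ∧ ContDiff ℝ 2 χ ∧
    HasCompactSupport χ ∧ (∀ y, χ y ∈ Set.Icc (0 : ℝ) 1) ∧ (∀ y, ‖y‖ ≤ 1 → χ y = 1) ∧
    ∀ (x x₀ : Euc N) (R c : ℝ), 0 < R → 2 * ‖x‖ ≤ R → ‖x₀‖ ≤ R → 0 < c → ∀ y,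
      |lap (fun y => gam c (y - x) * χ (R⁻¹ • y)) y + χ (R⁻¹ • y) * psi c (y - x)| ≤
        C * psi (R ^ 2) (y - x₀) := by
  have h2 : (3 : ℝ) ≤ N := by exact_mod_cast hN
  obtain ⟨χ, hχ, hcs, hsupp, hone, hIcc⟩ := exists_cutoff (isCompact_closedBall (0 : Euc N) 1)
    (isOpen_ball (x := (0 : Euc N)) (ε := 2)) (closedBall_subset_ball one_lt_two)
  have hχ' := isC11c_of_contDiff hχ hcs
  obtain ⟨C1, hC1⟩ := hχ'.exists_bound_fderiv
  obtain ⟨C2, hC2⟩ := hχ'.exists_bound_lap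
  have hC1' : 0 ≤ C1 := (norm_nonneg _).trans (hC1 0)
  have hC2' : 0 ≤ C2 := (norm_nonneg _).trans (hC2 0)
  set A : ℝ := (1 / 4 : ℝ) ^ (1 - (N : ℝ) / 2) * C2 +
    6 * N * (N - 2) * (1 / 4 : ℝ) ^ (-((N : ℝ) / 2)) * C1 with hA
  set B : ℝ := (N : ℝ) * (N - 2) * (10 : ℝ) ^ (-1 - (N : ℝ) / 2) with hB
  have hN2 : (0 : ℝ) < N - 2 := by linarith
  have hA0 : 0 ≤ A := by positivity
  have hB0 : 0 < B := by positivity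
  refine ⟨A / B, χ, by positivity, hχ, hcs, hIcc, fun y hy => ?_, ?_⟩
  · have := (eventually_nhdsSet_iff_forall.1 hone y (by simpa using hy))
    exact this.self_of_nhds
  intro x x₀ R c hR hx hx₀ hc y
  have hsm : ContDiff ℝ 2 fun y : Euc N => χ (R⁻¹ • y) := hχ.comp (contDiff_const_smul _)
  have e1 : lap (fun y => gam c (y - x) * χ (R⁻¹ • y)) y + χ (R⁻¹ • y) * psi c (y - x) =
      gam c (y - x) * (R⁻¹ ^ 2 * lap χ (R⁻¹ • y)) +
        2 * gdot (fun y => gam c (y - x)) (fun y => χ (R⁻¹ • y)) y := by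
    rw [lap_mul (contDiff_gam_sub hc x).contDiffAt.d2At hsm.contDiffAt.d2At, lap_gam_sub hc,
      lap_comp_smul]
    ring
  rw [e1]
  have hfd : fderiv ℝ (fun y => χ (R⁻¹ • y)) y = R⁻¹ • fderiv ℝ χ (R⁻¹ • y) := by
    rw [fderiv_comp_smul]
  have hψ : 0 ≤ psi (R ^ 2) (y - x₀) := psi_nonneg hN (by positivity) _
  have hzero : fderiv ℝ χ (R⁻¹ • y) = 0 → lap χ (R⁻¹ • y) = 0 →
      |gam c (y - x) * (R⁻¹ ^ 2 * lap χ (R⁻¹ • y)) +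
        2 * gdot (fun y => gam c (y - x)) (fun y => χ (R⁻¹ • y)) y| ≤
        A / B * psi (R ^ 2) (y - x₀) := by
    intro z1 z2
    have hg : gdot (fun y => gam c (y - x)) (fun y => χ (R⁻¹ • y)) y = 0 := by
      have := abs_gdot_le (fun y => gam c (y - x)) (fun y => χ (R⁻¹ • y)) y
      rw [hfd, z1] at this
      simpa using this
    rw [z2, hg]
    simp only [mul_zero, add_zero, abs_zero]
    positivity
  by_cases h1 : ‖R⁻¹ • y‖ ≤ 1
  · have : χ =ᶠ[𝓝 (R⁻¹ • y)] fun _ => (1 : ℝ) :=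
      eventually_nhdsSet_iff_forall.1 hone _ (by simpa using h1)
    exact hzero (by rw [this.fderiv_eq]; simp) (by rw [lap_congr this, lap_const])
  by_cases h3 : 2 ≤ ‖R⁻¹ • y‖
  · have : R⁻¹ • y ∉ tsupport χ := fun h => by
      have := hsupp h
      rw [mem_ball_zero_iff] at this
      linarith
    exact hzero (fderiv_of_notMem_tsupport ℝ this) (lap_eq_zero_of_notMem_tsupport this)
  rw [norm_smul, norm_inv, Real.norm_of_nonneg hR.le, inv_mul_eq_div] at h1 h3
  rw [div_le_one₀ hR, not_le] at h1
  rw [le_div_iff₀ hR, not_le] at h3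
  have z1 : R / 2 ≤ ‖y - x‖ := by
    have := norm_sub_norm_le y x
    linarith
  have z2 : ‖y - x‖ ≤ 3 * R := (norm_sub_le _ _).trans (by linarith)
  have z3 : ‖y - x₀‖ ≤ 3 * R := (norm_sub_le _ _).trans (by linarith)
  have hP : (0 : ℝ) < R ^ 2 := by positivity
  have z4 : 1 / 4 * R ^ 2 ≤ c + ‖y - x‖ ^ 2 := by nlinarith
  have z5 : 0 < c + ‖y - x‖ ^ 2 := by positivity
  have b1 : gam c (y - x) ≤ (1 / 4 : ℝ) ^ (1 - (N : ℝ) / 2) * (R ^ 2) ^ (1 - (N : ℝ) / 2) := by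
    rw [← Real.mul_rpow (by norm_num) hP.le]
    exact Real.rpow_le_rpow_of_nonpos (by positivity) z4 (by linarith)
  have b2 : ‖fderiv ℝ (fun y => gam c (y - x)) y‖ ≤
      (N - 2) * ((1 / 4 : ℝ) ^ (-((N : ℝ) / 2)) * (R ^ 2) ^ (-((N : ℝ) / 2))) * (3 * R) := by
    rw [fderiv_comp_sub]
    refine (norm_fderiv_pw_le z5).trans ?_
    rw [abs_of_nonpos (by linarith), ← Real.mul_rpow (by norm_num) hP.le]
    refine mul_le_mul ?_ z2 (norm_nonneg _) (by positivity)
    rw [show 2 * -(1 - (N : ℝ) / 2) = N - 2 by ring, show 1 - (N : ℝ) / 2 - 1 = -((N : ℝ) / 2) by ring]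
    refine mul_le_mul_of_nonneg_left ?_ hN2.le
    exact Real.rpow_le_rpow_of_nonpos (by positivity) z4 (by linarith)
  have b3 : (R ^ 2) ^ (1 - (N : ℝ) / 2) = R ^ 2 * (R ^ 2) ^ (-((N : ℝ) / 2)) := by
    rw [← Real.rpow_one_add' hP.le (by linarith)]; ring_nf
  have b4 : B * (R ^ 2) ^ (-((N : ℝ) / 2)) ≤ psi (R ^ 2) (y - x₀) := by
    refine le_trans (le_of_eq ?_) (le_psi hN hP z3)
    rw [show R ^ 2 + (3 * R) ^ 2 = 10 * R ^ 2 by ring, Real.mul_rpow (by norm_num) hP.le, hB,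
      show -1 - (N : ℝ) / 2 = -((N : ℝ) / 2) - 1 by ring, Real.rpow_sub_one hP.ne' (-((N : ℝ) / 2))]
    field_simp
  set Q := (R ^ 2) ^ (-((N : ℝ) / 2)) with hQ
  have hQ0 : 0 < Q := by positivity
  have d1 : |gam c (y - x) * (R⁻¹ ^ 2 * lap χ (R⁻¹ • y))| ≤
      (1 / 4 : ℝ) ^ (1 - (N : ℝ) / 2) * C2 * Q := by
    rw [abs_mul, abs_mul, abs_of_nonneg (gam_nonneg hc.le _), abs_of_nonneg (by positivity : 0 ≤ R⁻¹ ^ 2)]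
    calc _ ≤ ((1 / 4 : ℝ) ^ (1 - (N : ℝ) / 2) * (R ^ 2 * Q)) * (R⁻¹ ^ 2 * C2) := by
          rw [← b3]
          exact mul_le_mul b1 (mul_le_mul_of_nonneg_left (hC2 _) (by positivity)) (by positivity)
            (by positivity)
      _ = _ := by field_simp
  have d2 : |2 * gdot (fun y => gam c (y - x)) (fun y => χ (R⁻¹ • y)) y| ≤
      6 * N * (N - 2) * (1 / 4 : ℝ) ^ (-((N : ℝ) / 2)) * C1 * Q := by
    rw [abs_mul, abs_two]
    have hg := abs_gdot_le (fun y => gam c (y - x)) (fun y => χ (R⁻¹ • y)) y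
    have hm : ‖fderiv ℝ (fun y => gam c (y - x)) y‖ * ‖fderiv ℝ (fun y => χ (R⁻¹ • y)) y‖ ≤
        (N - 2) * ((1 / 4 : ℝ) ^ (-((N : ℝ) / 2)) * Q) * (3 * R) * (R⁻¹ * C1) := by
      refine mul_le_mul b2 ?_ (norm_nonneg _) (by positivity)
      rw [hfd, norm_smul, norm_inv, Real.norm_of_nonneg hR.le]
      exact mul_le_mul_of_nonneg_left (hC1 _) (by positivity)
    have hm2 : (N - 2) * ((1 / 4 : ℝ) ^ (-((N : ℝ) / 2)) * Q) * (3 * R) * (R⁻¹ * C1) =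
        3 * (N - 2) * (1 / 4 : ℝ) ^ (-((N : ℝ) / 2)) * C1 * Q := by
      field_simp
    rw [hm2] at hm
    have hN0 : (0 : ℝ) ≤ N := by positivity
    have := mul_le_mul_of_nonneg_left hm hN0
    linarith
  calc _ ≤ A * Q := by
        refine (abs_add_le _ _).trans ((add_le_add d1 d2).trans_eq ?_)
        rw [hA]; ring
    _ = A / B * (B * Q) := by field_simp
    _ ≤ _ := mul_le_mul_of_nonneg_left b4 (by positivity)

/-- A positive superharmonic function on the punctured space is, up to a constant, at most the
potential of its Riesz measure. -/
lemma IsSuper.exists_le_potential (hN : 3 ≤ N) {f : Euc N → ℝ} (hf : IsSuper f)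
    (hi : IntegrableOn (fun y => f y * ‖y‖ ^ (-2 : ℝ)) (ball 0 2)) :
    ∃ H, 0 ≤ H ∧ ∀ x, x ≠ 0 → kap N * f x ≤ (∫ y, -lap f y * gam 0 (y - x)) + H := by
  obtain ⟨x₀, hx₀⟩ := exists_ne_zero hN
  obtain ⟨C, χ, hC, hχ, hcs, hIcc, hone, herr⟩ := exists_cutoff_error hN
  refine ⟨C * (kap N * f x₀), mul_nonneg hC (mul_nonneg (kap_pos hN).le (hf.nonneg _ hx₀)),
    fun x hx => ?_⟩
  set R : ℝ := 1 + 2 * ‖x‖ + ‖x₀‖ with hR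
  have hxn := norm_nonneg x
  have hx0n := norm_nonneg x₀
  have hR0 : 0 < R := by positivity
  have hRn : R⁻¹ ≠ 0 := (inv_pos.2 hR0).ne'
  have hsm : ContDiff ℝ 2 fun y : Euc N => χ (R⁻¹ • y) := hχ.comp (contDiff_const_smul _)
  have hcsR : HasCompactSupport fun y : Euc N => χ (R⁻¹ • y) := hcs.comp_smul hRn
  obtain ⟨η, hη, hηc, hηs, hη1, hηI⟩ := exists_cutoff (isCompact_singleton (x := x))
    ((isOpen_ne (x := (0 : Euc N))).inter (isOpen_ball (x := (0 : Euc N)) (ε := R)))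
    (Set.singleton_subset_iff.2 ⟨hx, by rw [mem_ball_zero_iff]; linarith⟩)
  have hηx : η x = 1 := (eventually_nhdsSet_iff_forall.1 hη1 x rfl).self_of_nhds
  have hηle : ∀ y, η y ≤ χ (R⁻¹ • y) := fun y => by
    by_cases hy : y ∈ tsupport η
    · have h1 := (hηs hy).2
      rw [mem_ball_zero_iff] at h1
      rw [hone]
      · exact (hηI y).2
      · rw [norm_smul, norm_inv, Real.norm_of_nonneg hR0.le, inv_mul_eq_div, div_le_one₀ hR0]
        exact h1.le
    · rw [image_eq_zero_of_notMem_tsupport hy]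
      exact (hIcc _).1
  have hq : ContDiff ℝ 2 fun y => f y * η y := contDiff_mul_cutoff isOpen_ne_zero
    hf.contDiffOn hη (hηs.trans Set.inter_subset_left)
  obtain ⟨M, hM⟩ := (isC11c_of_contDiff hq hηc.mul_left).exists_bound
  have hlim := tendsto_integral_mul_psi hN hq.continuous.measurable hM
    (hq.continuous.continuousAt (x := x))
  rw [hηx, mul_one] at hlim
  refine le_of_tendsto hlim ?_
  filter_upwards [self_mem_nhdsWithin] with c hc
  have hc : 0 < c := hc
  have hφ : ContDiff ℝ 2 fun y => gam c (y - x) * χ (R⁻¹ • y) := (contDiff_gam_sub hc x).mul hsm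
  have hφs : HasCompactSupport fun y => gam c (y - x) * χ (R⁻¹ • y) := hcsR.mul_left
  have hφ' := isC11c_of_contDiff hφ hφs
  obtain ⟨M1, hM1⟩ := hφ'.exists_bound
  obtain ⟨M2, hM2⟩ := hφ'.exists_bound_lap
  have hid := hf.integral_mul_lap hN hi hφ hφs
  have i1 : Integrable fun y => f y * lap (fun y => gam c (y - x) * χ (R⁻¹ • y)) y :=
    integrable_mul_of_integrableOn_ball (hf.integrableOn_ball hN) (measurable_lap _) hM2
      (hasCompactSupport_lap hφs)
  have i2 : Integrable fun y => f y * psi (R ^ 2) (y - x₀) :=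
    hf.integrable_mean hN hx₀ (by positivity)
  have i3 : Integrable fun y => lap f y * (gam c (y - x) * χ (R⁻¹ • y)) :=
    integrable_mul_of_integrableOn_ball (hf.integrableOn_ball_lap hN) hφ.continuous.measurable
      hM1 hφs
  have s1 : ∫ y, f y * η y * psi c (y - x) ≤ C * (∫ y, f y * psi (R ^ 2) (y - x₀)) -
      ∫ y, f y * lap (fun y => gam c (y - x) * χ (R⁻¹ • y)) y := by
    rw [← integral_const_mul, ← integral_sub (i2.const_mul C) i1]
    refine integral_mono_of_nonneg ?_ ((i2.const_mul C).sub i1) ?_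
    · filter_upwards [ae_ne_point hN 0] with y hy
      exact mul_nonneg (mul_nonneg (hf.nonneg y hy) (hηI y).1) (psi_nonneg hN hc.le _)
    · filter_upwards [ae_ne_point hN 0] with y hy
      have h1 := herr x x₀ R c hR0 (by linarith) (by linarith) hc y
      have h2 := (abs_le.1 h1).2
      have h3 := hf.nonneg y hy
      have h4 := mul_le_mul_of_nonneg_right (hηle y) (psi_nonneg hN hc.le (y - x))
      have h5 : η y * psi c (y - x) ≤ C * psi (R ^ 2) (y - x₀) -
        lap (fun y => gam c (y - x) * χ (R⁻¹ • y)) y := by linarith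
      have := mul_le_mul_of_nonneg_left h5 h3
      linarith
  have s2 : -∫ y, lap f y * (gam c (y - x) * χ (R⁻¹ • y)) ≤ ∫ y, -lap f y * gam 0 (y - x) := by
    rw [← integral_neg]
    refine integral_mono_ae i3.neg (hf.integrable_potential hN hx) ?_
    filter_upwards [ae_ne_point hN 0, ae_ne_point hN x] with y hy hyx
    have hp := pos_add_normSq le_rfl (sub_ne_zero.2 hyx)
    have h1 := gam_anti hN hp hc.le
    have h2 := gam_nonneg hc.le (y - x)
    have h3 : gam c (y - x) * χ (R⁻¹ • y) ≤ gam 0 (y - x) :=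
      (mul_le_of_le_one_right h2 (hIcc _).2).trans h1
    have := mul_le_mul_of_nonneg_left h3 (neg_nonneg.2 (hf.lap_nonpos y hy))
    linarith
  have s3 := mul_le_mul_of_nonneg_left (hf.integral_mean_le hN hx₀ (b := R ^ 2) (by positivity)) hC
  linarith

end

section

open scoped Topology ENNReal

variable {N : ℕ}

lemma contDiffOn_norm_rpow (s : ℝ) : ContDiffOn ℝ 2 (fun x : Euc N => ‖x‖ ^ s) {x | x ≠ 0} := by
  intro x hx
  have h : ContDiffAt ℝ 2 (pw 0 (s / 2) : Euc N → ℝ) x :=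
    contDiffAt_pw (pos_add_normSq le_rfl hx)
  refine (h.congr_of_eventuallyEq (.of_forall fun y => ?_)).contDiffWithinAt
  rw [pw_zero_left]; ring_nf

lemma d2At_norm_rpow (s : ℝ) {x : Euc N} (hx : x ≠ 0) : D2At (fun x : Euc N => ‖x‖ ^ s) x :=
  ((contDiffOn_norm_rpow s).contDiffAt (isOpen_ne_zero.mem_nhds hx)).d2At

lemma lap_norm_rpow (s : ℝ) {x : Euc N} (hx : x ≠ 0) :
    lap (fun x : Euc N => ‖x‖ ^ s) x = s * (s + N - 2) * ‖x‖ ^ (s - 2) := by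
  have h : (fun x : Euc N => ‖x‖ ^ s) = pw 0 (s / 2) := by
    ext y; rw [pw_zero_left]; ring_nf
  have hp := norm_pos_iff.2 hx
  rw [h, lap_pw (pos_add_normSq le_rfl hx), zero_add, ← Real.rpow_natCast ‖x‖ 2,
    ← Real.rpow_mul hp.le, ← Real.rpow_mul hp.le, mul_assoc, ← Real.rpow_add hp]
  have e1 : ((2 : ℕ) : ℝ) + ((2 : ℕ) : ℝ) * (s / 2 - 2) = s - 2 := by push_cast; ring
  have e2 : ((2 : ℕ) : ℝ) * (s / 2 - 1) = s - 2 := by push_cast; ring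
  rw [e1, e2]; ring

/-- A strict supersolution, bounded below by `1`, controlling constants. -/
lemma exists_supersolution (hN : 3 ≤ N) {μ : ℝ} (hμ : 0 < μ) (hμ0 : μ < mu0 N) {V : Euc N → ℝ}
    (hVpos : ∀ x, x ≠ 0 → 0 < V x) (hV : ∀ x, x ≠ 0 → V x ≤ ‖x‖ ^ (-2 : ℝ))
    {τ A R₀ : ℝ} (hτ : 2 < τ) (hA : ∀ x, x ≠ 0 → R₀ ≤ ‖x‖ → V x ≤ A * ‖x‖ ^ (-τ)) :
    ∃ (S : Euc N → ℝ) (C : ℝ), ContDiffOn ℝ 2 S {x | x ≠ 0} ∧ (∀ x, x ≠ 0 → 1 ≤ S x) ∧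
      (∀ x, x ≠ 0 → μ * V x * S x ≤ -lap S x) ∧
      ∀ x, x ≠ 0 → ‖x‖ ≤ 2 → S x ≤ C * ‖x‖ ^ (-(((N : ℝ) - 2) / 2)) := by
  have h2 : (3 : ℝ) ≤ N := by exact_mod_cast hN
  set m : ℝ := ((N : ℝ) - 2) / 2 with hm
  have hm0 : 0 < m := by rw [hm]; linarith
  have hmm : mu0 N = m ^ 2 := by rw [mu0, hm]; ring
  set ε : ℝ := min ((τ - 2) / 2) (m / 2) with hε
  have hε0 : 0 < ε := lt_min (by linarith) (by linarith)
  have hε1 : ε ≤ (τ - 2) / 2 := min_le_left _ _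
  have hε2 : ε ≤ m / 2 := min_le_right _ _
  set D : ℝ := ε * (2 * m - ε) with hD
  have hD0 : 0 < D := mul_pos hε0 (by linarith)
  obtain ⟨R₁, hR₁⟩ := (tendsto_atTop.1 (tendsto_rpow_atTop (y := τ - 2 - ε) (by linarith))
    (2 * μ * |A| / D)).exists_forall_of_atTop
  set R : ℝ := max (max R₀ R₁) 1 with hR
  have hR1 : 1 ≤ R := le_max_right _ _
  have hR0 : 0 < R := by linarith
  set K : ℝ := μ * (R ^ m + R ^ (m - ε)) / (mu0 N - μ) with hK
  have hK0 : 0 ≤ K := div_nonneg (by positivity) (by linarith)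
  have hlap : ∀ x : Euc N, x ≠ 0 → lap (fun x => 1 + (‖x‖ ^ (-ε) + K * ‖x‖ ^ (-m))) x =
      -(D * ‖x‖ ^ (-ε - 2)) - K * (m ^ 2 * ‖x‖ ^ (-m - 2)) := fun x hx => by
    have d1 := d2At_norm_rpow (-ε) hx
    have d2 := (d2At_norm_rpow (-m) hx).const_mul K
    rw [lap_add contDiffAt_const.d2At (d1.add d2), lap_const, lap_add d1 d2,
      lap_const_mul _ (d2At_norm_rpow (-m) hx), lap_norm_rpow _ hx, lap_norm_rpow _ hx, hD]
    have : (N : ℝ) = 2 * m + 2 := by rw [hm]; ring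
    rw [this]; ring
  refine ⟨fun x => 1 + (‖x‖ ^ (-ε) + K * ‖x‖ ^ (-m)), 2 ^ m + 2 ^ (m - ε) + K, ?_, ?_, ?_, ?_⟩
  · exact contDiffOn_const.add ((contDiffOn_norm_rpow _).add
      (contDiffOn_const.mul (contDiffOn_norm_rpow _)))
  · intro x hx
    have := norm_pos_iff.2 hx
    have : 0 ≤ ‖x‖ ^ (-ε) + K * ‖x‖ ^ (-m) := by positivity
    linarith
  · intro x hx
    have hp := norm_pos_iff.2 hx
    have hVx := hVpos x hx
    rw [hlap x hx]
    rw [hmm] at hμ0 hK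
    have e1 : ‖x‖ ^ (-m - 2) = ‖x‖ ^ (-2 : ℝ) * ‖x‖ ^ (-m) := by
      rw [← Real.rpow_add hp]; ring_nf
    have k1 : μ * V x * (K * ‖x‖ ^ (-m)) ≤ K * (μ * ‖x‖ ^ (-m - 2)) := by
      rw [e1]
      have : V x * ‖x‖ ^ (-m) ≤ ‖x‖ ^ (-2 : ℝ) * ‖x‖ ^ (-m) :=
        mul_le_mul_of_nonneg_right (hV x hx) (by positivity)
      have := mul_le_mul_of_nonneg_left this (mul_nonneg hμ.le hK0)
      linarith
    have k2 : μ * V x * (1 + ‖x‖ ^ (-ε)) ≤ D * ‖x‖ ^ (-ε - 2) +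
        K * ((m ^ 2 - μ) * ‖x‖ ^ (-m - 2)) := by
      rcases le_total R ‖x‖ with hxR | hxR
      · have hx1 : 1 ≤ ‖x‖ := hR1.trans hxR
        have q1 : V x ≤ |A| * ‖x‖ ^ (-τ) :=
          (hA x hx (((le_max_left _ _).trans (le_max_left _ _)).trans hxR)).trans
            (mul_le_mul_of_nonneg_right (le_abs_self _) (by positivity))
        have q2 : 2 * μ * |A| / D ≤ ‖x‖ ^ (τ - 2 - ε) :=
          hR₁ _ (((le_max_right _ _).trans (le_max_left _ _)).trans hxR)
        rw [div_le_iff₀ hD0] at q2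
        have q3 : ‖x‖ ^ (-ε) ≤ 1 := Real.rpow_le_one_of_one_le_of_nonpos hx1 (by linarith)
        have q4 : ‖x‖ ^ (-ε - 2) = ‖x‖ ^ (τ - 2 - ε) * ‖x‖ ^ (-τ) := by
          rw [← Real.rpow_add hp]; ring_nf
        have q5 : 0 ≤ K * ((m ^ 2 - μ) * ‖x‖ ^ (-m - 2)) :=
          mul_nonneg hK0 (mul_nonneg (by linarith) (by positivity))
        have q6 : μ * V x * (1 + ‖x‖ ^ (-ε)) ≤ μ * (|A| * ‖x‖ ^ (-τ)) * 2 :=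
          mul_le_mul (mul_le_mul_of_nonneg_left q1 hμ.le) (by linarith) (by positivity)
            (by positivity)
        have q7 := mul_le_mul_of_nonneg_right q2 (by positivity : 0 ≤ ‖x‖ ^ (-τ))
        rw [q4]
        linarith
      · have q1 : 1 ≤ R ^ m * ‖x‖ ^ (-m) := by
          rw [Real.rpow_neg hp.le, ← div_eq_mul_inv, ← Real.div_rpow hR0.le hp.le]
          exact Real.one_le_rpow ((one_le_div hp).2 hxR) hm0.le
        have q2 : ‖x‖ ^ (-ε) ≤ R ^ (m - ε) * ‖x‖ ^ (-m) := by
          rw [show -ε = (m - ε) + -m by ring, Real.rpow_add hp]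
          exact mul_le_mul_of_nonneg_right
            (Real.rpow_le_rpow hp.le hxR (by linarith)) (by positivity)
        have q3 : K * ((m ^ 2 - μ) * ‖x‖ ^ (-m - 2)) =
            μ * ‖x‖ ^ (-2 : ℝ) * ((R ^ m + R ^ (m - ε)) * ‖x‖ ^ (-m)) := by
          have : m ^ 2 - μ ≠ 0 := by linarith
          rw [hK, e1]
          field_simp
        have q4 : 0 ≤ D * ‖x‖ ^ (-ε - 2) := by positivity
        have q5 : μ * V x * (1 + ‖x‖ ^ (-ε)) ≤
            μ * ‖x‖ ^ (-2 : ℝ) * ((R ^ m + R ^ (m - ε)) * ‖x‖ ^ (-m)) :=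
          mul_le_mul (mul_le_mul_of_nonneg_left (hV x hx) hμ.le) (by linarith) (by positivity)
            (by positivity)
        linarith
    linarith
  · intro x hx hx2
    have hp := norm_pos_iff.2 hx
    have q1 : 1 ≤ 2 ^ m * ‖x‖ ^ (-m) := by
      rw [Real.rpow_neg hp.le, ← div_eq_mul_inv, ← Real.div_rpow two_pos.le hp.le]
      exact Real.one_le_rpow ((one_le_div hp).2 hx2) hm0.le
    have q2 : ‖x‖ ^ (-ε) ≤ 2 ^ (m - ε) * ‖x‖ ^ (-m) := by
      rw [show -ε = (m - ε) + -m by ring, Real.rpow_add hp]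
      exact mul_le_mul_of_nonneg_right
        (Real.rpow_le_rpow hp.le hx2 (by linarith)) (by positivity)
    linarith

end

section

open scoped Topology ENNReal

variable {N : ℕ}

/-- The Newtonian potential with density `q f`. -/
def tp (q : Euc N → ℝ) (f : Euc N → ℝ≥0∞) (x : Euc N) : ℝ≥0∞ :=
  ∫⁻ y, ENNReal.ofReal (q y * gam 0 (y - x)) * f y

variable {q : Euc N → ℝ} {f g : Euc N → ℝ≥0∞} {x : Euc N}

lemma tp_mono_ae (h : ∀ᵐ y, f y ≤ g y) : tp q f x ≤ tp q g x :=
  lintegral_mono_ae (h.mono fun y hy => by gcongr)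

lemma tp_congr_ae (h : ∀ᵐ y, f y = g y) : tp q f x = tp q g x :=
  lintegral_congr_ae (h.mono fun y hy => by simp only [hy])

lemma measurable_kernel (hq : Measurable q) (x : Euc N) :
    Measurable fun y => ENNReal.ofReal (q y * gam 0 (y - x)) :=
  (hq.mul ((measurable_gam 0).comp (by fun_prop))).ennreal_ofReal

lemma measurable_tp (hq : Measurable q) (hf : Measurable f) : Measurable (tp q f) := by
  have h : Measurable fun p : Euc N × Euc N =>
      ENNReal.ofReal (q p.2 * gam 0 (p.2 - p.1)) * f p.2 :=
    ((hq.comp measurable_snd).mul ((measurable_gam 0).comp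
      (measurable_snd.sub measurable_fst))).ennreal_ofReal.mul (hf.comp measurable_snd)
  exact h.lintegral_prod_right'

lemma tp_add (hq : Measurable q) (hf : Measurable f) :
    tp q (fun y => f y + g y) x = tp q f x + tp q g x := by
  simp only [tp, mul_add]
  exact lintegral_add_left ((measurable_kernel hq x).mul hf) _

lemma tp_const_mul (hq : Measurable q) (hf : Measurable f) (c : ℝ≥0∞) :
    tp q (fun y => c * f y) x = c * tp q f x := by
  simp only [tp, mul_left_comm _ c]
  exact lintegral_const_mul _ ((measurable_kernel hq x).mul hf)

lemma tp_ofReal_eq {h : Euc N → ℝ} (hq0 : ∀ᵐ y, 0 ≤ q y) (x : Euc N) :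
    tp q (fun y => ENNReal.ofReal (h y)) x = ∫⁻ y, ENNReal.ofReal (q y * h y * gam 0 (y - x)) := by
  refine lintegral_congr_ae (hq0.mono fun y hy => ?_)
  simp only
  rw [← ENNReal.ofReal_mul (mul_nonneg hy (gam_nonneg le_rfl _))]
  congr 1; ring

lemma IsSuper.tp_le (hN : 3 ≤ N) {h k : Euc N → ℝ} (hf : IsSuper h)
    (hq0 : ∀ᵐ y, 0 ≤ q y) (hle : ∀ y, y ≠ 0 → kap N * (q y * k y) ≤ -lap h y) (hx : x ≠ 0) :
    tp q (fun y => ENNReal.ofReal (k y)) x ≤ ENNReal.ofReal (h x) := by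
  have hk := kap_pos hN
  have hr := riesz_potential hN hf.contDiffOn hf.measurable hf.nonneg hf.lap_nonpos hx
  rw [tp_ofReal_eq hq0]
  calc ∫⁻ y, ENNReal.ofReal (q y * k y * gam 0 (y - x))
      ≤ ∫⁻ y, ENNReal.ofReal (kap N)⁻¹ * ENNReal.ofReal (-lap h y * gam 0 (y - x)) := by
        refine lintegral_mono_ae ((ae_ne_point hN 0).mono fun y hy => ?_)
        rw [← ENNReal.ofReal_mul (inv_nonneg.2 hk.le)]
        refine ENNReal.ofReal_le_ofReal ?_
        rw [← mul_assoc]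
        refine mul_le_mul_of_nonneg_right ?_ (gam_nonneg le_rfl _)
        rw [inv_mul_eq_div, le_div_iff₀ hk]
        linarith [hle y hy]
    _ = ENNReal.ofReal (kap N)⁻¹ * ∫⁻ y, ENNReal.ofReal (-lap h y * gam 0 (y - x)) :=
        lintegral_const_mul _ ((measurable_lap h).neg.mul
          ((measurable_gam 0).comp (by fun_prop))).ennreal_ofReal
    _ ≤ ENNReal.ofReal (kap N)⁻¹ * ENNReal.ofReal (kap N * h x) := by gcongr
    _ = ENNReal.ofReal (h x) := by
        rw [← ENNReal.ofReal_mul (inv_nonneg.2 hk.le), inv_mul_cancel_left₀ hk.ne']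

/-- Between zero and a supersolution of `u = tp q u` which is a solution up to a constant, there
is a solution, and it differs from `u` by at most a multiple of a supersolution. -/
lemma exists_fixedPoint_tp (hN : 3 ≤ N) {U S : Euc N → ℝ≥0∞} {c : ℝ≥0∞} (hq : Measurable q)
    (hU : Measurable U) (hS : Measurable S) (hUfin : ∀ x, x ≠ 0 → U x ≠ ∞)
    (hU1 : ∀ x, x ≠ 0 → tp q U x ≤ U x) (hU2 : ∀ x, x ≠ 0 → U x ≤ tp q U x + c)
    (hS1 : ∀ x, x ≠ 0 → tp q S x + 1 ≤ S x) :
    ∃ v : Euc N → ℝ≥0∞, Measurable v ∧ (∀ x, x ≠ 0 → tp q v x = v x) ∧ (∀ x, x ≠ 0 → v x ≤ U x) ∧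
      ∀ x, x ≠ 0 → U x ≤ v x + c * S x := by
  set F : ℕ → Euc N → ℝ≥0∞ := fun n => (tp q)^[n] U with hF
  have hF0 : F 0 = U := rfl
  have hFs : ∀ n, F (n + 1) = tp q (F n) := fun n => Function.iterate_succ_apply' _ _ _
  have hne := ae_ne_point hN (0 : Euc N)
  have hFm : ∀ n, Measurable (F n) := fun n => by
    induction n with
    | zero => exact hU
    | succ n ih => rw [hFs]; exact measurable_tp hq ih
  have hdec : ∀ n x, x ≠ 0 → F (n + 1) x ≤ F n x := fun n => by
    induction n with
    | zero => intro x hx; rw [hFs]; exact hU1 x hx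
    | succ n ih =>
      intro x hx
      rw [hFs (n + 1), hFs n]
      exact tp_mono_ae (hne.mono fun y hy => by rw [← hFs]; exact ih y hy)
  have hbd : ∀ n x, x ≠ 0 → U x ≤ F n x + c * S x := fun n => by
    induction n with
    | zero => intro x hx; exact le_self_add
    | succ n ih =>
      intro x hx
      calc U x ≤ tp q U x + c := hU2 x hx
        _ ≤ tp q (fun y => F n y + c * S y) x + c := by
            gcongr
            exact tp_mono_ae (hne.mono ih)
        _ = tp q (F n) x + c * (tp q S x + 1) := by
            rw [tp_add hq (hFm n), tp_const_mul hq hS, mul_add, mul_one, add_assoc]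
        _ ≤ _ := by
            rw [hFs]
            gcongr
            exact hS1 x hx
  refine ⟨fun x => ⨅ n, F n x, .iInf hFm, fun x hx => ?_, fun x _ => iInf_le _ 0, fun x hx => ?_⟩
  · have h1 : tp q (fun x => ⨅ n, F n x) x = ⨅ n, F (n + 1) x := by
      unfold tp
      simp_rw [ENNReal.mul_iInf (fun h => absurd h ENNReal.ofReal_ne_top)]
      rw [lintegral_iInf_ae]
      · exact iInf_congr fun n => by rw [hFs]; rfl
      · exact fun n => (measurable_kernel hq x).mul (hFm n)
      · intro n
        filter_upwards [hne] with y hy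
        exact mul_le_mul_right (hdec n y hy) _
      · exact ne_top_of_le_ne_top (hUfin x hx) (hU1 x hx)
    rw [h1]
    refine le_antisymm (le_iInf fun n => (iInf_le _ n).trans (hdec n x hx))
      (le_iInf fun n => iInf_le (fun n => F n x) (n + 1))
  · rw [ENNReal.iInf_add]
    exact le_iInf fun n => hbd n x hx

end

section

open scoped Topology ENNReal

variable {N : ℕ}

lemma contDiff_lap {f : Euc N → ℝ} {n m : WithTop ℕ∞} (hf : ContDiff ℝ n f) (h : m + 2 ≤ n) :
    ContDiff ℝ m (lap f) := by
  have h1 : m + 1 + 1 ≤ n := by rwa [add_assoc, one_add_one_eq_two]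
  refine ContDiff.sum fun i _ => ?_
  exact (((hf.fderiv_right h1).clm_apply contDiff_const).fderiv_right le_rfl).clm_apply
    contDiff_const

/-- A compactly supported density whose Newtonian potential is that of a point mass outside a
small ball. -/
lemma exists_density (hN : 3 ≤ N) {δ : ℝ} (hδ : 0 < δ) :
    ∃ β : Euc N → ℝ, ContDiff ℝ 2 β ∧ HasCompactSupport β ∧ tsupport β ⊆ ball 0 δ ∧
      ∀ w, δ ≤ ‖w‖ → ∫ y, gam 0 (y - w) * β y = kap N * gam 0 w := by
  obtain ⟨χ, hχ, hχs, hχt, hχ1, hχI⟩ := exists_contDiff_cutoff 4 (isCompact_singleton (x := (0 : Euc N)))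
    (isOpen_ball (x := (0 : Euc N)) (ε := δ)) (by simpa using hδ)
  rw [nhdsSet_singleton] at hχ1
  set K : Euc N → ℝ := fun y => (1 - χ y) * gam 0 y with hK
  have hKc : ContDiff ℝ 4 K := by
    rw [contDiff_iff_contDiffAt]
    intro y
    by_cases hy : y = 0
    · subst hy
      refine (contDiffAt_const (c := (0 : ℝ))).congr_of_eventuallyEq ?_
      filter_upwards [hχ1] with z hz
      simp [hK, hz]
    · refine (contDiffAt_const.sub hχ.contDiffAt).mul (contDiffAt_pw ?_)
      positivity
  have hΓ : ∀ y : Euc N, y ≠ 0 → lap (gam 0) y = 0 := by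
    intro y hy
    have : (0 : ℝ) < 0 + ‖y‖ ^ 2 := by positivity
    rw [lap_gam this]; simp [psi]
  have hKout : ∀ y, y ∉ tsupport χ → lap K y = 0 := by
    intro y hy
    have h0 : y ≠ 0 := by
      rintro rfl
      refine hy (subset_tsupport _ ?_)
      simp [hχ1.self_of_nhds]
    rw [← hΓ y h0]
    refine lap_congr ?_
    filter_upwards [(isClosed_tsupport χ).isOpen_compl.mem_nhds hy] with z hz
    simp [hK, image_eq_zero_of_notMem_tsupport hz]
  have hts : tsupport (fun y => -lap K y) ⊆ tsupport χ := by
    refine closure_minimal (fun y hy => ?_) (isClosed_tsupport χ)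
    by_contra h
    exact hy (by simp [hKout y h])
  refine ⟨fun y => -lap K y, (contDiff_lap hKc (by norm_num)).neg,
    hχs.mono' ((subset_tsupport _).trans hts), hts.trans hχt, fun w hw => ?_⟩
  have hw0 : w ≠ 0 := by
    rintro rfl; simp at hw; linarith
  have hUo : IsOpen (ball (0 : Euc N) δ \ {w}) := isOpen_ball.sdiff isClosed_singleton
  obtain ⟨η, hη, hηs, hηt, hη1, hηI⟩ := exists_cutoff hχs.isCompact hUo (by
    intro y hy
    refine ⟨hχt hy, ?_⟩
    rintro rfl
    have := hχt hy
    rw [mem_ball_zero_iff] at this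
    linarith)
  rw [eventually_nhdsSet_iff_forall] at hη1
  set φ : Euc N → ℝ := fun y => gam 0 (y - w) * η y with hφ
  have hφc : ContDiff ℝ 2 φ := by
    refine contDiff_mul_cutoff (U := {y | y ≠ w}) isOpen_ne ?_ hη ?_
    · intro y hy
      have h0 : (0 : ℝ) < 0 + ‖y - w‖ ^ 2 := by
        have : 0 < ‖y - w‖ := norm_pos_iff.2 (sub_ne_zero.2 hy)
        positivity
      exact ((contDiffAt_pw h0).comp y (contDiffAt_id.sub contDiffAt_const)).contDiffWithinAt
    · exact fun y hy => (hηt hy).2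
  have hφs : HasCompactSupport φ := hηs.mul_left
  have hφ0 : φ 0 = gam 0 w := by
    have h1 : η 0 = 1 := by
      refine (hη1 0 (subset_tsupport _ ?_)).self_of_nhds
      simp [hχ1.self_of_nhds]
    simp [hφ, h1, gam, pw]
  have hφl : ∀ y ∈ tsupport χ, lap φ y = 0 := by
    intro y hy
    have h2 : φ =ᶠ[𝓝 y] fun z => gam 0 (z - w) := by
      filter_upwards [hη1 y hy] with z hz
      simp [hφ, hz]
    rw [lap_congr h2, lap_comp_sub, hΓ _ (sub_ne_zero.2 ?_)]
    rintro rfl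
    exact (hηt (subset_tsupport _ (by simp [(hη1 _ hy).self_of_nhds]))).2 rfl
  have e1 := integral_mul_lap_of_contDiffOn isOpen_univ (hKc.of_le (by norm_num)).contDiffOn
    (isC11c_of_contDiff hφc hφs) (Set.subset_univ _)
  have e2 := integral_gam_mul_lap hN hφc hφs 0
  rw [hφ0] at e2
  have e3 : ∫ y, K y * lap φ y = ∫ y, gam 0 (y - 0) * lap φ y := by
    refine integral_congr_ae (.of_forall fun y => ?_)
    by_cases hy : y ∈ tsupport χ
    · simp [hφl y hy]
    · simp [hK, image_eq_zero_of_notMem_tsupport hy]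
  have e4 : ∫ y, lap K y * φ y = ∫ y, lap K y * gam 0 (y - w) := by
    refine integral_congr_ae (.of_forall fun y => ?_)
    by_cases hy : y ∈ tsupport χ
    · simp [hφ, (hη1 y hy).self_of_nhds]
    · simp [hKout y hy]
  calc ∫ y, gam 0 (y - w) * -lap K y = -∫ y, lap K y * gam 0 (y - w) := by
        rw [← integral_neg]; exact integral_congr_ae (.of_forall fun y => by simp; ring)
    _ = kap N * gam 0 w := by rw [← e4, ← e1, e3, e2, neg_neg]

end

section

open scoped Topology ENNReal

variable {N : ℕ} {G : Type*} [NormedAddCommGroup G] [NormedSpace ℝ G]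

/-- Convolution of a scalar density with a vector-valued kernel. -/
def cv (F : Euc N → ℝ) (E : Euc N → G) (x : Euc N) : G := ∫ y, F y • E (x - y)

variable {F : Euc N → ℝ} {E : Euc N → G}

lemma contDiff_cv {n : ℕ} (hF : LocallyIntegrable F) (hE : ContDiff ℝ n E)
    (hs : HasCompactSupport E) : ContDiff ℝ n (cv F E) := by
  have := HasCompactSupport.contDiff_convolution_right (ContinuousLinearMap.lsmul ℝ ℝ) hs hF
    (n := (n : ℕ∞)) (mod_cast hE)
  exact_mod_cast this

lemma hasFDerivAt_cv (hF : LocallyIntegrable F) (hE : ContDiff ℝ 1 E)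
    (hs : HasCompactSupport E) (x : Euc N) :
    HasFDerivAt (cv F E) (cv F (fderiv ℝ E) x) x :=
  HasCompactSupport.hasFDerivAt_convolution_right (ContinuousLinearMap.lsmul ℝ ℝ) hs hF hE x

lemma fderiv_cv (hF : LocallyIntegrable F) (hE : ContDiff ℝ 1 E) (hs : HasCompactSupport E) :
    fderiv ℝ (cv F E) = cv F (fderiv ℝ E) :=
  funext fun x => (hasFDerivAt_cv hF hE hs x).fderiv

lemma integral_fderiv_eq_zero_of_hasCompactSupport (hE : ContDiff ℝ 1 E)
    (hs : HasCompactSupport E) : ∫ z, fderiv ℝ E z = 0 := by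
  have h1 : cv (fun _ => 1) E = fun _ : Euc N => ∫ z, E z := by
    funext x
    simp only [cv, one_smul]
    exact integral_sub_left_eq_self E volume x
  have h2 := hasFDerivAt_cv (locallyIntegrable_const (1 : ℝ)) hE hs 0
  rw [h1] at h2
  have h3 := h2.unique (hasFDerivAt_const _ _)
  rw [← h3]
  simp only [cv, one_smul]
  exact (integral_sub_left_eq_self (fderiv ℝ E) volume 0).symm

lemma norm_cv_le {M : ℝ} (hM : ∀ y, ‖F y‖ ≤ M) (hE : Continuous E) (hs : HasCompactSupport E)
    (x : Euc N) : ‖cv F E x‖ ≤ M * ∫ z, ‖E z‖ := by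
  rw [← integral_sub_left_eq_self (fun z => ‖E z‖) volume x, ← integral_const_mul]
  refine norm_integral_le_of_norm_le (((hE.integrable_of_hasCompactSupport hs).norm.comp_sub_left
    x).const_mul M) (.of_forall fun y => ?_)
  rw [norm_smul]
  gcongr
  exact hM y

lemma norm_cv_le_of_holder {C γ : ℝ} (hγ : 0 < γ) (hF : LocallyIntegrable F) (x : Euc N)
    (hC : ∀ y, ‖F y - F x‖ ≤ C * ‖x - y‖ ^ γ) (hE : Continuous E)
    (hs : HasCompactSupport E) (h0 : ∫ z, E z = 0) :
    ‖cv F E x‖ ≤ C * ∫ z, ‖z‖ ^ γ * ‖E z‖ := by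
  have hc : Continuous fun z : Euc N => ‖z‖ ^ γ * ‖E z‖ :=
    (continuous_norm.rpow_const fun _ => Or.inr hγ.le).mul hE.norm
  have hi : Integrable fun y => F y • E (x - y) := by
    have h1 : HasCompactSupport fun y => E (x - y) :=
      hs.comp_homeomorph (Homeomorph.subLeft x)
    exact hF.integrable_smul_right_of_hasCompactSupport (by fun_prop) h1
  have hi2 : Integrable fun y => F x • E (x - y) :=
    ((hE.integrable_of_hasCompactSupport hs).comp_sub_left x).smul (F x)
  have h1 : cv F E x = ∫ y, (F y - F x) • E (x - y) := by
    simp only [sub_smul]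
    rw [integral_sub hi hi2, integral_smul, integral_sub_left_eq_self E volume x, h0, smul_zero,
      sub_zero]
    rfl
  rw [h1, ← integral_sub_left_eq_self (fun z => ‖z‖ ^ γ * ‖E z‖) volume x, ← integral_const_mul]
  refine norm_integral_le_of_norm_le (((hc.integrable_of_hasCompactSupport
    (hs.norm.mul_left)).comp_sub_left x).const_mul C) (.of_forall fun y => ?_)
  rw [norm_smul, ← mul_assoc]
  gcongr
  exact hC y

/-- The kernel `E` compressed by the factor `r`, with amplitude `r ^ a`. -/
def scl (a : ℕ) (r : ℝ) (E : Euc N → G) (z : Euc N) : G := r ^ a • E (r • z)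

lemma contDiff_scl {n : WithTop ℕ∞} (hE : ContDiff ℝ n E) (a : ℕ) (r : ℝ) :
    ContDiff ℝ n (scl a r E) :=
  (hE.comp (contDiff_const_smul r)).const_smul _

lemma continuous_scl (hE : Continuous E) (a : ℕ) (r : ℝ) : Continuous (scl a r E) :=
  (hE.comp (continuous_const_smul r)).const_smul _

lemma hasCompactSupport_scl (hs : HasCompactSupport E) (a : ℕ) {r : ℝ} (hr : r ≠ 0) :
    HasCompactSupport (scl a r E) :=
  HasCompactSupport.smul_left (f := fun _ => r ^ a) (hs.comp_smul hr)

lemma fderiv_scl (hE : ContDiff ℝ 1 E) (a : ℕ) (r : ℝ) :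
    fderiv ℝ (scl a r E) = scl (a + 1) r (fderiv ℝ E) := by
  funext z
  have h1 : HasFDerivAt (fun z => E (r • z)) ((fderiv ℝ E (r • z)).comp
      (r • ContinuousLinearMap.id ℝ (Euc N))) z :=
    ((hE.differentiable one_ne_zero) (r • z)).hasFDerivAt.comp z
      ((hasFDerivAt_id z).const_smul r)
  have h2 := h1.const_smul (r ^ a)
  refine h2.fderiv.trans ?_
  ext w
  simp [scl, pow_succ, mul_smul]

lemma integral_norm_scl {a : ℕ} {r : ℝ} (hr : 0 < r) (E : Euc N → G) :
    ∫ z, ‖scl a r E z‖ = r ^ a / r ^ N * ∫ z, ‖E z‖ := by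
  simp only [scl, norm_smul]
  rw [integral_const_mul, Measure.integral_comp_smul volume (fun z => ‖E z‖) r]
  simp [abs_of_pos (inv_pos.2 (pow_pos hr N)), div_eq_mul_inv, mul_assoc, abs_of_pos hr]

lemma integral_norm_rpow_scl {a : ℕ} {r γ : ℝ} (hr : 0 < r) (E : Euc N → G) :
    ∫ z, ‖z‖ ^ γ * ‖scl a r E z‖ = r ^ a / r ^ N * r ^ (-γ) * ∫ z, ‖z‖ ^ γ * ‖E z‖ := by
  have h1 : ∀ z : Euc N, ‖z‖ ^ γ * ‖scl a r E z‖ =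
      r ^ a * r ^ (-γ) * (‖r • z‖ ^ γ * ‖E (r • z)‖) := by
    intro z
    have : r ^ (-γ) * r ^ γ = 1 := by rw [← Real.rpow_add hr]; simp
    rw [scl, norm_smul, norm_smul, Real.mul_rpow (norm_nonneg _) (norm_nonneg _), norm_pow,
      Real.norm_of_nonneg hr.le]
    linear_combination (-(r ^ a * ‖z‖ ^ γ * ‖E (r • z)‖)) * this
  simp only [h1]
  rw [integral_const_mul, Measure.integral_comp_smul volume (fun z => ‖z‖ ^ γ * ‖E z‖) r]
  simp [abs_of_pos (inv_pos.2 (pow_pos hr N)), div_eq_mul_inv]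
  ring

lemma contDiff_one_tsum {g : ℕ → Euc N → ℝ} (hg : ∀ j, ContDiff ℝ 1 (g j)) {C : ℕ → ℝ}
    (hC : Summable C) (h0 : ∀ j x, ‖g j x‖ ≤ C j) (h1 : ∀ j x, ‖fderiv ℝ (g j) x‖ ≤ C j) :
    ContDiff ℝ 1 fun x => ∑' j, g j x := by
  have := contDiff_tsum (𝕜 := ℝ) (N := (1 : ℕ∞)) (f := g) (v := fun _ => C) (by simpa using hg)
    (fun _ _ => hC) (fun k j x hk => by
      have hk : k ≤ 1 := by exact_mod_cast hk
      interval_cases k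
      · simpa using h0 j x
      · simpa using h1 j x)
  exact_mod_cast this

lemma contDiff_two_tsum {g : ℕ → Euc N → ℝ} (hg : ∀ j, ContDiff ℝ 2 (g j)) {C : ℕ → ℝ}
    (hC : Summable C) (h0 : ∀ j x, ‖g j x‖ ≤ C j) (h1 : ∀ j x, ‖fderiv ℝ (g j) x‖ ≤ C j)
    (h2 : ∀ j x, ‖fderiv ℝ (fderiv ℝ (g j)) x‖ ≤ C j) :
    ContDiff ℝ 2 fun x => ∑' j, g j x := by
  have := contDiff_tsum (𝕜 := ℝ) (N := (2 : ℕ∞)) (f := g) (v := fun _ => C) (by simpa using hg)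
    (fun _ _ => hC) (fun k j x hk => by
      have hk : k ≤ 2 := by exact_mod_cast hk
      interval_cases k
      · simpa using h0 j x
      · simpa using h1 j x
      · rw [← norm_iteratedFDeriv_fderiv]; simpa using h2 j x)
  exact_mod_cast this

section Dyadic

variable {E : Euc N → ℝ} {M : ℝ}

lemma two_pow_pos (j : ℕ) : (0 : ℝ) < 2 ^ j := by positivity

lemma hasCompactSupport_fderiv_two (hs : HasCompactSupport E) :
    HasCompactSupport (fderiv ℝ (fderiv ℝ E)) := (hs.fderiv ℝ).fderiv ℝ

lemma norm_cv_scl_le {a : ℕ} {E : Euc N → G} (hM : ∀ y, ‖F y‖ ≤ M) (hE : Continuous E)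
    (hs : HasCompactSupport E) {b : ℕ} (hab : a + b = N) (j : ℕ) (x : Euc N) :
    ‖cv F (scl a (2 ^ j) E) x‖ ≤ M * (∫ z, ‖E z‖) * ((1 / 2) ^ b) ^ j := by
  have hr := two_pow_pos j
  refine (norm_cv_le hM (continuous_scl hE _ _)
    (hasCompactSupport_scl hs a hr.ne') x).trans (le_of_eq ?_)
  rw [integral_norm_scl hr]
  have : ((2 : ℝ) ^ j) ^ a / ((2 : ℝ) ^ j) ^ N = ((1 / 2) ^ b) ^ j := by
    rw [← hab, pow_add, ← pow_mul (1 / 2 : ℝ), mul_comm b j, pow_mul, one_div, inv_pow]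
    field_simp
    rw [one_div, inv_pow, mul_inv_cancel₀ (by positivity)]
  rw [this]; ring

lemma norm_cv_scl_le_of_holder {E : Euc N → G} {C γ : ℝ} (hγ : 0 < γ) (hF : LocallyIntegrable F)
    (hC : ∀ x y, ‖F y - F x‖ ≤ C * ‖x - y‖ ^ γ) (hE : Continuous E)
    (hs : HasCompactSupport E) (h0 : ∫ z, E z = 0) (j : ℕ) (x : Euc N) :
    ‖cv F (scl N (2 ^ j) E) x‖ ≤ C * (∫ z, ‖z‖ ^ γ * ‖E z‖) * (2 ^ (-γ)) ^ j := by
  have hr := two_pow_pos j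
  have h1 : ∫ z, scl N (2 ^ j) E z = 0 := by
    simp only [scl]
    rw [integral_smul, Measure.integral_comp_smul volume E, h0]; simp
  refine (norm_cv_le_of_holder hγ hF x (hC x) (continuous_scl hE _ _)
     (hasCompactSupport_scl hs N hr.ne') h1).trans (le_of_eq ?_)
  rw [integral_norm_rpow_scl hr,
    div_self (pow_pos hr N).ne', ← Real.rpow_natCast, ← Real.rpow_mul two_pos.le,
    ← Real.rpow_natCast, ← Real.rpow_mul two_pos.le, mul_comm (j : ℝ)]
  ring

lemma contDiff_one_tsum_cv (hN : 3 ≤ N) (hF : LocallyIntegrable F) (hM : ∀ y, ‖F y‖ ≤ M)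
    (hE : ContDiff ℝ 2 E) (hs : HasCompactSupport E) :
    ContDiff ℝ 1 fun x => ∑' j : ℕ, cv F (scl (N - 2) (2 ^ j) E) x := by
  have hM0 : 0 ≤ M := (norm_nonneg _).trans (hM 0)
  set A := M * (∫ z, ‖E z‖) with hA
  set B := M * (∫ z, ‖fderiv ℝ E z‖) with hB
  have hA0 : 0 ≤ A := by positivity
  have hB0 : 0 ≤ B := by positivity
  refine contDiff_one_tsum (C := fun j => (A + B) * (1 / 2) ^ j) (fun j => ?_)
    (summable_geometric_two.mul_left _) (fun j x => ?_) (fun j x => ?_)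
  · exact_mod_cast contDiff_cv (n := 1) hF (contDiff_scl (hE.of_le (by norm_num)) _ _)
      (hasCompactSupport_scl hs _ (two_pow_pos j).ne')
  · refine (norm_cv_scl_le hM hE.continuous hs (b := 2) (by omega) j x).trans ?_
    gcongr
    · linarith
    · norm_num
  · rw [fderiv_cv hF ((contDiff_scl (hE.of_le (by norm_num)) _ _))
      (hasCompactSupport_scl hs _ (two_pow_pos j).ne'), fderiv_scl (hE.of_le (by norm_num))]
    refine (norm_cv_scl_le hM (hE.continuous_fderiv (by norm_num)) (hs.fderiv ℝ) (b := 1)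
      (by omega) j x).trans ?_
    gcongr
    · linarith
    · norm_num

lemma contDiff_two_tsum_cv (hN : 3 ≤ N) (hF : LocallyIntegrable F) (hM : ∀ y, ‖F y‖ ≤ M)
    {C γ : ℝ} (hγ : 0 < γ) (hγ1 : γ ≤ 1) (hC : ∀ x y, ‖F y - F x‖ ≤ C * ‖x - y‖ ^ γ)
    (hE : ContDiff ℝ 2 E) (hs : HasCompactSupport E) :
    ContDiff ℝ 2 fun x => ∑' j : ℕ, cv F (scl (N - 2) (2 ^ j) E) x := by
  have hM0 : 0 ≤ M := (norm_nonneg _).trans (hM 0)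
  set A := M * (∫ z, ‖E z‖) with hA
  set B := M * (∫ z, ‖fderiv ℝ E z‖) with hB
  set D := |C| * (∫ z, ‖z‖ ^ γ * ‖fderiv ℝ (fderiv ℝ E) z‖) with hD
  have hA0 : 0 ≤ A := by positivity
  have hB0 : 0 ≤ B := by positivity
  have hD0 : 0 ≤ D := mul_nonneg (abs_nonneg _) (integral_nonneg fun z => by positivity)
  have hq1 : (2 : ℝ) ^ (-γ) < 1 := Real.rpow_lt_one_of_one_lt_of_neg one_lt_two (by linarith)
  have hq0 : (0 : ℝ) < 2 ^ (-γ) := by positivity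
  have hq2 : (1 / 2 : ℝ) ≤ 2 ^ (-γ) := by
    have : (2 : ℝ) ^ (-1 : ℝ) ≤ 2 ^ (-γ) :=
      Real.rpow_le_rpow_of_exponent_le one_le_two (by linarith)
    rwa [Real.rpow_neg_one, ← one_div] at this
  have hE1 : ContDiff ℝ 1 (fderiv ℝ E) := hE.fderiv_right (by norm_num)
  have hd1 : ∀ j, fderiv ℝ (cv F (scl (N - 2) (2 ^ j) E)) =
      cv F (scl (N - 2 + 1) (2 ^ j) (fderiv ℝ E)) := fun j => by
    rw [fderiv_cv hF ((contDiff_scl (hE.of_le (by norm_num)) _ _))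
      (hasCompactSupport_scl hs _ (two_pow_pos j).ne'), fderiv_scl (hE.of_le (by norm_num))]
  refine contDiff_two_tsum (C := fun j => (A + B + D) * (2 ^ (-γ)) ^ j) (fun j => ?_)
    ((summable_geometric_of_lt_one hq0.le hq1).mul_left _) (fun j x => ?_) (fun j x => ?_)
    (fun j x => ?_)
  · exact_mod_cast contDiff_cv (n := 2) hF (contDiff_scl (by exact_mod_cast hE) _ _)
      (hasCompactSupport_scl hs _ (two_pow_pos j).ne')
  · refine (norm_cv_scl_le hM hE.continuous hs (b := 2) (by omega) j x).trans ?_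
    gcongr
    · linarith
    · exact le_trans (by norm_num) hq2
  · rw [hd1]
    refine (norm_cv_scl_le hM (hE.continuous_fderiv (by norm_num)) (hs.fderiv ℝ) (b := 1)
      (by omega) j x).trans ?_
    gcongr
    · linarith
    · exact le_trans (by norm_num) hq2
  · rw [hd1, fderiv_cv hF (contDiff_scl hE1 _ _)
      (hasCompactSupport_scl (hs.fderiv ℝ) _ (two_pow_pos j).ne'), fderiv_scl hE1,
      show N - 2 + 1 + 1 = N by omega]
    refine (norm_cv_scl_le_of_holder hγ hF (C := |C|) (fun x y => (hC x y).trans ?_)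
      (hE1.continuous_fderiv (by norm_num)) (hasCompactSupport_fderiv_two hs)
      (integral_fderiv_eq_zero_of_hasCompactSupport hE1 (hs.fderiv ℝ)) j x).trans ?_
    · gcongr; exact le_abs_self C
    · gcongr; linarith

end Dyadic

end

section

open scoped Topology ENNReal

variable {N : ℕ}

lemma gam_zero_two_smul (hN : 3 ≤ N) (z : Euc N) {r : ℝ} (hr : 0 < r) :
    r ^ (N - 2) * gam 0 (r • z) = gam 0 z := by
  rw [gam_zero_eq, gam_zero_eq, norm_smul, Real.norm_of_nonneg hr.le,
    Real.mul_rpow hr.le (norm_nonneg _), ← mul_assoc, ← Real.rpow_natCast, ← Real.rpow_add hr,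
    Nat.cast_sub (by omega)]
  simp

/-- Splitting of the fundamental solution into a smooth part `K` and a dyadic series. -/
lemma exists_dyadic (hN : 3 ≤ N) {δ : ℝ} (hδ : 0 < δ) {K : Euc N → ℝ} (hK : ContDiff ℝ 2 K)
    (hKΓ : ∀ w, δ ≤ ‖w‖ → K w = gam 0 w) :
    ∃ E : Euc N → ℝ, ContDiff ℝ 2 E ∧ HasCompactSupport E ∧
      ∀ z, z ≠ 0 → HasSum (fun j : ℕ => scl (N - 2) (2 ^ j) E z) (gam 0 z - K z) := by
  set E : Euc N → ℝ := fun z => 2 ^ (N - 2) * K ((2 : ℝ) • z) - K z with hE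
  have hE0 : ∀ z, δ ≤ ‖z‖ → E z = 0 := by
    intro z hz
    have h2 : δ ≤ ‖(2 : ℝ) • z‖ := by
      rw [norm_smul, Real.norm_of_nonneg two_pos.le]; linarith [norm_nonneg z]
    simp only [hE]
    rw [hKΓ z hz, hKΓ _ h2, gam_zero_two_smul hN z two_pos, sub_self]
  refine ⟨E, (contDiff_const.mul (hK.comp (contDiff_const_smul _))).sub hK,
    HasCompactSupport.of_support_subset_isCompact (isCompact_closedBall 0 δ) fun z hz => ?_,
    fun z hz => ?_⟩
  · by_contra h
    rw [mem_closedBall_zero_iff, not_le] at h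
    exact hz (hE0 z h.le)
  · set a : ℕ → ℝ := fun j => ((2 : ℝ) ^ j) ^ (N - 2) * K ((2 : ℝ) ^ j • z) with ha
    have hstep : ∀ j, scl (N - 2) (2 ^ j) E z = a (j + 1) - a j := by
      intro j
      simp only [scl, hE, ha, smul_eq_mul, smul_smul, pow_succ, mul_pow]
      rw [mul_comm (2 : ℝ) (2 ^ j)]; ring
    obtain ⟨J, hJ⟩ := pow_unbounded_of_one_lt (δ / ‖z‖) (one_lt_two (α := ℝ))
    have hz' : 0 < ‖z‖ := norm_pos_iff.2 hz
    have hbig : ∀ j, J ≤ j → δ ≤ ‖(2 : ℝ) ^ j • z‖ := by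
      intro j hj
      rw [norm_smul, Real.norm_of_nonneg (by positivity)]
      rw [div_lt_iff₀ hz'] at hJ
      refine hJ.le.trans ?_
      gcongr
      exact one_le_two
    have hsum : ∑ j ∈ Finset.range J, scl (N - 2) (2 ^ j) E z = gam 0 z - K z := by
      simp only [hstep]
      rw [Finset.sum_range_sub, ha]
      simp only [pow_zero, one_pow, one_mul, one_smul]
      rw [hKΓ _ (hbig J le_rfl), gam_zero_two_smul hN z (by positivity)]
    rw [← hsum]
    refine hasSum_sum_of_ne_finset_zero fun j hj => ?_
    rw [Finset.mem_range, not_lt] at hj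
    simp [scl, hE0 _ (hbig j hj)]

/-- `v` is, up to the normalizing constant, the Newtonian potential of the nonnegative locally
bounded density `f` on the punctured space. -/
structure IsPot (v f : Euc N → ℝ) : Prop where
  measurable : Measurable f
  nonneg : ∀ y, y ≠ 0 → 0 ≤ f y
  integrable : ∀ x, x ≠ 0 → Integrable fun y => gam 0 (y - x) * f y
  eq : ∀ x, x ≠ 0 → kap N * v x = ∫ y, gam 0 (y - x) * f y
  locInt : LocallyIntegrable v
  bdd : ∀ x, x ≠ 0 → ∃ M, ∀ y ∈ ball x (‖x‖ / 2), ‖f y‖ ≤ M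

namespace IsPot

variable {v f : Euc N → ℝ}

lemma integrable_prod (hN : 3 ≤ N) (h : IsPot v f) {β : Euc N → ℝ} (hβ : Continuous β)
    (hs : HasCompactSupport β) (x : Euc N) :
    Integrable (fun p : Euc N × Euc N => β p.1 * (gam 0 (p.2 - (x - p.1)) * f p.2))
      (volume.prod volume) := by
  have hm : Measurable fun p : Euc N × Euc N => β p.1 * (gam 0 (p.2 - (x - p.1)) * f p.2) :=
    (hβ.measurable.comp measurable_fst).mul (((measurable_gam 0).comp (by fun_prop)).mul
      (h.measurable.comp measurable_snd))
  have hae : ∀ᵐ z : Euc N, x - z ≠ 0 := by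
    filter_upwards [ae_ne_point hN x] with z hz
    exact sub_ne_zero.2 hz.symm
  have hv : Integrable fun z => kap N * (‖β z‖ * v (x - z)) := by
    have h1 : Integrable fun y => v y * ‖β (x - y)‖ :=
      h.locInt.integrable_smul_right_of_hasCompactSupport (by fun_prop)
        (hs.comp_homeomorph (Homeomorph.subLeft x)).norm
    have := (h1.comp_sub_left x).const_mul (kap N)
    refine this.congr (.of_forall fun z => ?_)
    simp only [sub_sub_cancel]; ring
  rw [integrable_prod_iff hm.aestronglyMeasurable]
  refine ⟨?_, hv.congr ?_⟩
  · filter_upwards [hae] with z hz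
    exact (h.integrable _ hz).const_mul _
  · filter_upwards [hae] with z hz
    simp only [norm_mul]
    rw [integral_const_mul, mul_left_comm, h.eq _ hz]
    congr 1
    refine integral_congr_ae ?_
    filter_upwards [ae_ne_point hN 0] with y hy
    rw [Real.norm_of_nonneg (gam_nonneg le_rfl _), Real.norm_of_nonneg (h.nonneg y hy)]

lemma integral_potential_mul (hN : 3 ≤ N) (h : IsPot v f) {β : Euc N → ℝ} (hβ : Continuous β)
    (hs : HasCompactSupport β) (x : Euc N) :
    Integrable (fun y => (∫ z, gam 0 (z - (x - y)) * β z) * f y) ∧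
    ∫ y, (∫ z, gam 0 (z - (x - y)) * β z) * f y = kap N * ∫ z, β z * v (x - z) := by
  have hp := h.integrable_prod hN hβ hs x
  have e1 : ∀ y, (∫ z, gam 0 (z - (x - y)) * β z) * f y =
      ∫ z, β z * (gam 0 (y - (x - z)) * f y) := by
    intro y
    rw [← integral_mul_const]
    refine integral_congr_ae (.of_forall fun z => ?_)
    simp only
    rw [show y - (x - z) = z - (x - y) by abel]
    ring
  simp only [e1]
  refine ⟨hp.integral_prod_right, ?_⟩
  rw [← integral_integral_swap hp, ← integral_const_mul]
  refine integral_congr_ae ?_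
  filter_upwards [ae_ne_point hN x] with z hz
  rw [integral_const_mul, ← h.eq _ (sub_ne_zero.2 hz.symm)]
  ring

/-- Local representation of a potential as a smooth function plus a dyadic series involving only
the density nearby. -/
lemma exists_local (hN : 3 ≤ N) (h : IsPot v f) {δ : ℝ} (hδ : 0 < δ) :
    ∃ β E : Euc N → ℝ, ContDiff ℝ 2 β ∧ HasCompactSupport β ∧ ContDiff ℝ 2 E ∧
      HasCompactSupport E ∧ ∀ x, x ≠ 0 → ∀ F : Euc N → ℝ, Measurable F → (∃ M, ∀ y, ‖F y‖ ≤ M) →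
      (∀ y ∈ ball x δ, F y = f y) →
      kap N * v x = cv v β x + ∑' j : ℕ, cv F (scl (N - 2) (2 ^ j) E) x := by
  have hk := kap_pos hN
  obtain ⟨β, hβ, hβs, hβt, hβ1⟩ := exists_density hN hδ
  have hΓli : LocallyIntegrable (gam 0 : Euc N → ℝ) := by
    rw [locallyIntegrable_iff]
    intro k hk
    obtain ⟨R, hR⟩ := hk.isBounded.subset_ball 0
    refine IntegrableOn.mono_set ?_ hR
    simpa using integrableOn_gam_zero hN 0 R
  set K : Euc N → ℝ := fun w => (kap N)⁻¹ * cv (gam 0) β w with hKdef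
  have hKc : ContDiff ℝ 2 K :=
    contDiff_const.mul (by exact_mod_cast contDiff_cv (n := 2) hΓli hβ hβs)
  have hcv : ∀ w, cv (gam 0) β w = ∫ z, gam 0 (z - w) * β z := by
    intro w
    rw [cv, ← integral_sub_left_eq_self _ volume w]
    refine integral_congr_ae (.of_forall fun z => ?_)
    simp [gam_comm_sub 0 w z]
  have hKΓ : ∀ w, δ ≤ ‖w‖ → K w = gam 0 w := by
    intro w hw
    simp only [hKdef]
    rw [hcv, hβ1 w hw, inv_mul_cancel_left₀ hk.ne']
  obtain ⟨E, hE, hEs, hEsum⟩ := exists_dyadic hN hδ hKc hKΓ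
  refine ⟨β, E, hβ, hβs, hE, hEs, fun x hx F hF ⟨M, hM⟩ hFf => ?_⟩
  obtain ⟨hi1, he1⟩ := h.integral_potential_mul hN hβ.continuous hβs x
  have hi2 : Integrable fun y => K (x - y) * f y := by
    refine (hi1.const_mul (kap N)⁻¹).congr (.of_forall fun y => ?_)
    simp only [hKdef, hcv]; ring
  have he2 : ∫ y, K (x - y) * f y = cv v β x := by
    calc ∫ y, K (x - y) * f y
        = (kap N)⁻¹ * ∫ y, (∫ z, gam 0 (z - (x - y)) * β z) * f y := by
          rw [← integral_const_mul]
          refine integral_congr_ae (.of_forall fun y => ?_)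
          simp only [hKdef, hcv]; ring
      _ = ∫ z, β z * v (x - z) := by rw [he1, inv_mul_cancel_left₀ hk.ne']
      _ = cv v β x := by
          rw [cv, ← integral_sub_left_eq_self _ volume x]
          refine integral_congr_ae (.of_forall fun z => ?_)
          simp [mul_comm]
  have he3 : kap N * v x = cv v β x + ∫ y, (gam 0 (x - y) - K (x - y)) * f y := by
    rw [h.eq x hx, ← he2]
    have hi3 : Integrable fun y => (gam 0 (x - y) - K (x - y)) * f y := by
      refine ((h.integrable x hx).sub hi2).congr (.of_forall fun y => ?_)
      simp [gam_comm_sub 0 x y]; ring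
    rw [← integral_add hi2 hi3]
    refine integral_congr_ae (.of_forall fun y => ?_)
    simp only [gam_comm_sub 0 x y]; ring
  rw [he3]
  congr 1
  have hFli : LocallyIntegrable F :=
    (locallyIntegrable_const M).mono hF.aestronglyMeasurable
      (.of_forall fun y => (hM y).trans (le_abs_self M))
  have hFi : ∀ j : ℕ, Integrable fun y => F y • scl (N - 2) (2 ^ j) E (x - y) := fun j =>
    hFli.integrable_smul_right_of_hasCompactSupport
      ((continuous_scl hE.continuous _ _).comp (by fun_prop))
      ((hasCompactSupport_scl hEs _ (two_pow_pos j).ne').comp_homeomorph (Homeomorph.subLeft x))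
  have hnorm : ∀ j : ℕ, ∫ y, ‖F y • scl (N - 2) (2 ^ j) E (x - y)‖ ≤
      M * (∫ z, ‖E z‖) * ((1 / 2) ^ 2) ^ j := by
    intro j
    have := norm_cv_scl_le (F := fun y => ‖F y‖) (E := fun z => ‖E z‖) (a := N - 2) (b := 2)
      (fun y => (norm_norm (F y)).le.trans (hM y)) hE.continuous.norm hEs.norm (by omega) j x
    simp only [norm_norm] at this
    refine le_trans (le_of_eq ?_) ((le_abs_self _).trans this)
    refine integral_congr_ae (.of_forall fun y => ?_)
    simp [scl]
  have hsum : Summable fun j : ℕ => ∫ y, ‖F y • scl (N - 2) (2 ^ j) E (x - y)‖ := by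
    refine Summable.of_nonneg_of_le (fun j => integral_nonneg fun y => norm_nonneg _) hnorm ?_
    exact (summable_geometric_of_lt_one (by norm_num) (by norm_num)).mul_left _
  have := hasSum_integral_of_summable_integral_norm hFi hsum
  refine Eq.trans ?_ this.tsum_eq.symm
  refine integral_congr_ae ?_
  filter_upwards [ae_ne_point hN x] with y hy
  have h1 := (hEsum (x - y) (sub_ne_zero.2 hy.symm)).mul_left (F y)
  simp only [smul_eq_mul]
  rw [h1.tsum_eq]
  by_cases hyx : y ∈ ball x δ
  · rw [hFf y hyx, mul_comm]
  · have : δ ≤ ‖x - y‖ := by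
      rw [mem_ball, not_lt, dist_comm, dist_eq_norm] at hyx; exact hyx
    rw [hKΓ _ this]; simp

end IsPot

end

section

open scoped Topology ENNReal

variable {N : ℕ}

lemma rpow_holder_of_le_one {a d γ : ℝ} (ha : 0 ≤ a) (hd : 0 ≤ d) (hd1 : d ≤ 1) (hγ : γ ≤ 1) :
    a * d ≤ a * d ^ γ := by
  rcases hd.eq_or_lt with rfl | h
  · simp only [mul_zero]; positivity
  · gcongr
    simpa using Real.rpow_le_rpow_of_exponent_ge h hd1 hγ

lemma LipschitzWith.holder_of_mem_Icc {η : Euc N → ℝ} {L : NNReal} (hL : LipschitzWith L η)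
    (hI : ∀ x, η x ∈ Set.Icc (0 : ℝ) 1) {γ : ℝ} (hγ : 0 < γ) (hγ1 : γ ≤ 1) (y z : Euc N) :
    |η y - η z| ≤ (L + 1) * dist y z ^ γ := by
  rcases le_total (dist y z) 1 with h | h
  · have h1 := hL.dist_le_mul y z
    rw [Real.dist_eq] at h1
    refine (h1.trans (rpow_holder_of_le_one L.2 dist_nonneg h hγ1)).trans ?_
    gcongr
    linarith
  · have h1 : |η y - η z| ≤ 1 := by
      rw [abs_le]; constructor <;> linarith [(hI y).1, (hI y).2, (hI z).1, (hI z).2]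
    have h2 : 1 ≤ dist y z ^ γ := Real.one_le_rpow h hγ.le
    have h3 := L.2
    nlinarith [show (0 : ℝ) ≤ L from L.2]

/-- A Hölder function on a ball, cut off inside the ball, is globally Hölder. -/
lemma holder_cutoff_mul {f η : Euc N → ℝ} {x₀ : Euc N} {ε C M γ : ℝ} {L : NNReal}
    (hγ : 0 < γ) (hγ1 : γ ≤ 1) (hL : LipschitzWith L η) (hI : ∀ x, η x ∈ Set.Icc (0 : ℝ) 1)
    (hη : ∀ y, y ∉ ball x₀ ε → η y = 0) (hM : ∀ y ∈ ball x₀ ε, ‖f y‖ ≤ M) (hM0 : 0 ≤ M)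
    (hC0 : 0 ≤ C)
    (hf : ∀ y ∈ ball x₀ ε, ∀ z ∈ ball x₀ ε, |f y - f z| ≤ C * dist y z ^ γ) (y z : Euc N) :
    |η y * f y - η z * f z| ≤ (C + M * (L + 1)) * dist y z ^ γ := by
  have hd : 0 ≤ dist y z ^ γ := by positivity
  have hL0 : (0 : ℝ) ≤ L := L.2
  have hηy := hL.holder_of_mem_Icc hI hγ hγ1 y z
  have key : ∀ t, ‖t‖ ≤ M → |η y - η z| * |t| ≤ (C + M * (L + 1)) * dist y z ^ γ := by
    intro t ht
    calc |η y - η z| * |t| ≤ ((L + 1) * dist y z ^ γ) * M := by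
          gcongr; exact ht
      _ ≤ _ := by nlinarith [mul_nonneg hC0 hd]
  by_cases hy : y ∈ ball x₀ ε <;> by_cases hz : z ∈ ball x₀ ε
  · have e : η y * f y - η z * f z = η y * (f y - f z) + (η y - η z) * f z := by ring
    rw [e]
    refine (abs_add_le _ _).trans ?_
    rw [abs_mul, abs_mul, add_mul]
    refine add_le_add ?_ ?_
    · refine le_trans ?_ (hf y hy z hz)
      refine mul_le_of_le_one_left (abs_nonneg _) ?_
      rw [abs_of_nonneg (hI y).1]; exact (hI y).2
    · calc |η y - η z| * |f z| ≤ ((L + 1) * dist y z ^ γ) * M := by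
            gcongr; exact hM z hz
        _ = _ := by ring
  · have e : η y * f y - η z * f z = (η y - η z) * f y := by rw [hη z hz]; ring
    rw [e, abs_mul]
    exact key _ (hM y hy)
  · have e : η y * f y - η z * f z = (η y - η z) * f z := by rw [hη y hy]; ring
    rw [e, abs_mul]
    exact key _ (hM z hz)
  · rw [hη y hy, hη z hz]; simp; positivity

namespace IsPot

variable {v f : Euc N → ℝ}

lemma eq_on_ball (hN : 3 ≤ N) (h : IsPot v f) {x₀ : Euc N} {δ : ℝ} (hδ : 0 < δ)
    (hx₀ : δ < ‖x₀‖) : ∃ β E : Euc N → ℝ, ContDiff ℝ 2 β ∧ HasCompactSupport β ∧ ContDiff ℝ 2 E ∧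
      HasCompactSupport E ∧ ∀ F : Euc N → ℝ, Measurable F → (∃ M, ∀ y, ‖F y‖ ≤ M) →
      (∀ y ∈ ball x₀ (2 * δ), F y = f y) → v =ᶠ[𝓝 x₀] fun x =>
        (kap N)⁻¹ * (cv v β x + ∑' j : ℕ, cv F (scl (N - 2) (2 ^ j) E) x) := by
  obtain ⟨β, E, h1, h2, h3, h4, h5⟩ := h.exists_local hN hδ
  refine ⟨β, E, h1, h2, h3, h4, fun F hF hM hFf => ?_⟩
  filter_upwards [ball_mem_nhds x₀ hδ] with x hx
  have hx0 : x ≠ 0 := by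
    rintro rfl
    rw [mem_ball, dist_zero_left] at hx
    linarith
  rw [← h5 x hx0 F hF hM fun y hy => hFf y ?_, inv_mul_cancel_left₀ (kap_pos hN).ne']
  rw [mem_ball] at *
  linarith [dist_triangle y x x₀]

lemma locallyIntegrable_of_bdd {F : Euc N → ℝ} (hF : Measurable F) {M : ℝ} (hM : ∀ y, ‖F y‖ ≤ M) :
    LocallyIntegrable F :=
  (locallyIntegrable_const M).mono hF.aestronglyMeasurable
    (.of_forall fun y => (hM y).trans (le_abs_self M))

lemma contDiffAt_one (hN : 3 ≤ N) (h : IsPot v f) {x₀ : Euc N} (hx₀ : x₀ ≠ 0) :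
    ContDiffAt ℝ 1 v x₀ := by
  have hx : 0 < ‖x₀‖ := norm_pos_iff.2 hx₀
  obtain ⟨β, E, h1, h2, h3, h4, h5⟩ := h.eq_on_ball hN (x₀ := x₀) (δ := ‖x₀‖ / 4) (by positivity)
    (by linarith)
  obtain ⟨M, hM⟩ := h.bdd x₀ hx₀
  have hM0 : 0 ≤ M := (norm_nonneg _).trans (hM x₀ (mem_ball_self (by positivity)))
  set F : Euc N → ℝ := (ball x₀ (‖x₀‖ / 2)).indicator f with hF
  have hFm : Measurable F := h.measurable.indicator measurableSet_ball
  have hFM : ∀ y, ‖F y‖ ≤ M := by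
    intro y
    by_cases hy : y ∈ ball x₀ (‖x₀‖ / 2)
    · rw [hF, Set.indicator_of_mem hy]; exact hM y hy
    · rw [hF, Set.indicator_of_notMem hy]; simpa using hM0
  have h6 := h5 F hFm ⟨M, hFM⟩ fun y hy => Set.indicator_of_mem
    (by rwa [show ‖x₀‖ / 2 = 2 * (‖x₀‖ / 4) by ring]) f
  refine ContDiffAt.congr_of_eventuallyEq (ContDiff.contDiffAt ?_) h6
  refine contDiff_const.mul (ContDiff.add ?_ ?_)
  · exact_mod_cast contDiff_cv (n := 1) h.locInt (h1.of_le (by norm_num)) h2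
  · exact contDiff_one_tsum_cv hN (locallyIntegrable_of_bdd hFm hFM) hFM h3 h4

/-- A potential whose density is a locally Hölder multiple of the potential itself is `C²`. -/
lemma contDiffOn_two (hN : 3 ≤ N) (h : IsPot v f) {g : Euc N → ℝ} {γ : ℝ} (hγ : 0 < γ)
    (hγ1 : γ ≤ 1) (hg : LocHolderOn γ {x | x ≠ 0} g) (hfg : ∀ y, y ≠ 0 → f y = g y * v y) :
    ContDiffOn ℝ 2 v {x | x ≠ 0} := by
  intro x₀ hx₀
  refine ContDiffAt.contDiffWithinAt ?_
  have hx : 0 < ‖x₀‖ := norm_pos_iff.2 hx₀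
  have hv1 := h.contDiffAt_one hN hx₀
  obtain ⟨Lv, s, hs, hLv⟩ := hv1.exists_lipschitzOnWith
  obtain ⟨ε₁, hε₁, hs1⟩ := Metric.mem_nhds_iff.1 hs
  obtain ⟨ε₂, hε₂, Cg, hCg, hgH⟩ := hg x₀ hx₀
  obtain ⟨M, hM⟩ := h.bdd x₀ hx₀
  have hM0 : 0 ≤ M := (norm_nonneg _).trans (hM x₀ (mem_ball_self (by positivity)))
  set ε := min (min ε₁ ε₂) (min (‖x₀‖ / 2) (1 / 2)) with hε
  have hε0 : 0 < ε := by positivity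
  have i1 : ε ≤ ε₁ := (min_le_left _ _).trans (min_le_left _ _)
  have i2 : ε ≤ ε₂ := (min_le_left _ _).trans (min_le_right _ _)
  have i3 : ε ≤ ‖x₀‖ / 2 := (min_le_right _ _).trans (min_le_left _ _)
  have i4 : ε ≤ 1 / 2 := (min_le_right _ _).trans (min_le_right _ _)
  have hne : ∀ y ∈ ball x₀ ε, y ≠ 0 := by
    rintro y hy rfl
    rw [mem_ball, dist_zero_left] at hy
    linarith
  have hdist : ∀ y ∈ ball x₀ ε, ∀ z ∈ ball x₀ ε, dist y z ≤ 1 := by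
    intro y hy z hz
    rw [mem_ball] at hy hz
    linarith [dist_triangle_right y z x₀]
  have hvL : ∀ y ∈ ball x₀ ε, ∀ z ∈ ball x₀ ε, |v y - v z| ≤ Lv * dist y z ^ γ := by
    intro y hy z hz
    have := hLv.dist_le_mul y (hs1 (ball_subset_ball i1 hy)) z (hs1 (ball_subset_ball i1 hz))
    rw [Real.dist_eq] at this
    exact this.trans (rpow_holder_of_le_one Lv.2 dist_nonneg (hdist y hy z hz) hγ1)
  have hgL : ∀ y ∈ ball x₀ ε, ∀ z ∈ ball x₀ ε, |g y - g z| ≤ Cg * dist y z ^ γ :=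
    fun y hy z hz => hgH y ⟨ball_subset_ball i2 hy, hne y hy⟩ z
      ⟨ball_subset_ball i2 hz, hne z hz⟩
  have hb : ∀ {a : Euc N → ℝ} {A : ℝ}, 0 ≤ A →
      (∀ y ∈ ball x₀ ε, ∀ z ∈ ball x₀ ε, |a y - a z| ≤ A * dist y z ^ γ) →
      ∀ y ∈ ball x₀ ε, |a y| ≤ |a x₀| + A := by
    intro a A hA ha y hy
    have h1 := ha y hy x₀ (mem_ball_self hε0)
    have h2 : dist y x₀ ^ γ ≤ 1 :=
      Real.rpow_le_one dist_nonneg (hdist y hy x₀ (mem_ball_self hε0)) hγ.le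
    have h3 := abs_sub_abs_le_abs_sub (a y) (a x₀)
    nlinarith
  have hLv0 : (0 : ℝ) ≤ Lv := Lv.2
  set C := (|g x₀| + Cg) * Lv + (|v x₀| + Lv) * Cg with hC
  have hC0 : 0 ≤ C := by positivity
  have hfL : ∀ y ∈ ball x₀ ε, ∀ z ∈ ball x₀ ε, |f y - f z| ≤ C * dist y z ^ γ := by
    intro y hy z hz
    rw [hfg y (hne y hy), hfg z (hne z hz),
      show g y * v y - g z * v z = g y * (v y - v z) + v z * (g y - g z) by ring]
    refine (abs_add_le _ _).trans ?_
    rw [abs_mul, abs_mul, hC, add_mul, mul_assoc, mul_assoc]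
    have d0 : 0 ≤ dist y z ^ γ := by positivity
    exact add_le_add
      (mul_le_mul (hb hCg.le hgL y hy) (hvL y hy z hz) (abs_nonneg _) (by positivity))
      (mul_le_mul (hb hLv0 hvL z hz) (hgL y hy z hz) (abs_nonneg _) (by positivity))
  obtain ⟨β, E, h1, h2, h3, h4, h5⟩ := h.eq_on_ball hN (x₀ := x₀) (δ := ε / 4) (by positivity)
    (by linarith)
  obtain ⟨η, hη, hηs, hηt, hη1, hηI⟩ := exists_cutoff (isCompact_closedBall x₀ (ε / 2))
    (isOpen_ball (x := x₀) (ε := ε)) (closedBall_subset_ball (by linarith))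
  rw [eventually_nhdsSet_iff_forall] at hη1
  obtain ⟨L, hL⟩ := (isC11c_of_contDiff hη hηs).lipschitz
  have hη0 : ∀ y, y ∉ ball x₀ ε → η y = 0 := fun y hy =>
    image_eq_zero_of_notMem_tsupport fun h => hy (hηt h)
  have hfM : ∀ y ∈ ball x₀ ε, ‖f y‖ ≤ M := fun y hy => hM y (ball_subset_ball i3 hy)
  set F : Euc N → ℝ := fun y => η y * f y with hF
  have hFm : Measurable F := hη.continuous.measurable.mul h.measurable
  have hFM : ∀ y, ‖F y‖ ≤ M := by
    intro y
    by_cases hy : y ∈ ball x₀ ε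
    · rw [hF, norm_mul]
      refine le_trans (mul_le_of_le_one_left (norm_nonneg _) ?_) (hfM y hy)
      rw [Real.norm_of_nonneg (hηI y).1]; exact (hηI y).2
    · simp only [hF]
      rw [hη0 y hy]; simpa using hM0
  have hFH : ∀ x y, ‖F y - F x‖ ≤ (C + M * (L + 1)) * ‖x - y‖ ^ γ := by
    intro x y
    rw [← dist_eq_norm x y, dist_comm x y]
    exact holder_cutoff_mul hγ hγ1 hL hηI hη0 hfM hM0 hC0 hfL y x
  have h6 := h5 F hFm ⟨M, hFM⟩ fun y hy => by
    have : η y = 1 := (hη1 y (ball_subset_closedBall (by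
      rwa [show ε / 2 = 2 * (ε / 4) by ring]))).self_of_nhds
    simp [hF, this]
  refine ContDiffAt.congr_of_eventuallyEq (ContDiff.contDiffAt ?_) h6
  refine contDiff_const.mul (ContDiff.add ?_ ?_)
  · exact_mod_cast contDiff_cv (n := 2) h.locInt (by exact_mod_cast h1) h2
  · exact contDiff_two_tsum_cv hN (locallyIntegrable_of_bdd hFm hFM) hFM hγ hγ1 hFH h3 h4

end IsPot

end

section

open scoped Topology ENNReal

variable {N : ℕ}

lemma LocHolderOn.continuousOn {γ : ℝ} (hγ : 0 < γ) {s : Set (Euc N)} {g : Euc N → ℝ}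
    (h : LocHolderOn γ s g) : ContinuousOn g s := by
  intro x hx
  obtain ⟨ε, hε, C, hC, hg⟩ := h x hx
  rw [ContinuousWithinAt, tendsto_iff_dist_tendsto_zero]
  have h1 : Tendsto (fun y => C * dist y x ^ γ) (𝓝[s] x) (𝓝 0) := by
    have : ContinuousAt (fun y : Euc N => C * dist y x ^ γ) x :=
      continuousAt_const.mul ((continuousAt_id.dist continuousAt_const).rpow_const (Or.inr hγ.le))
    have h2 := this.tendsto.mono_left (nhdsWithin_le_nhds (s := s))
    simpa [Real.zero_rpow hγ.ne'] using h2
  refine squeeze_zero' (.of_forall fun _ => dist_nonneg) ?_ h1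
  filter_upwards [mem_nhdsWithin_of_mem_nhds (ball_mem_nhds x hε), self_mem_nhdsWithin] with y hy hys
  exact hg y ⟨hy, hys⟩ x ⟨mem_ball_self hε, hx⟩

lemma LocHolderOn.const_mul {γ : ℝ} {s : Set (Euc N)} {g : Euc N → ℝ}
    (h : LocHolderOn γ s g) (a : ℝ) : LocHolderOn γ s fun x => a * g x := by
  intro x hx
  obtain ⟨ε, hε, C, hC, hg⟩ := h x hx
  refine ⟨ε, hε, (|a| + 1) * C, by positivity, fun y hy z hz => ?_⟩
  rw [← mul_sub, abs_mul, mul_assoc]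
  have := hg y hy z hz
  gcongr
  linarith

lemma lap_comp_neg (φ : Euc N → ℝ) (z : Euc N) : lap (fun z => φ (-z)) z = lap φ (-z) := by
  have := lap_comp_smul φ (-1) z
  simpa using this

lemma IsPot.neg_lap_eq (hN : 3 ≤ N) {v f : Euc N → ℝ} (h : IsPot v f)
    (hv : ContDiffOn ℝ 2 v {x | x ≠ 0}) (hf : ContinuousOn f {x | x ≠ 0}) {x : Euc N}
    (hx : x ≠ 0) : -lap v x = f x := by
  have hk := kap_pos hN
  have hX : IsOpen {x : Euc N | x ≠ 0} := isOpen_ne_zero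
  have hweak : ∀ φ : Euc N → ℝ, ContDiff ℝ 2 φ → HasCompactSupport φ →
      ∫ y, v y * lap φ y = -∫ y, f y * φ y := by
    intro φ hφ hs
    have hφ' : ContDiff ℝ 2 fun z => φ (-z) := hφ.comp contDiff_neg
    have hs' : HasCompactSupport fun z => φ (-z) := hs.comp_homeomorph (Homeomorph.neg _)
    obtain ⟨-, h2⟩ := h.integral_potential_mul hN (β := lap fun z => φ (-z))
      ((contDiff_lap (m := 0) hφ' (by norm_num)).continuous) (hasCompactSupport_lap hs') 0
    have e1 : ∀ y, ∫ z, gam 0 (z - (0 - y)) * lap (fun z => φ (-z)) z = -(kap N * φ y) := by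
      intro y
      rw [integral_gam_mul_lap hN hφ' hs']
      simp
    simp only [e1] at h2
    have e2 : ∫ z, lap (fun z => φ (-z)) z * v (0 - z) = ∫ y, v y * lap φ y := by
      rw [← integral_neg_eq_self]
      refine integral_congr_ae (.of_forall fun z => ?_)
      simp only [lap_comp_neg, neg_neg, zero_sub, mul_comm]
    rw [e2] at h2
    have e3 : ∫ y, -(kap N * φ y) * f y = -(kap N * ∫ y, f y * φ y) := by
      rw [← integral_const_mul, ← integral_neg]
      refine integral_congr_ae (.of_forall fun z => ?_)
      simp only; ring
    rw [e3] at h2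
    have := mul_left_cancel₀ hk.ne' (h2.symm.trans (mul_neg _ _).symm)
    exact this
  have hlc := continuousOn_lap hX hv
  have hsum : ContinuousOn (fun y => lap v y + f y) {x | x ≠ 0} := hlc.add hf
  have hae : ∀ᵐ y : Euc N, y ∈ {x : Euc N | x ≠ 0} → lap v y + f y = 0 := by
    refine hX.ae_eq_zero_of_integral_contDiff_smul_eq_zero
      (hsum.locallyIntegrableOn hX.measurableSet) fun φ hφ hs ht => ?_
    have hφ2 : ContDiff ℝ 2 φ := by exact_mod_cast contDiff_infty.1 hφ 2
    have h1 := hweak φ hφ2 hs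
    rw [integral_mul_lap_of_contDiffOn hX hv (isC11c_of_contDiff hφ2 hs) ht] at h1
    have hi : ∀ {a : Euc N → ℝ}, ContinuousOn a {x | x ≠ 0} → Integrable fun y => a y * φ y := by
      intro a ha
      refine (continuous_iff_continuousAt.2 fun y => ?_).integrable_of_hasCompactSupport hs.mul_left
      by_cases hy : y = 0
      · have h0 : y ∉ tsupport φ := fun h => ht h hy
        refine ContinuousAt.congr (f := fun _ => (0 : ℝ)) continuousAt_const ?_
        filter_upwards [(isClosed_tsupport φ).isOpen_compl.mem_nhds h0] with z hz
        simp [image_eq_zero_of_notMem_tsupport hz]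
      · exact (ha.continuousAt (hX.mem_nhds hy)).mul hφ.continuous.continuousAt
    calc ∫ y, φ y • (lap v y + f y) = ∫ y, (lap v y * φ y + f y * φ y) := by
          refine integral_congr_ae (.of_forall fun z => ?_)
          simp only [smul_eq_mul]; ring
      _ = 0 := by rw [integral_add (hi hlc) (hi hf), h1]; ring
  have := Measure.eqOn_open_of_ae_eq (μ := volume) (f := fun y => lap v y + f y) (g := fun _ => 0)
    ((ae_restrict_iff' hX.measurableSet).2 hae) hX hsum continuousOn_const hx
  simp only at this
  linarith

end

section

open scoped Topology ENNReal

variable {N : ℕ}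

lemma pw_half (s : ℝ) : (fun x : Euc N => ‖x‖ ^ s) = pw 0 (s / 2) := by
  ext y; rw [pw_zero_left]; ring_nf

lemma norm_sq_rpow (x : Euc N) (a : ℝ) : (0 + ‖x‖ ^ 2) ^ a = ‖x‖ ^ (2 * a) := by
  rw [zero_add, ← Real.rpow_natCast ‖x‖ 2, ← Real.rpow_mul (norm_nonneg _)]; norm_num

lemma norm_fderiv_rpow_norm_le (s : ℝ) {x : Euc N} (hx : x ≠ 0) :
    ‖fderiv ℝ (fun x : Euc N => ‖x‖ ^ s) x‖ ≤ |s| * ‖x‖ ^ (s - 1) := by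
  rw [pw_half]
  refine (norm_fderiv_pw_le (pos_add_normSq le_rfl hx)).trans (le_of_eq ?_)
  rw [norm_sq_rpow x, mul_assoc, ← Real.rpow_add_one (norm_ne_zero_iff.2 hx), abs_div, abs_two]
  ring_nf

lemma lap_norm_rpow_mul (s : ℝ) {x : Euc N} (hx : x ≠ 0) {ξ : Euc N → ℝ} (hξ : D2At ξ x) :
    lap (fun y => ‖y‖ ^ s * ξ y) x = ‖x‖ ^ (s - 2) *
      (‖x‖ ^ 2 * lap ξ x + s * (s + N - 2) * ξ x + 2 * s * fderiv ℝ ξ x x) := by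
  rw [lap_mul (d2At_norm_rpow s hx) hξ, lap_norm_rpow s hx, pw_half,
    gdot_pw (pos_add_normSq le_rfl hx), norm_sq_rpow x]
  have e : ‖x‖ ^ s = ‖x‖ ^ (s - 2) * ‖x‖ ^ 2 := by
    rw [← Real.rpow_natCast ‖x‖ 2, ← Real.rpow_add (norm_pos_iff.2 hx)]; norm_num
  have e2 : 2 * (s / 2 - 1) = s - 2 := by ring
  rw [e2]
  simp only [e]
  ring

lemma tauPlus_mul (hμ0 : μ < mu0 N) : tauPlus N μ * (tauPlus N μ + N - 2) = -μ := by
  have := Real.sq_sqrt (sub_nonneg.2 hμ0.le)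
  unfold tauPlus
  have e : mu0 N = ((N : ℝ) - 2) ^ 2 / 4 := rfl
  nlinarith

lemma IsC11c.norm_rpow_mul {ξ ζ : Euc N → ℝ} (hξ : IsC11c ξ) (s : ℝ) (hζ : ContDiff ℝ 2 ζ)
    (h0 : ∀ᶠ y in 𝓝 0, ζ y = 0) : IsC11c fun y => ζ y * (‖y‖ ^ s * ξ y) := by
  obtain ⟨χ, hχ, hcs, -, hone, -⟩ := exists_cutoff hξ.1.isCompact isOpen_univ (Set.subset_univ _)
  have h1 : ContDiff ℝ 2 fun y => ‖y‖ ^ s * ζ y := by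
    refine contDiff_mul_cutoff isOpen_ne_zero (contDiffOn_norm_rpow s) hζ fun y hy h => ?_
    subst h
    exact notMem_tsupport_iff_eventuallyEq.2 h0 hy
  have h2 : IsC11c fun y => (‖y‖ ^ s * ζ y) * χ y :=
    isC11c_of_contDiff (h1.mul hχ) (hcs.mul_left)
  have h3 := h2.mul hξ
  have e : (fun y => ζ y * (‖y‖ ^ s * ξ y)) = fun y => (‖y‖ ^ s * ζ y) * χ y * ξ y := by
    ext y
    by_cases hy : y ∈ tsupport ξ
    · rw [(eventually_nhdsSet_iff_forall.1 hone y hy).self_of_nhds]; ring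
    · rw [image_eq_zero_of_notMem_tsupport hy]; ring
  rw [e]; exact h3

/-- A solution with a weak singularity at the origin satisfies the distributional identity with
constant zero. -/
lemma integral_mul_LstarMuV_eq_zero (hN : 3 ≤ N) {μ : ℝ} (hμ0 : μ < mu0 N)
    {V w ξ : Euc N → ℝ} (hVm : Measurable V)
    (hV : ∀ x, x ≠ 0 → 0 ≤ V x ∧ V x ≤ ‖x‖ ^ (-2 : ℝ))
    (hw : ContDiffOn ℝ 2 w {x | x ≠ 0}) (heq : ∀ x, x ≠ 0 → -lap w x = μ * V x * w x)
    (hb : ∀ R : ℝ, ∃ C, ∀ x, x ≠ 0 → ‖x‖ < R → |w x| ≤ C * ‖x‖ ^ (-(((N : ℝ) - 2) / 2)))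
    (hξ : IsC11c ξ) :
    Integrable (fun x => w x * LstarMuV N μ V ξ x * ‖x‖ ^ tauPlus N μ) ∧
      ∫ x, w x * LstarMuV N μ V ξ x * ‖x‖ ^ tauPlus N μ = 0 := by
  set s := tauPlus N μ with hs
  have hsq : 0 < √(mu0 N - μ) := Real.sqrt_pos.2 (sub_pos.2 hμ0)
  have hs' : s = -((N : ℝ) - 2) / 2 + √(mu0 N - μ) := rfl
  have hsm : s * (s + N - 2) = -μ := tauPlus_mul hμ0
  have hne := ae_ne_point hN (0 : Euc N)
  have hwm : Measurable w := measurable_of_continuousOn_compl_singleton 0 hw.continuousOn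
  have hwi : ∀ R, IntegrableOn (fun y => w y * ‖y‖ ^ (s - 2)) (ball 0 R) := fun R => by
    obtain ⟨C, hC⟩ := hb R
    have h1 : IntegrableOn (fun y : Euc N => C * ‖y‖ ^ (-(((N : ℝ) - 2) / 2) + (s - 2)))
        (ball 0 R) :=
      (integrableOn_norm_rpow hN (by rw [hs']; linarith) R).const_mul C
    refine h1.mono' (hwm.mul (measurable_norm.pow_const _)).aestronglyMeasurable ?_
    filter_upwards [ae_restrict_mem measurableSet_ball, ae_restrict_of_ae hne] with y hy hy0
    have hp := norm_pos_iff.2 hy0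
    rw [norm_mul, Real.norm_eq_abs, Real.norm_of_nonneg (by positivity), Real.rpow_add hp,
      ← mul_assoc]
    gcongr
    exact hC y hy0 (mem_ball_zero_iff.1 hy)
  obtain ⟨C0, hC0⟩ := hξ.exists_bound
  obtain ⟨C1, hC1⟩ := hξ.exists_bound_fderiv
  obtain ⟨C2, hC2⟩ := hξ.exists_bound_lap
  have hC0' : 0 ≤ C0 := (norm_nonneg _).trans (hC0 0)
  have hC1' : 0 ≤ C1 := (norm_nonneg _).trans (hC1 0)
  obtain ⟨R, hR0, hR⟩ := hξ.1.isCompact.isBounded.subset_ball_lt 0 0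
  set φ : Euc N → ℝ := fun y => ‖y‖ ^ s * ξ y with hφ
  set G : Euc N → ℝ := fun x =>
    ‖x‖ ^ 2 * lap ξ x + s * (s + N - 2) * ξ x + 2 * s * fderiv ℝ ξ x x with hG
  have hlap : ∀ᵐ x, x ≠ 0 ∧ lap φ x = ‖x‖ ^ (s - 2) * G x := by
    filter_upwards [hξ.ae_d2At, hne] with x hx h0 using ⟨h0, lap_norm_rpow_mul s h0 hx⟩
  have hfm : Measurable fun x : Euc N => fderiv ℝ ξ x x :=
    (hξ.continuous_fderiv.clm_apply continuous_id).measurable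
  have hGm : Measurable G :=
    (((measurable_norm.pow_const 2).mul (measurable_lap ξ)).add
      (hξ.continuous.measurable.const_mul _)).add (hfm.const_mul _)
  have hGz : ∀ x ∉ tsupport ξ, G x = 0 := fun x hx => by
    simp only [hG]
    rw [lap_eq_zero_of_notMem_tsupport hx, image_eq_zero_of_notMem_tsupport hx,
      fderiv_of_notMem_tsupport ℝ hx]
    simp
  have hGs : HasCompactSupport G := hξ.1.mono' fun x hx => by
    by_contra h
    exact hx (hGz x h)
  have hGb : ∀ x, ‖G x‖ ≤ R ^ 2 * C2 + |s * (s + N - 2)| * C0 + |2 * s| * (C1 * R) := fun x => by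
    by_cases hx : x ∈ tsupport ξ
    · have hxR : ‖x‖ ≤ R := (mem_ball_zero_iff.1 (hR hx)).le
      refine (norm_add₃_le).trans ?_
      rw [norm_mul, norm_mul _ (ξ x), norm_mul (2 * s), Real.norm_eq_abs (2 * s),
        Real.norm_eq_abs (s * _), norm_pow, norm_norm]
      have h2 := hC2 x
      have h0 := hC0 x
      have h1 : ‖fderiv ℝ ξ x x‖ ≤ C1 * R :=
        ((fderiv ℝ ξ x).le_opNorm x).trans (by gcongr; exact hC1 x)
      gcongr
    · rw [hGz x hx, norm_zero]
      have hC2' : 0 ≤ C2 := (norm_nonneg _).trans (hC2 0)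
      positivity
  have hφi : ∀ᵐ y, (w y * ‖y‖ ^ (s - 2)) * G y = w y * lap φ y := by
    filter_upwards [hlap] with y hy
    rw [hy.2]; ring
  have hi1 : Integrable fun y => w y * lap φ y :=
    (integrable_mul_of_integrableOn_ball hwi hGm hGb hGs).congr hφi
  have hpow : ∀ y : Euc N, y ≠ 0 → ‖y‖ ^ s = ‖y‖ ^ (s - 2) * ‖y‖ ^ 2 := fun y hy => by
    rw [← Real.rpow_natCast ‖y‖ 2, ← Real.rpow_add (norm_pos_iff.2 hy)]; norm_num
  have hVb : ∀ y : Euc N, ‖V y * ‖y‖ ^ 2‖ ≤ 1 := fun y => by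
    by_cases hy : y = 0
    · simp [hy]
    · have hp := norm_pos_iff.2 hy
      rw [Real.norm_of_nonneg (mul_nonneg (hV y hy).1 (sq_nonneg _))]
      refine (mul_le_mul_of_nonneg_right (hV y hy).2 (sq_nonneg _)).trans (le_of_eq ?_)
      rw [← Real.rpow_natCast ‖y‖ 2, ← Real.rpow_add hp]; norm_num
  have hi2' : Integrable fun y => (w y * ‖y‖ ^ (s - 2)) * (-μ * (V y * ‖y‖ ^ 2 * ξ y)) := by
    refine integrable_mul_of_integrableOn_ball (C := |μ| * (1 * C0)) hwi
      (((hVm.mul (measurable_norm.pow_const 2)).mul hξ.continuous.measurable).const_mul _)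
      (fun y => ?_) (hξ.1.mul_left.mul_left)
    rw [norm_mul, norm_mul (V y * _), norm_neg, Real.norm_eq_abs μ]
    gcongr
    · exact hVb y
    · exact hC0 y
  have hlw : ∀ᵐ y, (w y * ‖y‖ ^ (s - 2)) * (-μ * (V y * ‖y‖ ^ 2 * ξ y)) = lap w y * φ y := by
    filter_upwards [hne] with y hy
    have := heq y hy
    rw [show lap w y = -(μ * V y * w y) by linarith, hφ]
    simp only [hpow y hy]
    ring
  have hi2 : Integrable fun y => lap w y * φ y := hi2'.congr hlw
  have hdφ : ∀ y, y ≠ 0 → fderiv ℝ φ y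
      = ‖y‖ ^ s • fderiv ℝ ξ y + ξ y • fderiv ℝ (fun y : Euc N => ‖y‖ ^ s) y := fun y hy =>
    fderiv_fun_mul (d2At_norm_rpow s hy).differentiableAt (hξ.2.1 y)
  have key := integral_mul_lap_of_removable (φ := φ) (σ := s) (C := C0 + 2 * C1 + C0 * |s|) hN hw
    (fun ζ hζ h0 => hξ.norm_rpow_mul s hζ h0) (fun y hy _ => ?_) (fun y hy h2 => ?_) (hwi 2) hi1 hi2
  · have e : ∀ᵐ x, -(w x * lap φ x) + lap w x * φ x
        = w x * LstarMuV N μ V ξ x * ‖x‖ ^ s := by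
      filter_upwards [hlap, hφi, hlw] with x hx h1 h2
      rw [← h1, ← h2, LstarMuV, LstarMu, ← hs, hpow x hx.1]
      have hp := norm_pos_iff.2 hx.1
      have e3 : ‖x‖ ^ (-2 : ℝ) = (‖x‖ ^ 2)⁻¹ := by
        rw [Real.rpow_neg hp.le]; norm_num
      simp only [hG, hsm, e3]
      field_simp
      ring
    refine ⟨(hi1.neg.add hi2).congr e, ?_⟩
    rw [← integral_congr_ae e]
    refine (integral_add hi1.neg hi2).trans ?_
    rw [integral_neg', key]; ring
  · rw [hφ, norm_mul, Real.norm_of_nonneg (by positivity), mul_comm]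
    gcongr
    refine (hC0 y).trans ?_
    have : 0 ≤ 2 * C1 + C0 * |s| := by positivity
    linarith
  · rw [hdφ y hy]
    have hp := norm_pos_iff.2 hy
    refine (norm_add_le _ _).trans ?_
    rw [norm_smul, norm_smul, Real.norm_of_nonneg (by positivity : 0 ≤ ‖y‖ ^ s)]
    have h3 : ‖y‖ ^ s = ‖y‖ * ‖y‖ ^ (s - 1) := by
      rw [mul_comm, ← Real.rpow_add_one hp.ne']; norm_num
    have h4 : ‖y‖ ^ s * ‖fderiv ℝ ξ y‖ ≤ 2 * ‖y‖ ^ (s - 1) * C1 := by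
      rw [h3]; gcongr; exact hC1 y
    have h5 : ‖ξ y‖ * ‖fderiv ℝ (fun y : Euc N => ‖y‖ ^ s) y‖ ≤ C0 * (|s| * ‖y‖ ^ (s - 1)) := by
      gcongr
      · exact hC0 y
      · exact norm_fderiv_rpow_norm_le s hy
    have h6 : 0 ≤ C0 * ‖y‖ ^ (s - 1) := by positivity
    nlinarith

end

section

open scoped Topology ENNReal

variable {N : ℕ}

lemma isPot_of_tp_eq (hN : 3 ≤ N) {q : Euc N → ℝ} (hq : Measurable q)
    (hq0 : ∀ y, y ≠ 0 → 0 ≤ q y) (hqc : ContinuousOn q {x | x ≠ 0}) {v : Euc N → ℝ≥0∞}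
    {u : Euc N → ℝ} (hu : IsSuper u) (hv : Measurable v) (hfix : ∀ x, x ≠ 0 → tp q v x = v x)
    (hvu : ∀ x, x ≠ 0 → v x ≤ ENNReal.ofReal (u x)) :
    IsPot (fun x => (v x).toReal) fun y => kap N * (q y * (v y).toReal) := by
  have hk := kap_pos hN
  have hne := ae_ne_point hN (0 : Euc N)
  have hle : ∀ x, x ≠ 0 → (v x).toReal ≤ u x := fun x hx =>
    ENNReal.toReal_le_of_le_ofReal (hu.nonneg x hx) (hvu x hx)
  have hfin : ∀ x, x ≠ 0 → v x ≠ ∞ := fun x hx =>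
    ((hvu x hx).trans_lt ENNReal.ofReal_lt_top).ne
  have hf0 : ∀ y, y ≠ 0 → 0 ≤ kap N * (q y * (v y).toReal) := fun y hy =>
    mul_nonneg hk.le (mul_nonneg (hq0 y hy) ENNReal.toReal_nonneg)
  have hfm : Measurable fun y => kap N * (q y * (v y).toReal) :=
    (hq.mul hv.ennreal_toReal).const_mul _
  have hker : ∀ x, Measurable fun y => gam 0 (y - x) * (kap N * (q y * (v y).toReal)) := fun x =>
    ((measurable_gam 0).comp (by fun_prop)).mul hfm
  have hker0 : ∀ x, ∀ᵐ y, 0 ≤ gam 0 (y - x) * (kap N * (q y * (v y).toReal)) := fun x =>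
    hne.mono fun y hy => mul_nonneg (gam_nonneg le_rfl _) (hf0 y hy)
  have hl : ∀ x, x ≠ 0 → ∫⁻ y, ENNReal.ofReal (gam 0 (y - x) * (kap N * (q y * (v y).toReal)))
      = ENNReal.ofReal (kap N * (v x).toReal) := fun x hx => by
    rw [ENNReal.ofReal_mul hk.le, ENNReal.ofReal_toReal (hfin x hx), ← hfix x hx,
      tp_congr_ae (g := fun y => ENNReal.ofReal (v y).toReal)
        (hne.mono fun y hy => (ENNReal.ofReal_toReal (hfin y hy)).symm),
      tp_ofReal_eq (hne.mono hq0), ← lintegral_const_mul' _ _ ENNReal.ofReal_ne_top]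
    refine lintegral_congr fun y => ?_
    rw [← ENNReal.ofReal_mul hk.le]
    congr 1; ring
  refine ⟨hfm, hf0, fun x hx => ?_, fun x hx => ?_, ?_, fun x hx => ?_⟩
  · refine integrable_of_lintegral_ofReal_le (A := kap N * (v x).toReal) (hker x) (hker0 x) ?_
    exact (hl x hx).le
  · rw [integral_eq_lintegral_of_nonneg_ae (hker0 x) (hker x).aestronglyMeasurable, hl x hx,
      ENNReal.toReal_ofReal (mul_nonneg hk.le ENNReal.toReal_nonneg)]
  · refine fun x => ⟨ball 0 (‖x‖ + 1), isOpen_ball.mem_nhds (by simp), ?_⟩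
    refine (hu.integrableOn_ball hN (‖x‖ + 1)).mono' hv.ennreal_toReal.aestronglyMeasurable ?_
    filter_upwards [ae_restrict_of_ae hne] with y hy
    rw [Real.norm_of_nonneg ENNReal.toReal_nonneg]
    exact hle y hy
  · have hx' := norm_pos_iff.2 hx
    have hsub : closedBall x (‖x‖ / 2) ⊆ {x | x ≠ 0} := by
      rintro y hy rfl
      rw [mem_closedBall, dist_zero_left] at hy
      linarith
    obtain ⟨M, hM⟩ := (isCompact_closedBall x (‖x‖ / 2)).exists_bound_of_continuousOn
      ((hqc.mul hu.continuousOn).mono hsub)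
    refine ⟨kap N * M, fun y hy => ?_⟩
    have hy0 := hsub (ball_subset_closedBall hy)
    rw [Real.norm_of_nonneg (hf0 y hy0)]
    refine mul_le_mul_of_nonneg_left (le_trans ?_ ((le_abs_self _).trans
      (hM y (ball_subset_closedBall hy)))) hk.le
    exact mul_le_mul_of_nonneg_left (hle y hy0) (hq0 y hy0)

/-- The standing hypotheses on the potential and on a positive solution. -/
structure IsSetting (μ : ℝ) (V u : Euc N → ℝ) : Prop where
  three_le : 3 ≤ N
  pos : 0 < μ
  lt : μ < mu0 N
  holder : ∃ γ : ℝ, 0 < γ ∧ γ ≤ 1 ∧ LocHolderOn γ {x | x ≠ 0} V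
  pot_pos : ∀ x, x ≠ 0 → 0 < V x
  pot_le : ∀ x, x ≠ 0 → V x ≤ ‖x‖ ^ (-2 : ℝ)
  le_pot : ∃ c : ℝ, ∀ x, x ≠ 0 → ‖x‖ ^ (-2 : ℝ) - c ≤ V x
  decay : ∃ τ A R₀ : ℝ, 2 < τ ∧ ∀ x, x ≠ 0 → R₀ ≤ ‖x‖ → V x ≤ A * ‖x‖ ^ (-τ)
  sol_pos : ∀ x, x ≠ 0 → 0 < u x
  contDiffOn : ContDiffOn ℝ 2 u {x | x ≠ 0}
  neg_lap_eq : ∀ x, x ≠ 0 → -lap u x = μ * V x * u x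

namespace IsSetting

variable {μ : ℝ} {V u : Euc N → ℝ}

lemma continuousOn_pot (h : IsSetting μ V u) : ContinuousOn V {x | x ≠ 0} := by
  obtain ⟨γ, hγ, -, hV⟩ := h.holder
  exact hV.continuousOn hγ

lemma measurable_pot (h : IsSetting μ V u) : Measurable V :=
  measurable_of_continuousOn_compl_singleton 0 h.continuousOn_pot

lemma isSuper (h : IsSetting μ V u) : IsSuper u where
  contDiffOn := h.contDiffOn
  nonneg x hx := (h.sol_pos x hx).le
  lap_nonpos x hx := by
    have := h.neg_lap_eq x hx
    have := mul_pos (mul_pos h.pos (h.pot_pos x hx)) (h.sol_pos x hx)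
    linarith

lemma integrableOn_mul_norm_rpow (h : IsSetting μ V u) :
    IntegrableOn (fun y => u y * ‖y‖ ^ (-2 : ℝ)) (ball 0 2) := by
  obtain ⟨c, hc⟩ := h.le_pot
  have h1 := h.isSuper.integrableOn_ball h.three_le 2
  have h2 := h.isSuper.integrableOn_ball_lap h.three_le 2
  refine ((h2.neg.const_mul μ⁻¹).add (h1.const_mul c)).mono'
    (h.isSuper.measurable.mul (measurable_norm.pow_const _)).aestronglyMeasurable ?_
  filter_upwards [ae_restrict_of_ae (ae_ne_point h.three_le 0)] with y hy
  have hu := h.sol_pos y hy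
  have e : μ⁻¹ * -lap u y = V y * u y := by
    rw [h.neg_lap_eq y hy]; field_simp [h.pos.ne']
  rw [Real.norm_of_nonneg (by positivity)]
  change _ ≤ μ⁻¹ * -lap u y + c * u y
  rw [e]
  nlinarith [hc y hy]

/-- Below every positive solution lies a nonnegative solution which is a fixed point of the
integral operator, the difference being weakly singular at the origin. -/
lemma exists_minimal_solution (h : IsSetting μ V u) :
    ∃ v : Euc N → ℝ, ContDiffOn ℝ 2 v {x | x ≠ 0} ∧ (∀ x, x ≠ 0 → -lap v x = μ * V x * v x) ∧
      (∀ x, x ≠ 0 → 0 ≤ v x) ∧ (∀ x, x ≠ 0 → v x ≤ u x) ∧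
      (∀ R : ℝ, ∃ C, ∀ x, x ≠ 0 → ‖x‖ < R → |u x - v x| ≤ C * ‖x‖ ^ (-(((N : ℝ) - 2) / 2))) ∧
      ∀ x, x ≠ 0 → tp (fun y => (kap N)⁻¹ * (μ * V y)) (fun y => ENNReal.ofReal (v y)) x
        = ENNReal.ofReal (v x) := by
  have hN := h.three_le
  have hk := kap_pos hN
  have hne := ae_ne_point hN (0 : Euc N)
  set q : Euc N → ℝ := fun y => (kap N)⁻¹ * (μ * V y) with hq
  have hqm : Measurable q := (h.measurable_pot.const_mul _).const_mul _
  have hqp : ∀ y, y ≠ 0 → 0 < q y := fun y hy =>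
    mul_pos (inv_pos.2 hk) (mul_pos h.pos (h.pot_pos y hy))
  have hkq : ∀ y, kap N * q y = μ * V y := fun y => by
    rw [hq]; field_simp
  have hqc : ContinuousOn q {x | x ≠ 0} :=
    (h.continuousOn_pot.const_smul μ).const_smul (kap N)⁻¹
  have hq0 : ∀ᵐ y, 0 ≤ q y := hne.mono fun y hy => (hqp y hy).le
  obtain ⟨τ, A, R₀, hτ, hA⟩ := h.decay
  obtain ⟨S, C, hS, hS1, hSeq, hSC⟩ := exists_supersolution hN h.pos h.lt h.pot_pos h.pot_le hτ hA
  obtain ⟨H, hH, hHle⟩ := h.isSuper.exists_le_potential hN h.integrableOn_mul_norm_rpow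
  have hSm : Measurable S := measurable_of_continuousOn_compl_singleton 0 hS.continuousOn
  have hSsup : IsSuper fun x => S x - 1 := by
    refine ⟨hS.sub contDiffOn_const, fun y hy => by linarith [hS1 y hy], fun y hy => ?_⟩
    have hd := (hS.contDiffAt (isOpen_ne_zero.mem_nhds hy)).d2At
    rw [lap_sub hd contDiffAt_const.d2At, lap_const]
    have := mul_nonneg (mul_pos h.pos (h.pot_pos y hy)).le (zero_le_one.trans (hS1 y hy))
    linarith [hSeq y hy]
  obtain ⟨v, hvm, hfix, hvu, huv⟩ := exists_fixedPoint_tp (q := q) hN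
    (U := fun x => ENNReal.ofReal (u x)) (S := fun x => ENNReal.ofReal (S x))
    (c := ENNReal.ofReal ((kap N)⁻¹ * H)) hqm h.isSuper.measurable.ennreal_ofReal
    hSm.ennreal_ofReal (fun _ _ => ENNReal.ofReal_ne_top)
    (fun x hx => h.isSuper.tp_le hN hq0 (fun y hy => by
      rw [← mul_assoc, hkq, h.neg_lap_eq y hy]) hx)
    (fun x hx => by
      have e : ∀ᵐ y, (kap N)⁻¹ * (-lap u y * gam 0 (y - x)) = q y * u y * gam 0 (y - x) :=
        hne.mono fun y hy => by rw [h.neg_lap_eq y hy, hq]; ring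
      have hi := ((h.isSuper.integrable_potential hN hx).const_mul (kap N)⁻¹).congr e
      have hn : ∀ᵐ y, 0 ≤ q y * u y * gam 0 (y - x) := hne.mono fun y hy =>
        mul_nonneg (mul_nonneg (hqp y hy).le (h.sol_pos y hy).le) (gam_nonneg le_rfl _)
      rw [tp_ofReal_eq hq0, ← ofReal_integral_eq_lintegral_ofReal hi hn,
        ← ENNReal.ofReal_add (integral_nonneg_of_ae hn) (by positivity), ← integral_congr_ae e,
        integral_const_mul, ← mul_add]
      refine ENNReal.ofReal_le_ofReal ?_
      rw [inv_mul_eq_div, le_div_iff₀ hk, mul_comm]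
      exact hHle x hx)
    (fun x hx => by
      have := hSsup.tp_le (q := q) (k := S) hN hq0 (fun y hy => by
        have hd := (hS.contDiffAt (isOpen_ne_zero.mem_nhds hy)).d2At
        rw [← mul_assoc, hkq, lap_sub hd contDiffAt_const.d2At, lap_const, sub_zero]
        exact hSeq y hy) hx
      refine (add_le_add_left this 1).trans (le_of_eq ?_)
      rw [← ENNReal.ofReal_one, ← ENNReal.ofReal_add (by linarith [hS1 x hx]) zero_le_one,
        sub_add_cancel])
  have hpot := isPot_of_tp_eq hN hqm (fun y hy => (hqp y hy).le) hqc h.isSuper hvm hfix hvu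
  have hfin : ∀ x, x ≠ 0 → v x ≠ ∞ := fun x hx =>
    ((hvu x hx).trans_lt ENNReal.ofReal_lt_top).ne
  obtain ⟨γ, hγ, hγ1, hVh⟩ := h.holder
  have hv2 := hpot.contDiffOn_two hN hγ hγ1 (hVh.const_mul μ) (fun y _ => by
    rw [← mul_assoc, hkq])
  have hle : ∀ x, x ≠ 0 → (v x).toReal ≤ u x := fun x hx =>
    ENNReal.toReal_le_of_le_ofReal (h.sol_pos x hx).le (hvu x hx)
  have hSb : ∀ x, x ≠ 0 → u x - (v x).toReal ≤ (kap N)⁻¹ * H * S x := fun x hx => by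
    have h1 := huv x hx
    rw [← ENNReal.ofReal_toReal (hfin x hx), ← ENNReal.ofReal_mul (by positivity),
      ← ENNReal.ofReal_add ENNReal.toReal_nonneg (by have := hS1 x hx; positivity)] at h1
    have := (ENNReal.ofReal_le_ofReal_iff (by have := hS1 x hx; positivity)).1 h1
    linarith
  refine ⟨fun x => (v x).toReal, hv2, fun x hx => ?_, fun _ _ => ENNReal.toReal_nonneg, hle,
    fun R => ?_, fun x hx => ?_⟩
  · rw [hpot.neg_lap_eq hN hv2 ((hqc.mul hv2.continuousOn).const_smul (kap N)) hx, ← mul_assoc, hkq]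
  · obtain ⟨M, hM⟩ := ((isCompact_closedBall (0 : Euc N) R).diff
      (isOpen_ball (x := (0 : Euc N)) (ε := 1))).exists_bound_of_continuousOn
      (h.contDiffOn.continuousOn.mono (by rintro y hy rfl; simp at hy))
    set m := ((N : ℝ) - 2) / 2 with hm
    have hm0 : 0 < m := by
      have : (3 : ℝ) ≤ N := by exact_mod_cast hN
      rw [hm]; linarith
    refine ⟨max ((kap N)⁻¹ * H * C) (M * R ^ m), fun x hx hR => ?_⟩
    have hp := norm_pos_iff.2 hx
    rw [abs_of_nonneg (by linarith [hle x hx])]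
    by_cases h1 : ‖x‖ < 1
    · refine (hSb x hx).trans ?_
      calc (kap N)⁻¹ * H * S x ≤ (kap N)⁻¹ * H * (C * ‖x‖ ^ (-m)) := by
            gcongr; exact hSC x hx (by linarith)
        _ = ((kap N)⁻¹ * H * C) * ‖x‖ ^ (-m) := by ring
        _ ≤ _ := by gcongr; exact le_max_left _ _
    · have hMx := hM x ⟨mem_closedBall_zero_iff.2 hR.le, by simpa using h1⟩
      have hM0 : 0 ≤ M := (norm_nonneg _).trans hMx
      calc u x - (v x).toReal ≤ M := by
            have := (le_abs_self _).trans hMx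
            have h0 : 0 ≤ (v x).toReal := ENNReal.toReal_nonneg
            linarith
        _ = M * (‖x‖ ^ m * ‖x‖ ^ (-m)) := by rw [← Real.rpow_add hp]; simp
        _ ≤ M * (R ^ m * ‖x‖ ^ (-m)) := by gcongr
        _ = M * R ^ m * ‖x‖ ^ (-m) := by ring
        _ ≤ _ := by gcongr; exact le_max_right _ _
  · rw [ENNReal.ofReal_toReal (hfin x hx), ← hfix x hx]
    exact tp_congr_ae (hne.mono fun y hy => ENNReal.ofReal_toReal (hfin y hy))

end IsSetting

end

section

open scoped Topology ENNReal

variable {N : ℕ}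

lemma cMu_pos (hN : 3 ≤ N) {μ : ℝ} (hμ : μ < mu0 N) : 0 < cMu N μ := by
  have hN0 : (0 : ℝ) < N := by exact_mod_cast (by omega : 0 < N)
  have h1 : 0 < √(mu0 N - μ) := Real.sqrt_pos.2 (sub_pos.2 hμ)
  have h2 : 0 < (volume (ball (0 : Euc N) 1)).toReal :=
    ENNReal.toReal_pos (measure_ball_pos _ _ one_pos).ne' measure_ball_lt_top.ne
  rw [cMu, if_pos hμ, sphereArea]
  positivity

lemma exists_isC11c_one : ∃ ξ : Euc N → ℝ, IsC11c ξ ∧ ξ 0 = 1 := by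
  obtain ⟨ξ, h1, h2, -, h3, -⟩ := exists_cutoff (isCompact_singleton (x := (0 : Euc N)))
    isOpen_univ (Set.subset_univ _)
  exact ⟨ξ, isC11c_of_contDiff h1 h2, (eventually_nhdsSet_iff_forall.1 h3 0 rfl).self_of_nhds⟩

namespace IsSetting

variable {μ k : ℝ} {V u : Euc N → ℝ}

/-- The minimal solution is a fixed point of the integral operator. -/
lemma tp_eq_of_minimal (h : IsSetting μ V u) (hk : 0 < k) (hid : DistribIdentity N μ V u k)
    (hmin : ∀ v : Euc N → ℝ, (∀ x, x ≠ 0 → 0 < v x) → IsSolution N μ V v →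
      DistribIdentity N μ V v k → ∀ x, x ≠ 0 → u x ≤ v x) {x : Euc N} (hx : x ≠ 0) :
    tp (fun y => (kap N)⁻¹ * (μ * V y)) (fun y => ENNReal.ofReal (u y)) x
      = ENNReal.ofReal (u x) := by
  have hN := h.three_le
  have hne := ae_ne_point hN (0 : Euc N)
  obtain ⟨v, hv, hveq, hv0, hvu, hb, hfix⟩ := h.exists_minimal_solution
  have hvid : DistribIdentity N μ V v k := fun ξ hξ => by
    have hw2 : ContDiffOn ℝ 2 (fun x => u x - v x) {x | x ≠ 0} := h.contDiffOn.sub hv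
    have hweq : ∀ x, x ≠ 0 → -lap (fun x => u x - v x) x = μ * V x * (u x - v x) := fun x hx => by
      have hX := isOpen_ne_zero.mem_nhds (x := x) hx
      rw [lap_sub (h.contDiffOn.contDiffAt hX).d2At (hv.contDiffAt hX).d2At]
      linarith [h.neg_lap_eq x hx, hveq x hx]
    obtain ⟨h1, h2⟩ := integral_mul_LstarMuV_eq_zero hN h.lt h.measurable_pot
      (fun x hx => ⟨(h.pot_pos x hx).le, h.pot_le x hx⟩) hw2 hweq hb hξ
    rw [← hid ξ hξ]
    have e : (fun x => u x * LstarMuV N μ V ξ x * ‖x‖ ^ tauPlus N μ) = fun x =>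
        v x * LstarMuV N μ V ξ x * ‖x‖ ^ tauPlus N μ
        + (u x - v x) * LstarMuV N μ V ξ x * ‖x‖ ^ tauPlus N μ := by
      ext x; ring
    by_cases hi : Integrable fun x => v x * LstarMuV N μ V ξ x * ‖x‖ ^ tauPlus N μ
    · rw [e, integral_add hi h1, h2, add_zero]
    · rw [integral_undef hi, integral_undef fun hi' => hi ?_]
      refine (hi'.sub h1).congr (.of_forall fun x => ?_)
      simp only [Pi.sub_apply]
      ring
  have hpos : ∀ x, x ≠ 0 → 0 < v x := fun x hx => by
    refine (hv0 x hx).lt_of_ne fun h0 => ?_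
    have hz := hfix x hx
    have hvm : Measurable v := measurable_of_continuousOn_compl_singleton 0 hv.continuousOn
    have hm : Measurable fun y => ENNReal.ofReal ((kap N)⁻¹ * (μ * V y) * gam 0 (y - x))
        * ENNReal.ofReal (v y) :=
      (measurable_kernel ((h.measurable_pot.const_mul _).const_mul _) x).mul hvm.ennreal_ofReal
    rw [← h0, ENNReal.ofReal_zero, tp, lintegral_eq_zero_iff hm] at hz
    have hvz : ∀ᵐ y, v y = 0 := by
      filter_upwards [hz, hne, ae_ne_point hN x] with y hy h1 h2
      have hq : 0 < (kap N)⁻¹ * (μ * V y) * gam 0 (y - x) :=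
        mul_pos (mul_pos (inv_pos.2 (kap_pos hN)) (mul_pos h.pos (h.pot_pos y h1)))
          (gam_pos (pos_add_normSq le_rfl (sub_ne_zero.2 h2)))
      have := (mul_eq_zero.1 hy).resolve_left (ENNReal.ofReal_pos.2 hq).ne'
      exact le_antisymm (ENNReal.ofReal_eq_zero.1 this) (hv0 y h1)
    obtain ⟨ξ, hξ, hξ0⟩ := exists_isC11c_one (N := N)
    have h3 := hvid ξ hξ
    rw [integral_eq_zero_of_ae (hvz.mono fun y hy => by simp [hy]), hξ0] at h3
    exact (mul_pos (cMu_pos hN h.lt) hk).ne (by linarith)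
  have huv : ∀ x, x ≠ 0 → u x = v x := fun x hx =>
    le_antisymm (hmin v hpos ⟨hv, fun x hx => by linarith [hveq x hx]⟩ hvid x hx) (hvu x hx)
  rw [huv x hx, ← hfix x hx]
  exact tp_congr_ae (hne.mono fun y hy => by rw [huv y hy])

end IsSetting

end

section

open scoped Topology ENNReal

variable {N : ℕ}

lemma lap_pw_one (a : ℝ) (x : Euc N) : lap (pw 1 a) x = 2 * a * (2 * a - 2 + N) * pw 1 (a - 1) x
    - 4 * a * (a - 1) * pw 1 (a - 2) x := by
  have h : 0 < 1 + ‖x‖ ^ 2 := by positivity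
  have e : (1 + ‖x‖ ^ 2) ^ (a - 1) = (1 + ‖x‖ ^ 2) ^ (a - 2) * (1 + ‖x‖ ^ 2) := by
    rw [← Real.rpow_add_one h.ne']; ring_nf
  rw [lap_pw h, pw, pw, e]
  ring

lemma pw_one_mono {a b : ℝ} (h : a ≤ b) (x : Euc N) : pw 1 a x ≤ pw 1 b x :=
  Real.rpow_le_rpow_of_exponent_le (by nlinarith [sq_nonneg ‖x‖]) h

/-- The Newtonian potential of an integrable power at infinity decays like the fundamental
solution. -/
lemma exists_potential_le (hN : 3 ≤ N) {e : ℝ} (he : 0 < e) (he1 : e ≤ 1 / 2) :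
    ∃ C, 0 < C ∧ ∀ y : Euc N, y ≠ 0 → ∫⁻ x, ENNReal.ofReal (gam 0 (x - y)) *
      {x | 1 ≤ ‖x‖}.indicator (fun x => ENNReal.ofReal (‖x‖ ^ (-(N + e)))) x
        ≤ ENNReal.ofReal (C * gam 1 y) := by
  have h3 : (3 : ℝ) ≤ N := by exact_mod_cast hN
  have hk := kap_pos hN
  set a : ℝ := 1 - N / 2 with ha
  set b : ℝ := (2 - N - e) / 2 with hb
  have hba : b ≤ a := by rw [ha, hb]; linarith
  have hs : ∀ x : Euc N, D2At (pw 1 a) x ∧ D2At (fun y : Euc N => 1 / 2 * pw 1 b y) x := fun x =>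
    ⟨(contDiff_pw one_pos).contDiffAt.d2At,
      (contDiff_const.mul (contDiff_pw one_pos)).contDiffAt.d2At⟩
  have hlap : ∀ x : Euc N, 1 / 2 * e * (N - 2) * pw 1 (-((N + e) / 2)) x
      ≤ -lap (fun y => pw 1 a y - 1 / 2 * pw 1 b y) x := fun x => by
    rw [lap_sub (hs x).1 (hs x).2, lap_const_mul _ (contDiff_pw one_pos).contDiffAt.d2At,
      lap_pw_one, lap_pw_one]
    have h1 := pw_one_mono (x := x) (show b - 2 ≤ a - 2 by linarith)
    have h2 : 0 ≤ pw 1 (b - 2) x := pw_nonneg zero_le_one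
    have h4 : 0 ≤ pw 1 (-((N + e) / 2)) x := pw_nonneg zero_le_one
    have e1 : b - 1 = -((N + e) / 2) := by rw [hb]; ring
    have e2 : 2 * a - 2 + N = 0 := by rw [ha]; ring
    have e3 : 4 * a * (a - 1) = N * (N - 2) := by rw [ha]; ring
    have e4 : 2 * b * (2 * b - 2 + N) = e * (N - 2 + e) := by rw [hb]; ring
    have e5 : 4 * b * (b - 1) = (N - 2 + e) * (N + e) := by rw [hb]; ring
    rw [e3, e4, e5, e1, e2]
    have h5 : (1 : ℝ) / 2 * ((N - 2 + e) * (N + e)) ≤ N * (N - 2) := by nlinarith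
    have h6 := mul_le_mul_of_nonneg_right h5 h2
    have h7 : (0 : ℝ) ≤ N * (N - 2) := by nlinarith
    have h8 := mul_le_mul_of_nonneg_left h1 h7
    have h9 : 0 ≤ e * e * pw 1 (-((N + e) / 2)) x := by positivity
    linarith
  have hD : IsSuper fun y : Euc N => pw 1 a y - 1 / 2 * pw 1 b y := by
    refine ⟨((contDiff_pw one_pos).sub (contDiff_const.mul (contDiff_pw one_pos))).contDiffOn,
      fun y _ => ?_, fun y _ => ?_⟩
    · have h1 := pw_one_mono (x := y) hba
      have h2 : 0 ≤ pw 1 b y := pw_nonneg zero_le_one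
      linarith
    · have h4 : 0 ≤ pw 1 (-((N + e) / 2)) y := pw_nonneg zero_le_one
      have h5 : 0 ≤ 1 / 2 * e * (N - 2) * pw 1 (-((N + e) / 2)) y :=
        mul_nonneg (mul_nonneg (by positivity) (by linarith)) h4
      linarith [hlap y]
  set c : ℝ := (kap N)⁻¹ * (1 / 2 * e * (N - 2)) with hc
  have hc0 : 0 < c := mul_pos (inv_pos.2 hk) (mul_pos (by positivity) (by linarith))
  set B : ℝ := c⁻¹ * 2 ^ ((N + e) / 2) with hB
  have hB0 : 0 < B := by positivity
  refine ⟨B, hB0, fun y hy => ?_⟩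
  have key := hD.tp_le (q := fun _ => 1) (k := fun x => c * pw 1 (-((N + e) / 2)) x) hN
    (.of_forall fun _ => zero_le_one) (fun x _ => by
      refine le_trans (le_of_eq ?_) (hlap x)
      rw [hc]; field_simp) hy
  calc _ ≤ ∫⁻ x, ENNReal.ofReal B * (ENNReal.ofReal (1 * gam 0 (x - y)) *
          ENNReal.ofReal (c * pw 1 (-((N + e) / 2)) x)) := by
        refine lintegral_mono fun x => ?_
        by_cases hx : 1 ≤ ‖x‖
        · rw [Set.indicator_of_mem (s := {x : Euc N | 1 ≤ ‖x‖}) hx, one_mul, mul_left_comm, ← ENNReal.ofReal_mul hB0.le]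
          gcongr
          have hp : 0 < ‖x‖ := by linarith
          have h1 : (1 + ‖x‖ ^ 2) ≤ 2 * ‖x‖ ^ 2 := by nlinarith
          have h2 : (2 * ‖x‖ ^ 2) ^ (-((N + e) / 2)) ≤ (1 + ‖x‖ ^ 2) ^ (-((N + e) / 2)) :=
            Real.rpow_le_rpow_of_nonpos (by positivity) h1 (by
              have : 0 < (N + e) / 2 := by positivity
              linarith)
          have h4 : ((2 : ℝ) * ‖x‖ ^ 2) ^ (-((N + e) / 2))
              = (2 ^ ((N + e) / 2))⁻¹ * ‖x‖ ^ (-(N + e)) := by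
            rw [Real.mul_rpow (by norm_num) (by positivity), Real.rpow_neg (by norm_num),
              ← Real.rpow_natCast ‖x‖ 2, ← Real.rpow_mul hp.le]
            congr 2; push_cast; ring
          rw [h4] at h2
          calc ‖x‖ ^ (-(N + e)) = B * (c * ((2 ^ ((N + e) / 2))⁻¹ * ‖x‖ ^ (-(N + e)))) := by
                rw [hB]; field_simp
            _ ≤ _ := by gcongr; exact h2
        · rw [Set.indicator_of_notMem (s := {x : Euc N | 1 ≤ ‖x‖}) hx, mul_zero]
          exact zero_le
    _ = ENNReal.ofReal B * tp (fun _ => 1)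
          (fun x => ENNReal.ofReal (c * pw 1 (-((N + e) / 2)) x)) y :=
        lintegral_const_mul' _ _ ENNReal.ofReal_ne_top
    _ ≤ ENNReal.ofReal B * ENNReal.ofReal (gam 1 y) := by
        refine mul_le_mul_right (key.trans (ENNReal.ofReal_le_ofReal ?_)) _
        have h2 : 0 ≤ pw 1 b y := pw_nonneg zero_le_one
        have h3 : gam 1 y = pw 1 a y := rfl
        rw [h3]
        linarith
    _ = _ := (ENNReal.ofReal_mul hB0.le).symm

/-- The adjoint of the integral operator. -/
lemma lintegral_tp_mul {q : Euc N → ℝ} {f g : Euc N → ℝ≥0∞} (hq : Measurable q)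
    (hf : Measurable f) (hg : Measurable g) : ∫⁻ x, tp q f x * g x
      = ∫⁻ y, ENNReal.ofReal (q y) * f y * ∫⁻ x, ENNReal.ofReal (gam 0 (x - y)) * g x := by
  have hG : Measurable fun p : Euc N × Euc N => gam 0 (p.2 - p.1) :=
    (measurable_gam 0).comp (measurable_snd.sub measurable_fst)
  have hm : Measurable fun p : Euc N × Euc N =>
      ENNReal.ofReal (q p.2 * gam 0 (p.2 - p.1)) * f p.2 * g p.1 :=
    ((((hq.comp measurable_snd).mul hG).ennreal_ofReal).mul (hf.comp measurable_snd)).mul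
      (hg.comp measurable_fst)
  calc ∫⁻ x, tp q f x * g x
      = ∫⁻ x, ∫⁻ y, ENNReal.ofReal (q y * gam 0 (y - x)) * f y * g x := by
        refine lintegral_congr fun x => ?_
        exact (lintegral_mul_const _ ((measurable_kernel hq x).mul hf)).symm
    _ = ∫⁻ y, ∫⁻ x, ENNReal.ofReal (q y * gam 0 (y - x)) * f y * g x :=
        lintegral_lintegral_swap hm.aemeasurable
    _ = _ := by
        refine lintegral_congr fun y => ?_
        rw [← lintegral_const_mul]
        · refine lintegral_congr fun x => ?_
          rw [gam_comm_sub, ENNReal.ofReal_mul' (gam_nonneg le_rfl _)]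
          ring
        · exact (((measurable_gam 0).comp (by fun_prop)).ennreal_ofReal).mul hg

end

section

open scoped Topology ENNReal

variable {N : ℕ}

/-- A contraction principle: a subsolution of an integral inequality with small kernel is
dominated by the source term. -/
lemma le_of_le_add_tp {q : Euc N → ℝ} (hq : Measurable q) {A : Set (Euc N)} (hA : MeasurableSet A)
    {U G θ : Euc N → ℝ≥0∞} (hU : Measurable U) (hG : Measurable G) (hθ : Measurable θ) {c : ℝ≥0∞}
    (h1 : ∀ x ∈ A, U x ≤ c * G x + tp q (A.indicator U) x)
    (h2 : ∀ x ∈ A, tp q (A.indicator G) x ≤ 2⁻¹ * G x)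
    (h3 : ∀ y ∈ A, ENNReal.ofReal (q y) *
      ∫⁻ x, ENNReal.ofReal (gam 0 (x - y)) * A.indicator θ x ≤ 2⁻¹ * θ y)
    (h4 : ∫⁻ x, U x * A.indicator θ x ≠ ∞) (hθ0 : ∀ x ∈ A, θ x ≠ 0) :
    ∀ x ∈ A, U x ≤ 2 * c * G x := by
  set r : Euc N → ℝ≥0∞ := fun x => U x - 2 * c * G x with hr
  have hrm : Measurable r := hU.sub (hG.const_mul _)
  have hrA := hrm.indicator hA
  have hUr : ∀ y, A.indicator U y ≤ A.indicator r y + 2 * c * A.indicator G y := fun y => by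
    by_cases hy : y ∈ A
    · simpa [hy] using le_tsub_add
    · simp [hy]
  have hrK : ∀ x ∈ A, r x ≤ tp q (A.indicator r) x := fun x hx => by
    rw [hr, tsub_le_iff_right]
    calc U x ≤ c * G x + tp q (A.indicator U) x := h1 x hx
      _ ≤ c * G x + (tp q (A.indicator r) x + 2 * c * tp q (A.indicator G) x) := by
          gcongr
          rw [← tp_const_mul hq (hG.indicator hA), ← tp_add hq hrA]
          exact tp_mono_ae (.of_forall hUr)
      _ ≤ c * G x + (tp q (A.indicator r) x + 2 * c * (2⁻¹ * G x)) := by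
          gcongr; exact h2 x hx
      _ = c * G x + (tp q (A.indicator r) x + 2 * 2⁻¹ * (c * G x)) := by ring
      _ = tp q (A.indicator r) x + 2 * c * G x := by
          rw [ENNReal.mul_inv_cancel two_ne_zero ENNReal.ofNat_ne_top]; ring
  set I : ℝ≥0∞ := ∫⁻ x, A.indicator r x * A.indicator θ x with hI
  have hIfin : I ≠ ∞ := ne_top_of_le_ne_top h4 <| lintegral_mono fun x => by
    by_cases hx : x ∈ A
    · simp only [hx, Set.indicator_of_mem, hr]
      gcongr
      exact tsub_le_self
    · simp [hx]
  have hIle : I ≤ 2⁻¹ * I := by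
    calc I ≤ ∫⁻ x, tp q (A.indicator r) x * A.indicator θ x := lintegral_mono fun x => by
          by_cases hx : x ∈ A
          · simp only [hx, Set.indicator_of_mem]
            gcongr
            exact hrK x hx
          · simp [hx]
      _ = ∫⁻ y, ENNReal.ofReal (q y) * A.indicator r y *
          ∫⁻ x, ENNReal.ofReal (gam 0 (x - y)) * A.indicator θ x :=
          lintegral_tp_mul hq hrA (hθ.indicator hA)
      _ ≤ ∫⁻ y, 2⁻¹ * (A.indicator r y * A.indicator θ y) := lintegral_mono fun y => by
          by_cases hy : y ∈ A
          · simp only [hy, Set.indicator_of_mem]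
            rw [mul_right_comm, mul_comm (r y), ← mul_assoc]
            exact mul_le_mul_left (h3 y hy) _
          · simp [hy]
      _ = 2⁻¹ * I := lintegral_const_mul' _ _ (by simp)
  have hI0 : I = 0 := by
    by_contra h0
    have h5 : 2⁻¹ * I < I := by
      rw [mul_comm, ← div_eq_mul_inv]
      exact ENNReal.half_lt_self h0 hIfin
    exact absurd hIle (not_le.2 h5)
  have hr0 : ∀ᵐ y, A.indicator r y = 0 := by
    filter_upwards [(lintegral_eq_zero_iff (hrA.mul (hθ.indicator hA))).1 hI0] with y hy
    by_cases hyA : y ∈ A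
    · refine (mul_eq_zero.1 hy).resolve_right ?_
      simpa [hyA] using hθ0 y hyA
    · simp [hyA]
  intro x hx
  have h6 : tp q (A.indicator r) x = 0 := by
    rw [tp_congr_ae (g := fun _ => 0) hr0, tp]
    simp
  have h7 := hrK x hx
  rw [h6, nonpos_iff_eq_zero] at h7
  exact tsub_eq_zero_iff_le.1 h7

end

section

open scoped Topology ENNReal

variable {N : ℕ}

lemma gam_zero_le_of_half_le (hN : 3 ≤ N) {x z : Euc N} (hx : x ≠ 0) (h : ‖x‖ / 2 ≤ ‖z‖) :
    gam 0 z ≤ 4 ^ ((N : ℝ) / 2 - 1) * gam 0 x := by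
  have h3 : (3 : ℝ) ≤ N := by exact_mod_cast hN
  have hp := norm_pos_iff.2 hx
  have h1 : (‖x‖ ^ 2) / 4 ≤ 0 + ‖z‖ ^ 2 := by nlinarith
  have h2 := Real.rpow_le_rpow_of_nonpos (by positivity) h1 (show 1 - (N : ℝ) / 2 ≤ 0 by linarith)
  refine h2.trans (le_of_eq ?_)
  have e : (4 : ℝ) ^ ((N : ℝ) / 2 - 1) = (4 ^ (1 - (N : ℝ) / 2))⁻¹ := by
    rw [← Real.rpow_neg (by norm_num)]; ring_nf
  rw [Real.div_rpow (by positivity) (by norm_num), e, gam, pw, zero_add, div_eq_mul_inv, mul_comm]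

lemma gam_one_le (hN : 3 ≤ N) {x y : Euc N} (hx : ‖x‖ = 1) (hy : y ≠ x) :
    gam 1 y ≤ 2 ^ ((N : ℝ) / 2 - 1) * gam 0 (y - x) := by
  have h3 : (3 : ℝ) ≤ N := by exact_mod_cast hN
  have hp := norm_pos_iff.2 (sub_ne_zero.2 hy)
  have h0 : ‖y - x‖ ≤ ‖y‖ + 1 := hx ▸ norm_sub_le y x
  have h1 : 0 + ‖y - x‖ ^ 2 ≤ 2 * (1 + ‖y‖ ^ 2) := by
    nlinarith [sq_nonneg (‖y‖ - 1), norm_nonneg y]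
  have h2 := Real.rpow_le_rpow_of_nonpos (by positivity) h1 (show 1 - (N : ℝ) / 2 ≤ 0 by linarith)
  rw [Real.mul_rpow (by norm_num) (by positivity)] at h2
  have e : (2 : ℝ) ^ (1 - (N : ℝ) / 2) = (2 ^ ((N : ℝ) / 2 - 1))⁻¹ := by
    rw [← Real.rpow_neg (by norm_num)]; ring_nf
  rw [e, inv_mul_le_iff₀ (by positivity)] at h2
  exact h2

/-- A fixed point of the integral operator whose density decays fast enough decays like the
fundamental solution. -/
lemma exists_decay_of_tp_eq (hN : 3 ≤ N) {q u : Euc N → ℝ} (hq : Measurable q)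
    (hq0 : ∀ y, y ≠ 0 → 0 ≤ q y) {τ A R₀ : ℝ} (hτ : 2 < τ)
    (hA : ∀ y, y ≠ 0 → R₀ ≤ ‖y‖ → q y ≤ A * ‖y‖ ^ (-τ)) (hu : ContinuousOn u {x | x ≠ 0})
    (hfix : ∀ x, x ≠ 0 → tp q (fun y => ENNReal.ofReal (u y)) x = ENNReal.ofReal (u x)) :
    ∃ c, 0 < c ∧ ∀ x, 1 ≤ ‖x‖ → u x ≤ c * gam 0 x := by
  have h3 : (3 : ℝ) ≤ N := by exact_mod_cast hN
  have := nontrivial_euc hN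
  have hne := ae_ne_point hN (0 : Euc N)
  have hum : Measurable u := measurable_of_continuousOn_compl_singleton 0 hu
  obtain ⟨x₀, hx₀⟩ := exists_norm_eq (Euc N) zero_le_one
  have hx₀' : x₀ ≠ 0 := norm_pos_iff.1 (hx₀ ▸ one_pos)
  set e : ℝ := min ((τ - 2) / 2) (1 / 2) with he
  have he0 : 0 < e := lt_min (by linarith) (by norm_num)
  have heτ : 2 + 2 * e ≤ τ := by
    have : e ≤ (τ - 2) / 2 := min_le_left _ _
    linarith
  obtain ⟨C, hC, hCle⟩ := exists_potential_le hN he0 (min_le_right _ _)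
  obtain ⟨R, hR1, hRR, hRe⟩ : ∃ R : ℝ, 1 ≤ R ∧ R₀ ≤ R ∧ C * (|A| * R ^ (-e)) ≤ 1 / 2 := by
    have ht : Tendsto (fun R : ℝ => C * (|A| * R ^ (-e))) atTop (𝓝 (C * (|A| * 0))) :=
      ((tendsto_rpow_neg_atTop he0).const_mul _).const_mul _
    rw [mul_zero, mul_zero] at ht
    exact ((eventually_ge_atTop 1).and ((eventually_ge_atTop R₀).and
      (ht.eventually_le_const (by norm_num)))).exists
  set δ : ℝ := |A| * R ^ (-e) with hδ
  have hR0 : 0 < R := by linarith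
  have hδ0 : 0 ≤ δ := by positivity
  set E : Set (Euc N) := {y | R ≤ ‖y‖} with hE
  have hEm : MeasurableSet E := measurableSet_le measurable_const measurable_norm
  have hE0 : ∀ y ∈ E, y ≠ 0 := fun y hy => norm_pos_iff.1 (hR0.trans_le hy)
  set θ : Euc N → ℝ≥0∞ := fun x => ENNReal.ofReal (‖x‖ ^ (-(N + e))) with hθ
  have hθm : Measurable θ := (measurable_norm.pow_const _).ennreal_ofReal
  have hqE : ∀ y ∈ E, q y * gam 0 y ≤ δ * ‖y‖ ^ (-(N + e)) := fun y hy => by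
    have hyR : R ≤ ‖y‖ := hy
    have hy1 : 1 ≤ ‖y‖ := hR1.trans hyR
    have hp : 0 < ‖y‖ := by linarith
    have h5 : q y ≤ |A| * ‖y‖ ^ (-τ) := (hA y (hE0 y hy) (hRR.trans hyR)).trans (by
      gcongr; exact le_abs_self A)
    calc q y * gam 0 y ≤ |A| * ‖y‖ ^ (-τ) * ‖y‖ ^ ((2 : ℝ) - N) := by
          rw [gam_zero_eq]; gcongr
      _ = |A| * ‖y‖ ^ (-τ + (2 - N)) := by rw [Real.rpow_add hp]; ring
      _ ≤ |A| * ‖y‖ ^ (-e + -(N + e)) := by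
          exact mul_le_mul_of_nonneg_left
            (Real.rpow_le_rpow_of_exponent_le hy1 (by linarith)) (abs_nonneg A)
      _ = |A| * ‖y‖ ^ (-e) * ‖y‖ ^ (-(N + e)) := by rw [Real.rpow_add hp]; ring
      _ ≤ _ := by
          rw [hδ]
          gcongr |A| * ?_ * _
          exact Real.rpow_le_rpow_of_nonpos hR0 hyR (by linarith)
  have hpot : ∀ y, y ≠ 0 → ∫⁻ x, ENNReal.ofReal (gam 0 (x - y)) * E.indicator θ x
      ≤ ENNReal.ofReal (C * gam 1 y) := fun y hy => by
    refine (lintegral_mono fun x => ?_).trans (hCle y hy)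
    gcongr
    intro z hz
    exact hR1.trans hz
  have hg10 : ∀ y : Euc N, y ≠ 0 → gam 1 y ≤ gam 0 y := fun y hy =>
    gam_anti hN (pos_add_normSq le_rfl hy) zero_le_one
  set U : Euc N → ℝ≥0∞ := fun y => ENNReal.ofReal (u y) with hU
  have hUm : Measurable U := hum.ennreal_ofReal
  set J : ℝ≥0∞ := ∫⁻ y, ENNReal.ofReal (q y) * U y * ENNReal.ofReal (gam 1 y) with hJ
  have hJfin : J ≠ ∞ := by
    have h5 : J ≤ ENNReal.ofReal (2 ^ ((N : ℝ) / 2 - 1)) * tp q U x₀ := by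
      rw [tp, ← lintegral_const_mul' _ _ ENNReal.ofReal_ne_top]
      refine lintegral_mono_ae ((ae_ne_point hN x₀).mono fun y hy => ?_)
      rw [ENNReal.ofReal_mul' (gam_nonneg le_rfl _)]
      calc _ ≤ ENNReal.ofReal (q y) * U y *
            ENNReal.ofReal (2 ^ ((N : ℝ) / 2 - 1) * gam 0 (y - x₀)) := by
            gcongr; exact gam_one_le hN hx₀ hy
        _ = _ := by rw [ENNReal.ofReal_mul (by positivity)]; ring
    refine ne_top_of_le_ne_top ?_ h5
    rw [hfix x₀ hx₀']
    exact ENNReal.mul_ne_top ENNReal.ofReal_ne_top ENNReal.ofReal_ne_top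
  set B : ℝ := 4 ^ ((N : ℝ) / 2 - 1) * (1 + R ^ 2) ^ ((N : ℝ) / 2 - 1) with hB
  have hB0 : 0 < B := by positivity
  have hfar : ∀ x, 2 * R ≤ ‖x‖ → tp q (Eᶜ.indicator U) x
      ≤ ENNReal.ofReal (B * J.toReal * gam 0 x) := fun x hx => by
    have hx0 : x ≠ 0 := norm_pos_iff.1 (by linarith)
    have hgx : 0 ≤ gam 0 x := gam_nonneg le_rfl _
    calc tp q (Eᶜ.indicator U) x ≤ ∫⁻ y, ENNReal.ofReal (B * gam 0 x) *
          (ENNReal.ofReal (q y) * U y * ENNReal.ofReal (gam 1 y)) := by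
          refine lintegral_mono fun y => ?_
          by_cases hy : y ∈ E
          · simp [hy]
          · have hyR : ‖y‖ < R := not_le.1 hy
            rw [Set.indicator_of_mem hy, ENNReal.ofReal_mul' (gam_nonneg le_rfl _)]
            have h5 : gam 0 (y - x) ≤ 4 ^ ((N : ℝ) / 2 - 1) * gam 0 x := by
              refine gam_zero_le_of_half_le hN hx0 ?_
              have := norm_sub_norm_le x y
              rw [norm_sub_rev] at this
              linarith
            have h6 : 1 ≤ (1 + R ^ 2) ^ ((N : ℝ) / 2 - 1) * gam 1 y := by
              have h7 := Real.rpow_le_rpow_of_nonpos (by positivity)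
                (show 1 + ‖y‖ ^ 2 ≤ 1 + R ^ 2 by gcongr) (show 1 - (N : ℝ) / 2 ≤ 0 by linarith)
              calc (1 : ℝ) = (1 + R ^ 2) ^ ((N : ℝ) / 2 - 1) * (1 + R ^ 2) ^ (1 - (N : ℝ) / 2) := by
                    rw [← Real.rpow_add (by positivity)]; ring_nf; simp
                _ ≤ _ := by gcongr; exact h7
            have h8 : gam 0 (y - x) ≤ B * gam 0 x * gam 1 y := by
              calc gam 0 (y - x) ≤ 4 ^ ((N : ℝ) / 2 - 1) * gam 0 x * 1 := by rwa [mul_one]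
                _ ≤ 4 ^ ((N : ℝ) / 2 - 1) * gam 0 x *
                    ((1 + R ^ 2) ^ ((N : ℝ) / 2 - 1) * gam 1 y) := by gcongr
                _ = _ := by rw [hB]; ring
            calc _ ≤ ENNReal.ofReal (q y) * ENNReal.ofReal (B * gam 0 x * gam 1 y) * U y := by
                  gcongr
              _ = _ := by rw [ENNReal.ofReal_mul (by positivity)]; ring
      _ = ENNReal.ofReal (B * gam 0 x) * J := lintegral_const_mul' _ _ ENNReal.ofReal_ne_top
      _ = _ := by
          rw [← ENNReal.ofReal_toReal hJfin, ← ENNReal.ofReal_mul (by positivity),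
            ENNReal.toReal_ofReal ENNReal.toReal_nonneg]
          ring_nf
  obtain ⟨M, hM⟩ := ((isCompact_closedBall (0 : Euc N) (2 * R)).diff
    (isOpen_ball (x := (0 : Euc N)) (ε := 1))).exists_bound_of_continuousOn
    (hu.mono (by rintro y hy rfl; simp at hy))
  have hnear : ∀ x, 1 ≤ ‖x‖ → ‖x‖ ≤ 2 * R → u x ≤ |M| * (2 * R) ^ ((N : ℝ) - 2) * gam 0 x :=
    fun x h1 h2 => by
      have hp : 0 < ‖x‖ := by linarith
      have h5 := hM x ⟨mem_closedBall_zero_iff.2 h2, by simpa using h1⟩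
      have h6 : 1 ≤ (2 * R) ^ ((N : ℝ) - 2) * gam 0 x := by
        rw [gam_zero_eq]
        calc (1 : ℝ) = ‖x‖ ^ ((N : ℝ) - 2) * ‖x‖ ^ ((2 : ℝ) - N) := by
              rw [← Real.rpow_add hp]; simp
          _ ≤ _ := by gcongr; linarith
      calc u x ≤ |M| * 1 := by
            rw [mul_one]; exact (le_abs_self _).trans (h5.trans (le_abs_self _))
        _ ≤ |M| * ((2 * R) ^ ((N : ℝ) - 2) * gam 0 x) := by gcongr
        _ = _ := by ring
  set D : ℝ := max (B * J.toReal) (|M| * (2 * R) ^ ((N : ℝ) - 2)) + 1 with hD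
  have hDB : B * J.toReal ≤ D := (le_max_left _ _).trans (by linarith)
  have hDM : |M| * (2 * R) ^ ((N : ℝ) - 2) ≤ D := (le_max_right _ _).trans (by linarith)
  have hD0 : 0 < D := by
    have : 0 ≤ |M| * (2 * R) ^ ((N : ℝ) - 2) := by positivity
    have := le_max_right (B * J.toReal) (|M| * (2 * R) ^ ((N : ℝ) - 2))
    linarith
  have hg0 : ∀ x : Euc N, 0 ≤ gam 0 x := fun x => gam_nonneg le_rfl _
  have key := le_of_le_add_tp hq hEm (U := U) (G := fun x => ENNReal.ofReal (gam 0 x)) (θ := θ)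
    (c := ENNReal.ofReal D) hUm (measurable_gam 0).ennreal_ofReal hθm ?_ ?_ ?_ ?_ ?_
  · refine ⟨2 * D, by positivity, fun x hx => ?_⟩
    by_cases h : x ∈ E
    · have h5 := key x h
      rw [← ENNReal.ofReal_ofNat 2, ← ENNReal.ofReal_mul (by norm_num),
        ← ENNReal.ofReal_mul (by positivity)] at h5
      exact (ENNReal.ofReal_le_ofReal_iff (mul_nonneg (by positivity) (hg0 x))).1 h5
    · have h5 : ‖x‖ < R := not_le.1 h
      exact (hnear x hx (by linarith)).trans
        (mul_le_mul_of_nonneg_right (by linarith) (hg0 x))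
  · intro x hx
    rw [← ENNReal.ofReal_mul hD0.le]
    have hsplit : U x = tp q (Eᶜ.indicator U) x + tp q (E.indicator U) x := by
      rw [← tp_add hq (hUm.indicator hEm.compl)]
      refine (hfix x (hE0 x hx)).symm.trans (tp_congr_ae (.of_forall fun y => ?_))
      rw [add_comm]
      exact (congrFun (Set.indicator_self_add_compl E U) y).symm
    by_cases h : 2 * R ≤ ‖x‖
    · rw [hsplit]
      gcongr
      refine (hfar x h).trans (ENNReal.ofReal_le_ofReal ?_)
      exact mul_le_mul_of_nonneg_right hDB (hg0 x)
    · refine le_add_right (ENNReal.ofReal_le_ofReal ?_)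
      exact (hnear x (hR1.trans hx) (not_le.1 h).le).trans
        (mul_le_mul_of_nonneg_right hDM (hg0 x))
  · intro x hx
    have hx0 := hE0 x hx
    calc tp q (E.indicator fun x => ENNReal.ofReal (gam 0 x)) x
        ≤ ∫⁻ y, ENNReal.ofReal δ * (ENNReal.ofReal (gam 0 (y - x)) * E.indicator θ y) := by
          refine lintegral_mono fun y => ?_
          by_cases hy : y ∈ E
          · simp only [hy, Set.indicator_of_mem]
            calc _ = ENNReal.ofReal (gam 0 (y - x)) * ENNReal.ofReal (q y * gam 0 y) := by
                  rw [ENNReal.ofReal_mul' (hg0 (y - x)), ENNReal.ofReal_mul' (hg0 y)]; ring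
              _ ≤ ENNReal.ofReal (gam 0 (y - x)) * ENNReal.ofReal (δ * ‖y‖ ^ (-(N + e))) :=
                  mul_le_mul_right (ENNReal.ofReal_le_ofReal (hqE y hy)) _
              _ = _ := by rw [ENNReal.ofReal_mul hδ0]; ring
          · simp [hy]
      _ = ENNReal.ofReal δ * ∫⁻ y, ENNReal.ofReal (gam 0 (y - x)) * E.indicator θ y :=
          lintegral_const_mul' _ _ ENNReal.ofReal_ne_top
      _ ≤ ENNReal.ofReal δ * ENNReal.ofReal (C * gam 1 x) := by gcongr; exact hpot x hx0
      _ = ENNReal.ofReal (C * δ * gam 1 x) := by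
          rw [← ENNReal.ofReal_mul hδ0]; ring_nf
      _ ≤ ENNReal.ofReal (1 / 2 * gam 0 x) := by
          refine ENNReal.ofReal_le_ofReal ?_
          have h5 : 0 ≤ gam 1 x := gam_nonneg zero_le_one _
          exact mul_le_mul hRe (hg10 x hx0) h5 (by norm_num)
      _ = _ := by
          rw [ENNReal.ofReal_mul (by norm_num), one_div, ENNReal.ofReal_inv_of_pos two_pos]
          simp
  · intro y hy
    have hy0 := hE0 y hy
    calc _ ≤ ENNReal.ofReal (q y) * ENNReal.ofReal (C * gam 1 y) := by
          gcongr; exact hpot y hy0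
      _ = ENNReal.ofReal (q y * (C * gam 1 y)) := (ENNReal.ofReal_mul (hq0 y hy0)).symm
      _ ≤ ENNReal.ofReal (1 / 2 * ‖y‖ ^ (-(N + e))) := by
          refine ENNReal.ofReal_le_ofReal ?_
          calc q y * (C * gam 1 y) ≤ q y * (C * gam 0 y) := by
                have := hq0 y hy0
                gcongr; exact hg10 y hy0
            _ = C * (q y * gam 0 y) := by ring
            _ ≤ C * (δ * ‖y‖ ^ (-(N + e))) := mul_le_mul_of_nonneg_left (hqE y hy) hC.le
            _ = C * δ * ‖y‖ ^ (-(N + e)) := by ring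
            _ ≤ _ := mul_le_mul_of_nonneg_right hRe (by positivity)
      _ = _ := by
          rw [ENNReal.ofReal_mul (by norm_num), one_div, ENNReal.ofReal_inv_of_pos two_pos]
          simp [hθ]
  · refine ne_top_of_le_ne_top (ENNReal.mul_ne_top (ENNReal.ofReal_ne_top (r := C)) hJfin) ?_
    calc ∫⁻ x, U x * E.indicator θ x = ∫⁻ x, tp q U x * E.indicator θ x :=
          lintegral_congr_ae (hne.mono fun x hx => congrArg (· * _) (hfix x hx).symm)
      _ = ∫⁻ y, ENNReal.ofReal (q y) * U y *
          ∫⁻ x, ENNReal.ofReal (gam 0 (x - y)) * E.indicator θ x :=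
          lintegral_tp_mul hq hUm (hθm.indicator hEm)
      _ ≤ ∫⁻ y, ENNReal.ofReal C *
          (ENNReal.ofReal (q y) * U y * ENNReal.ofReal (gam 1 y)) := by
          refine lintegral_mono_ae (hne.mono fun y hy => ?_)
          rw [mul_left_comm, ← ENNReal.ofReal_mul hC.le]
          gcongr
          exact hpot y hy
      _ = _ := lintegral_const_mul' _ _ ENNReal.ofReal_ne_top
  · intro x hx
    have := norm_pos_iff.2 (hE0 x hx)
    exact (ENNReal.ofReal_pos.2 (by positivity)).ne'

end

/-- Theorem 4.1 (ii): decay of the minimal fundamental solution when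
limsup_{|x|→∞} V(x)|x|^τ < +∞ for some τ > 2. -/
theorem minimal_solution_decay_fast
    (N : ℕ) (hN : 3 ≤ N) (μ : ℝ) (hμ : 0 < μ) (hμ0 : μ < mu0 N)
    (γ : ℝ) (hγ : 0 < γ ∧ γ < 1) (V : Euc N → ℝ)
    (hVreg : LocHolderOn γ {x : Euc N | x ≠ 0} V)
    (hVpos : ∀ x : Euc N, x ≠ 0 → 0 < V x)
    (c₅ : ℝ) (hc₅ : 0 < c₅)
    (hV : ∀ x : Euc N, x ≠ 0 → ‖x‖ ^ (-2 : ℝ) - c₅ ≤ V x ∧ V x ≤ ‖x‖ ^ (-2 : ℝ))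
    (τ : ℝ) (hτ : 2 < τ)
    (hVinf : IsBoundedUnder (· ≤ ·) (normAtTop N) (fun x : Euc N => V x * ‖x‖ ^ τ))
    (k : ℝ) (hk : 0 < k) (u : Euc N → ℝ)
    (hupos : ∀ x : Euc N, x ≠ 0 → 0 < u x)
    (husol : IsSolution N μ V u)
    (huid : DistribIdentity N μ V u k)
    (humin : ∀ v : Euc N → ℝ, (∀ x : Euc N, x ≠ 0 → 0 < v x) → IsSolution N μ V v →
      DistribIdentity N μ V v k → ∀ x : Euc N, x ≠ 0 → u x ≤ v x) :
    ∃ c₇ : ℝ, 0 < c₇ ∧ ∀ x : Euc N, 1 ≤ ‖x‖ → u x ≤ c₇ * ‖x‖ ^ ((2 : ℝ) - N) := by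
  have hdecay : ∃ τ A R₀ : ℝ, 2 < τ ∧ ∀ x : Euc N, x ≠ 0 → R₀ ≤ ‖x‖ → V x ≤ A * ‖x‖ ^ (-τ) := by
    obtain ⟨b, hb⟩ := hVinf.eventually_le
    obtain ⟨R₀, hR₀⟩ := eventually_atTop.1 (eventually_comap.1 hb)
    refine ⟨τ, b, R₀, hτ, fun x hx hxR => ?_⟩
    have hp := norm_pos_iff.2 hx
    rw [Real.rpow_neg hp.le, ← div_eq_mul_inv, le_div_iff₀ (by positivity)]
    exact hR₀ _ hxR x rfl
  have h : IsSetting μ V u :=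
    ⟨hN, hμ, hμ0, ⟨γ, hγ.1, hγ.2.le, hVreg⟩, hVpos, fun x hx => (hV x hx).2,
      ⟨c₅, fun x hx => (hV x hx).1⟩, hdecay, hupos, husol.1, fun x hx => by
        linarith [husol.2 x hx]⟩
  have hκ := kap_pos hN
  obtain ⟨σ, A, R₀, hσ, hA⟩ := hdecay
  obtain ⟨c, hc, hle⟩ := exists_decay_of_tp_eq hN (q := fun y => (kap N)⁻¹ * (μ * V y))
    ((h.measurable_pot.const_mul _).const_mul _)
    (fun y hy => by have := hVpos y hy; positivity) hσ (A := (kap N)⁻¹ * (μ * A)) (R₀ := R₀)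
    (fun y hy hyR => by
      have := hA y hy hyR
      calc _ ≤ (kap N)⁻¹ * (μ * (A * ‖y‖ ^ (-σ))) := by gcongr
        _ = _ := by ring)
    husol.1.continuousOn (fun x hx => h.tp_eq_of_minimal hk huid humin hx)
  exact ⟨c, hc, fun x hx => by simpa only [gam_zero_eq] using hle x hx⟩
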